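/- arXiv:1812.10207 — 3 statements merged into one kernel-verified Lean document; each statement's English description precedes it below -/
import Mathlib

section
/- Let (γ,ν): (I,t₀) → ℝ² × S¹ be a Legendre curve with ν(t)=(cos φ(t), sin φ(t)) and curvature (φ̇,β), and assume β(t₀) = 0. Then: (1) γ has a 3/2-cusp at t₀ if and only if β̇(t₀)φ̇(t₀) ≠ 0; (2) γ has a 5/2-cusp at t₀ if and only if β̇(t₀) ≠ 0, φ̇(t₀) = 0 and β̈(t₀)φ̈(t₀) − β̇(t₀)φ⃛(t₀) ≠ 0. -/
open Real

/-- `f` is a germ of diffeomorphism at `p`, sending `p` to `q`: `f` is smooth near `p`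
and has a smooth local inverse near `q`. -/
def DiffeoGermAt {E F : Type*} [NormedAddCommGroup E] [NormedSpace ℝ E]
    [NormedAddCommGroup F] [NormedSpace ℝ F] (f : E → F) (p : E) (q : F) : Prop :=
  f p = q ∧ ∃ (U : Set E) (V : Set F) (g : F → E),
    IsOpen U ∧ p ∈ U ∧ IsOpen V ∧ q ∈ V ∧
    ContDiffOn ℝ (⊤ : ℕ∞) f U ∧ ContDiffOn ℝ (⊤ : ℕ∞) g V ∧
    Set.MapsTo f U V ∧ Set.MapsTo g V U ∧
    (∀ p' ∈ U, g (f p') = p') ∧ (∀ q' ∈ V, f (g q') = q')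

/-- A plane curve `γ` has a `j/i`-cusp at `t₀` if it is 𝒜-equivalent at `t₀` to the
germ `t ↦ (tⁱ, tʲ)` at `0`. -/
def HasCuspAt (γ : ℝ → ℝ × ℝ) (t₀ : ℝ) (i j : ℕ) : Prop :=
  ∃ (φ : ℝ → ℝ) (Ψ : ℝ × ℝ → ℝ × ℝ),
    DiffeoGermAt φ t₀ 0 ∧ DiffeoGermAt Ψ (γ t₀) (0, 0) ∧
    ∀ᶠ t in nhds t₀, Ψ (γ t) = (φ t ^ i, φ t ^ j)

open Filter Topology Set
open scoped ContDiff

lemma chain_contDiff (G : ℕ → ℝ → ℝ) (h : ∀ n u, HasDerivAt (G n) (G (n+1) u) u) :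
    ContDiff ℝ ∞ (G 0) ∧ ∀ n, iteratedDeriv n (G 0) = G n := by
  have h1 : ∀ n, iteratedDeriv n (G 0) = G n := by
    intro n
    induction n with
    | zero => simp
    | succ n ih => 
      rw [iteratedDeriv_succ, ih]; ext u; exact (h n u).deriv
  refine ⟨?_, h1⟩
  apply contDiff_of_differentiable_iteratedDeriv (n := ⊤)
  intro m _
  rw [h1]
  exact fun u => (h m u).differentiableAt

lemma hasDerivAt_iter {f : ℝ → ℝ} (hf : ContDiff ℝ ∞ f) (n : ℕ) (u : ℝ) :
    HasDerivAt (iteratedDeriv n f) (iteratedDeriv (n+1) f u) u := by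
  rw [iteratedDeriv_succ]
  refine DifferentiableAt.hasDerivAt ?_
  exact (hf.differentiable_iteratedDeriv n (by exact_mod_cast ENat.natCast_lt_top n)) u

lemma iter_cont {f : ℝ → ℝ} (hf : ContDiff ℝ ∞ f) (n : ℕ) : Continuous (iteratedDeriv n f) :=
  continuous_iff_continuousAt.2 fun u => (hasDerivAt_iter hf n u).continuousAt

/-- Hadamard's lemma -/
lemma hadamard {f : ℝ → ℝ} (hf : ContDiff ℝ ∞ f) (a : ℝ) (ha : f a = 0) :
    ∃ g : ℝ → ℝ, ContDiff ℝ ∞ g ∧ ∀ t, f t = (t - a) * g t := by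
  let G : ℕ → ℝ → ℝ := fun n t => ∫ u in (0:ℝ)..1, u ^ n * iteratedDeriv (n+1) f (a + u * (t - a))
  have hG : ∀ n t, HasDerivAt (G n) (G (n+1) t) t := by
    intro n t
    have hc : Continuous (fun p : ℝ × ℝ => p.2 ^ (n+1) * iteratedDeriv (n+1+1) f (a + p.2 * (p.1 - a))) := by
      have := iter_cont hf (n+1+1)
      fun_prop
    have hc0 : Continuous (fun p : ℝ × ℝ => p.2 ^ n * iteratedDeriv (n+1) f (a + p.2 * (p.1 - a))) := by
      have := iter_cont hf (n+1)
      fun_prop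
    obtain ⟨C, hC⟩ := ((isCompact_Icc (a := t - 1) (b := t+1)).prod
      (isCompact_Icc (a := (0:ℝ)) (b := 1))).exists_bound_of_continuousOn hc.continuousOn
    refine (intervalIntegral.hasDerivAt_integral_of_dominated_loc_of_deriv_le
      (F := fun t u => u ^ n * iteratedDeriv (n+1) f (a + u * (t - a)))
      (F' := fun t u => u ^ (n+1) * iteratedDeriv (n+1+1) f (a + u * (t - a)))
      (s := Icc (t-1) (t+1)) (bound := fun _ => C) (Icc_mem_nhds (by linarith) (by linarith)) 
      ?_ ?_ ?_ ?_ ?_ ?_).2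
    · exact Eventually.of_forall fun x => (hc0.comp (by fun_prop : Continuous fun u : ℝ => (x, u))).aestronglyMeasurable
    · exact (hc0.comp (by fun_prop : Continuous fun u : ℝ => (t, u))).intervalIntegrable _ _
    · exact (hc.comp (by fun_prop : Continuous fun u : ℝ => (t, u))).aestronglyMeasurable
    · refine Eventually.of_forall fun u hu x hx => ?_
      rw [uIoc_of_le zero_le_one] at hu
      exact hC (x, u) ⟨hx, hu.1.le, hu.2⟩
    · exact intervalIntegrable_const
    · refine Eventually.of_forall fun u hu x hx => ?_
      have h1 : HasDerivAt (fun x => a + u * (x - a)) u x := by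
        simpa using (((hasDerivAt_id x).sub_const a).const_mul u).const_add a
      have := ((hasDerivAt_iter hf (n+1) (a + u * (x - a))).comp x h1).const_mul (u ^ n)
      convert! this using 1
      ring
  refine ⟨G 0, (chain_contDiff G hG).1, fun t => ?_⟩
  have h2 : ∀ u ∈ uIcc (0:ℝ) 1, HasDerivAt (fun u => f (a + u * (t - a))) 
      (iteratedDeriv 1 f (a + u * (t - a)) * (t - a)) u := by
    intro u _
    have h1 : HasDerivAt (fun u => a + u * (t - a)) (t - a) u := by
      simpa using ((hasDerivAt_id u).mul_const (t-a)).const_add a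
    have h0 := hasDerivAt_iter hf 0 (a + u * (t - a))
    rw [iteratedDeriv_zero] at h0
    exact h0.comp u h1
  have := intervalIntegral.integral_eq_sub_of_hasDerivAt h2 (by
    have := iter_cont hf 1
    apply Continuous.intervalIntegrable; fun_prop)
  rw [intervalIntegral.integral_mul_const] at this
  simp [ha] at this
  simp only [G, pow_zero, one_mul, zero_add, iteratedDeriv_one]
  linarith

lemma compact_bound {f : ℝ → ℝ} (hf : ContDiff ℝ ∞ f) (hs : HasCompactSupport f) (n : ℕ) :
    ∃ C, 0 ≤ C ∧ ∀ u, |iteratedDeriv n f u| ≤ C := by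
  have hs' : HasCompactSupport (iteratedDeriv n f) := by
    rw [iteratedDeriv_eq_equiv_comp]
    exact (hs.iteratedFDeriv n).comp_left (by simp)
  obtain ⟨C, hC⟩ := hs'.exists_bound_of_continuous (iter_cont hf n)
  exact ⟨C, (norm_nonneg _).trans (hC 0), hC⟩
lemma borel_piece (c : ℝ) (k : ℕ) : ∃ f : ℝ → ℝ, ContDiff ℝ ∞ f ∧ HasCompactSupport f ∧
    (∀ n < k, ∀ u, |iteratedDeriv n f u| ≤ (1/2) ^ k) ∧
    ∀ n, iteratedDeriv n f 0 = if n = k then c else 0 := by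
  let χ : ContDiffBump (0:ℝ) := ⟨1, 2, by norm_num, by norm_num⟩
  let P : ℝ → ℝ := fun w => (c / k.factorial) * (w ^ k * χ w)
  have hP : ContDiff ℝ ∞ P := contDiff_const.mul ((contDiff_id.pow k).mul χ.contDiff)
  have hPs : HasCompactSupport P := (χ.hasCompactSupport.mul_left).mul_left
  have hP0 : ∀ n, iteratedDeriv n P 0 = if n = k then c else 0 := by
    intro n
    have : P =ᶠ[𝓝 0] fun w => (c / k.factorial) * w ^ k := by
      filter_upwards [χ.eventuallyEq_one] with w hw
      simp [P, hw]
    rw [this.iteratedDeriv_eq, iteratedDeriv_const_mul_field]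
    have h2 : iteratedDeriv n (fun w : ℝ => w ^ k) 0 = if n = k then (k.factorial : ℝ) else 0 := by
      simp only [iteratedDeriv_eq_iterate, iter_deriv_pow]
      rcases lt_trichotomy n k with h | h | h
      · simp [h.ne, (Nat.sub_pos_of_lt h).ne']
      · subst h
        simp only [Nat.sub_self, pow_zero, mul_one, if_true]
        rw [← Nat.descFactorial_self, Nat.descFactorial_eq_prod_range, Nat.cast_prod]
        refine Finset.prod_congr rfl fun i hi => ?_
        rw [Nat.cast_sub (Finset.mem_range.1 hi).le]
      · simp only [h.ne', if_false]
        rw [Finset.prod_eq_zero (Finset.mem_range.2 h) (sub_self _), zero_mul]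
    rw [h2]
    split_ifs
    · field_simp
    · simp
  choose C hC0 hC using compact_bound hP hPs
  let M := ∑ i ∈ Finset.range k, C i
  have hM : 0 ≤ M := Finset.sum_nonneg fun i _ => hC0 i
  let L : ℝ := 1 + 2 ^ k * M
  have hL1 : 1 ≤ L := by simp only [L]; nlinarith [pow_pos (zero_lt_two (α := ℝ)) k, mul_nonneg (pow_pos (zero_lt_two (α := ℝ)) k).le hM]
  have hL0 : L ≠ 0 := by linarith
  have hd : ∀ n u, iteratedDeriv n (fun u => (L⁻¹)^k * P (L * u)) u = (L⁻¹)^k * (L ^ n * iteratedDeriv n P (L * u)) := by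
    intro n u
    rw [iteratedDeriv_const_mul_field, iteratedDeriv_comp_const_mul (hP.of_le (by exact_mod_cast le_top))]
  refine ⟨fun u => (L⁻¹)^k * P (L * u), ?_, ?_, ?_, ?_⟩
  · exact contDiff_const.mul (hP.comp (contDiff_const.mul contDiff_id))
  · exact (hPs.comp_homeomorph (Homeomorph.mulLeft₀ L hL0)).mul_left
  · intro n hn u
    rw [hd, abs_mul, abs_mul, abs_of_pos (by positivity), abs_of_pos (by positivity)]
    have h1 : |iteratedDeriv n P (L * u)| ≤ M :=
      (hC n _).trans (Finset.single_le_sum (f := C) (fun i _ => hC0 i) (Finset.mem_range.2 hn))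
    have h2 : L⁻¹ ^ k * L ^ n ≤ L⁻¹ := by
      have : k = (k - 1 - n) + n + 1 := by omega
      have h3 : L⁻¹ ^ k * L ^ n = L⁻¹ ^ (k-1-n) * L⁻¹ := by
        nth_rw 1 [this]
        rw [pow_succ, pow_add, inv_pow L n]
        field_simp
      rw [h3]
      have : L⁻¹ ^ (k-1-n) ≤ 1 := pow_le_one₀ (by positivity) (inv_le_one_of_one_le₀ hL1)
      have h5 : 0 < L⁻¹ := by positivity
      nlinarith
    calc _ = (L⁻¹ ^ k * L ^ n) * |iteratedDeriv n P (L * u)| := by ring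
      _ ≤ L⁻¹ * M := by gcongr
      _ ≤ (1/2)^k := by
        rw [inv_mul_le_iff₀ (by linarith), one_div, inv_pow]
        simp only [L]
        have : (0:ℝ) < 2 ^ k := by positivity
        field_simp
        nlinarith
  · intro n
    rw [hd, mul_zero, hP0]
    split_ifs with h
    · subst h; rw [inv_pow]; field_simp
    · simp

lemma borel_lemma (c : ℕ → ℝ) : ∃ h : ℝ → ℝ, ContDiff ℝ ∞ h ∧ ∀ n, iteratedDeriv n h 0 = c n := by
  choose f hf hs hb h0 using fun k => borel_piece (c k) k
  choose C hC0 hC using fun k n => compact_bound (hf k) (hs k) n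
  let v : ℕ → ℕ → ℝ := fun n k => if n < k then (1/2)^k else C k n
  have hv : ∀ n, Summable (v n) := by
    intro n
    have : Summable fun k : ℕ => ((1:ℝ)/2)^k := summable_geometric_two
    refine (this.congr_cofinite ?_)
    rw [Nat.cofinite_eq_atTop]
    filter_upwards [eventually_gt_atTop n] with k hk
    simp [v, hk]
  have hbd : ∀ n k u, ‖iteratedDeriv n (f k) u‖ ≤ v n k := by
    intro n k u
    simp only [v]
    split_ifs with h
    · exact hb k n h u
    · exact hC k n u
  let G : ℕ → ℝ → ℝ := fun n u => ∑' k, iteratedDeriv n (f k) u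
  have hG : ∀ n u, HasDerivAt (G n) (G (n+1) u) u := by
    intro n u
    exact hasDerivAt_tsum (hv (n+1)) (fun k y => hasDerivAt_iter (hf k) n y) (hbd (n+1))
      (y₀ := 0) (.of_norm_bounded (hv n) (fun k => hbd n k 0)) u
  obtain ⟨h1, h2⟩ := chain_contDiff G hG
  refine ⟨G 0, h1, fun n => ?_⟩
  rw [h2]
  simp only [G, h0]
  rw [tsum_eq_single n]
  · simp
  · intro k hk; simp [hk.symm]

lemma even_step (k : {f : ℝ → ℝ // ContDiff ℝ ∞ f ∧ ∀ t, f (-t) = f t}) :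
    ∃ g : {f : ℝ → ℝ // ContDiff ℝ ∞ f ∧ ∀ t, f (-t) = f t}, ∀ t, HasDerivAt k.1 (2 * t * g.1 t) t := by
  obtain ⟨k, hk, he⟩ := k
  have hd : ContDiff ℝ ∞ (deriv k) := (contDiff_infty_iff_deriv.1 hk).2
  have hodd : ∀ t, deriv k (-t) = - deriv k t := by
    intro t
    have h1 : (fun t => k (-t)) = k := funext he
    have := deriv_comp_neg k t
    rw [h1] at this
    linarith
  obtain ⟨g, hg, hg2⟩ := hadamard hd 0 (by have := hodd 0; simp at this; linarith)
  have hev : ∀ t, t ≠ 0 → g (-t) = g t := by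
    intro t ht
    have h1 := hg2 t
    have h2 := hg2 (-t)
    rw [hodd] at h2
    have : t * (g (-t) - g t) = 0 := by linarith
    rcases mul_eq_zero.1 this with h | h
    · exact absurd h ht
    · linarith
  refine ⟨⟨fun t => g t / 2, hg.div_const 2, fun t => ?_⟩, fun t => ?_⟩
  · by_cases ht : t = 0
    · simp [ht]
    · simp [hev t ht]
  · have := (hk.differentiable (by simp) t).hasDerivAt
    rw [hg2 t] at this
    convert! this using 1
    ring

/-- Whitney's theorem on even functions. -/
lemma whitney_even (k : ℝ → ℝ) (hk : ContDiff ℝ ∞ k) (he : ∀ t, k (-t) = k t) :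
    ∃ g : ℝ → ℝ, ContDiff ℝ ∞ g ∧ ∀ t, k t = g (t ^ 2) := by
  choose D hD using even_step
  let K : ℕ → {f : ℝ → ℝ // ContDiff ℝ ∞ f ∧ ∀ t, f (-t) = f t} := fun n => D^[n] ⟨k, hk, he⟩
  have hK : ∀ n t, HasDerivAt (K n).1 (2 * t * (K (n+1)).1 t) t := by
    intro n t
    simp only [K, Function.iterate_succ_apply']
    exact hD _ t
  obtain ⟨h, hh, hh0⟩ := borel_lemma (fun n => (K n).1 0)
  let G : ℕ → ℝ → ℝ := fun n u => if 0 ≤ u then (K n).1 (√u) else iteratedDeriv n h u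
  have hGc : ∀ n, Continuous (G n) := by
    intro n
    refine Continuous.if_le ((K n).2.1.continuous.comp Real.continuous_sqrt) (iter_cont hh n) continuous_const continuous_id ?_
    intro u hu
    subst hu
    simp [hh0]
  have hG : ∀ n u, HasDerivAt (G n) (G (n+1) u) u := by
    intro n u
    refine hasDerivAt_of_hasDerivAt_of_ne' (x := 0) ?_ (hGc n).continuousAt (hGc (n+1)).continuousAt u
    intro y hy
    rcases hy.lt_or_gt with h1 | h1
    · have : G (n+1) y = iteratedDeriv (n+1) h y := by simp [G, h1]
      rw [this]
      refine (hasDerivAt_iter hh n y).congr_of_eventuallyEq ?_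
      filter_upwards [gt_mem_nhds h1] with z hz
      simp [G, hz]
    · have : G (n+1) y = (K (n+1)).1 (√y) := by simp [G, h1.le]
      rw [this]
      have h3 : HasDerivAt (fun y => (K n).1 (√y)) ((K (n+1)).1 (√y)) y := by
        have := (hK n (√y)).comp y (Real.hasDerivAt_sqrt h1.ne')
        convert! this using 1
        have := Real.sqrt_pos.2 h1
        field_simp
      refine h3.congr_of_eventuallyEq ?_
      filter_upwards [lt_mem_nhds h1] with z hz
      simp [G, hz.le]
  refine ⟨G 0, (chain_contDiff G hG).1, fun t => ?_⟩
  simp only [G, sq_nonneg, if_true, K, Function.iterate_zero, id, Real.sqrt_sq_eq_abs]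
  rcases abs_choice t with h | h
  · rw [h]
  · rw [h, he]
def SmoothNear {E F : Type*} [NormedAddCommGroup E] [NormedSpace ℝ E]
    [NormedAddCommGroup F] [NormedSpace ℝ F] (f : E → F) (p : E) : Prop :=
  ∀ᶠ y in 𝓝 p, ContDiffAt ℝ ∞ f y

section germs
variable {E F H : Type*} [NormedAddCommGroup E] [NormedSpace ℝ E]
    [NormedAddCommGroup F] [NormedSpace ℝ F] [NormedAddCommGroup H] [NormedSpace ℝ H]

lemma SmoothNear.at {f : E → F} {p : E} (h : SmoothNear f p) : ContDiffAt ℝ ∞ f p := h.self_of_nhds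

lemma ContDiff.smoothNear {f : E → F} (h : ContDiff ℝ ∞ f) (p : E) : SmoothNear f p :=
  Eventually.of_forall fun _ => h.contDiffAt

lemma SmoothNear.comp {f : E → F} {g : F → H} {p : E} {q : F} (hg : SmoothNear g q) (hf : SmoothNear f p)
    (h : f p = q) : SmoothNear (g ∘ f) p := by
  have hc := hf.at.continuousAt
  unfold ContinuousAt at hc
  rw [h] at hc
  filter_upwards [hf, hc.eventually hg] with y h1 h2
  exact h2.comp y h1

lemma diffeo_iff {f : E → F} {p : E} {q : F} : DiffeoGermAt f p q ↔
    f p = q ∧ SmoothNear f p ∧ ∃ g : F → E, g q = p ∧ SmoothNear g q ∧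
      (∀ᶠ y in 𝓝 p, g (f y) = y) ∧ (∀ᶠ y in 𝓝 q, f (g y) = y) := by
  constructor
  · rintro ⟨h, U, V, g, hU, hp, hV, hq, hf, hg, -, -, h1, h2⟩
    refine ⟨h, ?_, g, ?_, ?_, ?_, ?_⟩
    · filter_upwards [hU.mem_nhds hp] with y hy
      exact hf.contDiffAt (hU.mem_nhds hy)
    · rw [← h]; exact h1 p hp
    · filter_upwards [hV.mem_nhds hq] with y hy
      exact hg.contDiffAt (hV.mem_nhds hy)
    · filter_upwards [hU.mem_nhds hp] using h1
    · filter_upwards [hV.mem_nhds hq] using h2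
  · rintro ⟨h, hf, g, hg0, hg, h1, h2⟩
    obtain ⟨U, hU, hUo, hpU⟩ := eventually_nhds_iff.1 (hf.and h1)
    obtain ⟨V, hV, hVo, hqV⟩ := eventually_nhds_iff.1 (hg.and h2)
    have fc : ContinuousOn f U := fun y hy => (hU y hy).1.continuousAt.continuousWithinAt
    have gc : ContinuousOn g V := fun y hy => (hV y hy).1.continuousAt.continuousWithinAt
    refine ⟨h, U ∩ f ⁻¹' V, V ∩ g ⁻¹' U, g, fc.isOpen_inter_preimage hUo hVo, ⟨hpU, by simpa [h] using hqV⟩,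
      gc.isOpen_inter_preimage hVo hUo, ⟨hqV, by simpa [hg0] using hpU⟩, 
      fun y hy => (hU y hy.1).1.contDiffWithinAt, fun y hy => (hV y hy.1).1.contDiffWithinAt, ?_, ?_, 
      fun y hy => (hU y hy.1).2, fun y hy => (hV y hy.1).2⟩
    · intro y hy
      refine ⟨hy.2, ?_⟩
      simp only [mem_preimage, (hU y hy.1).2]; exact hy.1
    · intro y hy
      refine ⟨hy.2, ?_⟩
      simp only [mem_preimage, (hV y hy.1).2]; exact hy.1

lemma DiffeoGermAt.comp {f : E → F} {g : F → H} {p : E} {q : F} {r : H} 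
    (hg : DiffeoGermAt g q r) (hf : DiffeoGermAt f p q) : DiffeoGermAt (g ∘ f) p r := by
  obtain ⟨f0, fs, f', f'0, f's, f1, f2⟩ := diffeo_iff.1 hf
  obtain ⟨g0, gs, g', g'0, g's, g1, g2⟩ := diffeo_iff.1 hg
  refine diffeo_iff.2 ⟨by simp [f0, g0], gs.comp fs f0, f' ∘ g', by simp [f'0, g'0], f's.comp g's g'0, ?_, ?_⟩
  · have hc := fs.at.continuousAt
    unfold ContinuousAt at hc
    rw [f0] at hc
    filter_upwards [f1, hc.eventually g1] with y h1 h2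
    simp [h1, h2]
  · have hc := g's.at.continuousAt
    unfold ContinuousAt at hc
    rw [g'0] at hc
    filter_upwards [g2, hc.eventually f2] with y h1 h2
    simp [h1, h2]

lemma DiffeoGermAt.exists_lip [FiniteDimensional ℝ E] {f : E → F} {p : E} {q : F} (h : DiffeoGermAt f p q) :
    ∃ K : ℝ, 0 < K ∧ ∃ U ∈ 𝓝 p, ∀ a ∈ U, ∀ b ∈ U, ‖f a - f b‖ ≤ K * ‖a - b‖ := by
  obtain ⟨f0, fs, -⟩ := diffeo_iff.1 h
  obtain ⟨K, U, hU, hK⟩ := (fs.at.of_le (by simp) : ContDiffAt ℝ 1 f p).exists_lipschitzOnWith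
  refine ⟨K + 1, by positivity, U, hU, fun a ha b hb => ?_⟩
  have := hK.norm_sub_le ha hb
  nlinarith [norm_nonneg (a - b)]

end germs

lemma cusp_of_equiv {γ γ' : ℝ → ℝ × ℝ} {t₀ s₀ : ℝ} {L : ℝ × ℝ → ℝ × ℝ} {s : ℝ → ℝ} {i j : ℕ}
    (hL : DiffeoGermAt L (γ t₀) (γ' s₀)) (hs : DiffeoGermAt s t₀ s₀)
    (h : ∀ᶠ t in 𝓝 t₀, L (γ t) = γ' (s t)) (hc : HasCuspAt γ' s₀ i j) : HasCuspAt γ t₀ i j := by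
  obtain ⟨φ, Ψ, h1, h2, h3⟩ := hc
  refine ⟨φ ∘ s, Ψ ∘ L, h1.comp hs, h2.comp hL, ?_⟩
  obtain ⟨f0, fs, -⟩ := diffeo_iff.1 hs
  have hc := fs.at.continuousAt
  unfold ContinuousAt at hc
  rw [f0] at hc
  filter_upwards [h, hc.eventually h3] with t ha hb
  simp [ha, hb]

lemma cusp_equiv {γ γ' : ℝ → ℝ × ℝ} {t₀ s₀ : ℝ} {L : ℝ × ℝ → ℝ × ℝ} {s : ℝ → ℝ} {i j : ℕ}
    (hL : DiffeoGermAt L (γ t₀) (γ' s₀)) (hs : DiffeoGermAt s t₀ s₀) (hγ : ContinuousAt γ t₀)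
    (h : ∀ᶠ t in 𝓝 t₀, L (γ t) = γ' (s t)) : HasCuspAt γ t₀ i j ↔ HasCuspAt γ' s₀ i j := by
  refine ⟨fun hc => ?_, cusp_of_equiv hL hs h⟩
  obtain ⟨f0, fs, f', f'0, f's, f1, f2⟩ := diffeo_iff.1 hs
  obtain ⟨g0, gs, g', g'0, g's, g1, g2⟩ := diffeo_iff.1 hL
  refine cusp_of_equiv (L := g') (s := f') (diffeo_iff.2 ⟨g'0, g's, L, g0, gs, g2, g1⟩)
    (diffeo_iff.2 ⟨f'0, f's, s, f0, fs, f2, f1⟩) ?_ hc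
  have hc := f's.at.continuousAt
  unfold ContinuousAt at hc
  rw [f'0] at hc
  filter_upwards [hc.eventually h, f2, hc.eventually (hγ.eventually g1)] with t h1 h2 h3
  rw [h2] at h1
  rw [← h1, h3]

lemma diffeo_deriv {s : ℝ → ℝ} {t₀ q : ℝ} (h : DiffeoGermAt s t₀ q) : ∃ a, a ≠ 0 ∧ HasDerivAt s a t₀ := by
  obtain ⟨f0, fs, f', f'0, f's, f1, f2⟩ := diffeo_iff.1 h
  have h1 := (fs.at.differentiableAt (by simp)).hasDerivAt
  refine ⟨_, ?_, h1⟩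
  intro h0
  have h2 := (f's.at.differentiableAt (by simp)).hasDerivAt
  rw [← f0] at h2
  have h3 := h2.comp t₀ h1
  have h4 : HasDerivAt (f' ∘ s) 1 t₀ := (hasDerivAt_id t₀).congr_of_eventuallyEq f1
  have := h3.unique h4
  simp [h0] at this

lemma diffeo_of_deriv {s : ℝ → ℝ} {t₀ a : ℝ} (hs : SmoothNear s t₀) (ha : a ≠ 0) (hd : HasDerivAt s a t₀) :
    DiffeoGermAt s t₀ (s t₀) := by
  have hd' := hd.hasFDerivAt_equiv ha
  let e := hs.at.toOpenPartialHomeomorph s hd' (by simp)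
  have he : ⇑e = s := rfl
  have hsrc : t₀ ∈ e.source := hs.at.mem_toOpenPartialHomeomorph_source hd' (by simp)
  have htgt : s t₀ ∈ e.target := hs.at.image_mem_toOpenPartialHomeomorph_target hd' (by simp)
  have h0 : e.symm (s t₀) = t₀ := e.left_inv hsrc
  have hcont : ContinuousAt e.symm (s t₀) := e.continuousAt_symm htgt
  unfold ContinuousAt at hcont
  rw [h0] at hcont
  have hdc : ∀ᶠ t in 𝓝 t₀, deriv s t ≠ 0 := by
    have hcd : ContinuousAt (deriv s) t₀ :=
      (ContDiffAt.derivWithin (m := 0) hs.at (by simp)).continuousAt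
    exact hcd.eventually_ne (by rwa [hd.deriv])
  refine diffeo_iff.2 ⟨rfl, hs, e.symm, h0, ?_, ?_, ?_⟩
  · filter_upwards [e.open_target.mem_nhds htgt, hcont.eventually hs, hcont.eventually hdc] with y h1 h2 h3
    exact e.contDiffAt_symm_deriv h3 h1 (h2.differentiableAt (by simp)).hasDerivAt h2
  · filter_upwards [e.open_source.mem_nhds hsrc] with y hy
    exact e.left_inv hy
  · filter_upwards [e.open_target.mem_nhds htgt] with y hy
    exact e.right_inv hy
lemma tendsto_div {σ : ℝ → ℝ} {a : ℝ} (h : HasDerivAt σ a 0) (h0 : σ 0 = 0) :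
    Tendsto (fun r => σ r / r) (𝓝[≠] 0) (𝓝 a) := by
  have := hasDerivAt_iff_tendsto_slope.1 h
  refine this.congr fun r => ?_
  simp [slope_def_field, h0]

lemma tendsto_neg_ne : Tendsto (fun r : ℝ => -r) (𝓝[≠] 0) (𝓝[≠] 0) := by
  refine tendsto_nhdsWithin_iff.2 ⟨?_, ?_⟩
  · have : Tendsto (fun r : ℝ => -r) (𝓝 0) (𝓝 (-0)) := continuous_neg.tendsto 0
    rw [neg_zero] at this
    exact this.mono_left nhdsWithin_le_nhds
  · filter_upwards [self_mem_nhdsWithin] with r hr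
    simpa using hr

lemma diffeo_id : DiffeoGermAt (fun t : ℝ => t) 0 0 :=
  diffeo_iff.2 ⟨rfl, contDiff_id.smoothNear _, fun t => t, rfl, contDiff_id.smoothNear _,
    Eventually.of_forall fun _ => rfl, Eventually.of_forall fun _ => rfl⟩

lemma diffeo_div {D : ℝ → ℝ} (hD : ContDiff ℝ ∞ D) (h0 : D 0 ≠ 0) :
    DiffeoGermAt (fun p : ℝ × ℝ => (p.2, p.1 / D p.2)) (0, 0) (0, 0) := by
  have hne : ∀ᶠ u in 𝓝 (0:ℝ), D u ≠ 0 := hD.continuous.continuousAt.eventually_ne h0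
  have hne2 : ∀ᶠ p : ℝ × ℝ in 𝓝 (0, 0), D p.2 ≠ 0 := 
    (continuous_snd.tendsto' ((0:ℝ), (0:ℝ)) 0 rfl).eventually hne
  have hne1 : ∀ᶠ p : ℝ × ℝ in 𝓝 (0, 0), D p.1 ≠ 0 := 
    (continuous_fst.tendsto' ((0:ℝ), (0:ℝ)) 0 rfl).eventually hne
  refine diffeo_iff.2 ⟨by simp, ?_, fun p => (p.2 * D p.1, p.1), by simp, ?_, ?_, ?_⟩
  · filter_upwards [hne2] with p hp
    exact contDiffAt_snd.prodMk (contDiffAt_fst.div (hD.contDiffAt.comp p contDiffAt_snd) hp)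
  · exact ((contDiff_snd.mul (hD.comp contDiff_fst)).prodMk contDiff_fst).smoothNear _
  · filter_upwards [hne2] with p hp
    ext <;> simp [hp]
  · filter_upwards [hne1] with p hp
    ext <;> simp [hp]

lemma model_suff {D : ℝ → ℝ} (hD : ContDiff ℝ ∞ D) (h0 : D 0 ≠ 0) {n : ℕ} (hn : n ≠ 0) :
    HasCuspAt (fun s => (s ^ n * D (s ^ 2), s ^ 2)) 0 2 n := by
  have h1 := diffeo_div hD h0
  refine ⟨fun t => t, fun p : ℝ × ℝ => (p.2, p.1 / D p.2), diffeo_id, by simpa [hn] using h1, ?_⟩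
  have hne : ∀ᶠ u in 𝓝 (0:ℝ), D u ≠ 0 := hD.continuous.continuousAt.eventually_ne h0
  have : Tendsto (fun s : ℝ => s ^ 2) (𝓝 0) (𝓝 0) := by
    simpa using (continuous_pow 2).tendsto (0:ℝ)
  filter_upwards [this.eventually hne] with s hs
  simp [hs]

lemma model_nec {D : ℝ → ℝ} (hD : Continuous D) {n : ℕ} (hn : Odd n)
    (h : HasCuspAt (fun s => (s ^ n * D (s ^ 2), s ^ 2)) 0 2 n) : D 0 ≠ 0 := by
  intro h0
  obtain ⟨σ, Ψ, hσ, hΨ, he⟩ := h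
  have hn0 : n ≠ 0 := by rintro rfl; simp at hn
  obtain ⟨a, ha, hd⟩ := diffeo_deriv hσ
  have hσ0 : σ 0 = 0 := hσ.1
  obtain ⟨K, hK, U, hU, hL⟩ := hΨ.exists_lip
  have hγ : Continuous (fun s : ℝ => (s ^ n * D (s ^ 2), s ^ 2)) := by fun_prop
  have hev : ∀ᶠ s in 𝓝 (0:ℝ), ‖σ s ^ n - σ (-s) ^ n‖ ≤ K * ‖2 * (s ^ n * D (s ^ 2))‖ := by
    have h1 : ∀ᶠ s in 𝓝 (0:ℝ), (s ^ n * D (s ^ 2), s ^ 2) ∈ U := hγ.continuousAt.eventually hU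
    have hneg : Tendsto (fun s : ℝ => -s) (𝓝 0) (𝓝 0) := by simpa using continuous_neg.tendsto (0:ℝ)
    filter_upwards [he, hneg.eventually he, h1, hneg.eventually h1] with s a1 a2 a3 a4
    have := hL _ a3 _ a4
    rw [a1, a2] at this
    have h5 : ‖σ s ^ n - σ (-s) ^ n‖ ≤ ‖((σ s ^ 2, σ s ^ n) : ℝ × ℝ) - (σ (-s) ^ 2, σ (-s) ^ n)‖ :=
      norm_snd_le (((σ s ^ 2, σ s ^ n) : ℝ × ℝ) - (σ (-s) ^ 2, σ (-s) ^ n))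
    refine h5.trans (this.trans (le_of_eq ?_))
    have h6 : ((s ^ n * D (s ^ 2), s ^ 2) : ℝ × ℝ) - ((-s) ^ n * D ((-s) ^ 2), (-s) ^ 2) = (2 * (s ^ n * D (s ^ 2)), 0) := by
      rw [hn.neg_pow, even_two.neg_pow]
      ext <;> simp; ring
    rw [h6, Prod.norm_def]
    simp only [norm_zero, max_eq_left (norm_nonneg _)]
  have t1 := (tendsto_div hd hσ0).pow n
  have t2 := ((tendsto_div hd hσ0).comp tendsto_neg_ne).pow n
  have t3 := (t1.add t2).norm
  have t4 : Tendsto (fun s : ℝ => K * ‖2 * D (s ^ 2)‖) (𝓝[≠] 0) (𝓝 0) := by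
    have : Continuous fun s : ℝ => K * ‖2 * D (s ^ 2)‖ := by fun_prop
    have := this.tendsto 0
    simp [h0] at this
    simp
    exact this.mono_left nhdsWithin_le_nhds
  have := le_of_tendsto_of_tendsto t3 t4 ?_
  · have h7 : a ^ n + a ^ n = 0 := norm_le_zero_iff.1 this
    have : a ^ n = 0 := by linarith
    exact ha (pow_eq_zero_iff hn0 |>.1 this)
  · filter_upwards [hev.filter_mono nhdsWithin_le_nhds, self_mem_nhdsWithin] with s hs hs0
    have hs0' : s ≠ 0 := hs0
    have hp : 0 < ‖s ^ n‖ := norm_pos_iff.2 (pow_ne_zero n hs0')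
    have e1 : (σ s / s) ^ n + (((fun r => σ r / r) ∘ fun r => -r) s) ^ n = (σ s ^ n - σ (-s) ^ n) / s ^ n := by
      simp only [Function.comp, div_pow, hn.neg_pow]
      field_simp
      ring
    rw [e1, norm_div, div_le_iff₀ hp]
    refine hs.trans (le_of_eq ?_)
    rw [mul_assoc, ← norm_mul]
    congr 2; ring

lemma model_nec5 {C : ℝ → ℝ} (hC : Continuous C)
    (h : HasCuspAt (fun s => (s ^ 3 * C (s ^ 2), s ^ 2)) 0 2 5) : C 0 = 0 := by
  obtain ⟨σ, Ψ, hσ, hΨ, he⟩ := h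
  obtain ⟨f0, fs, ρ, ρ0, ρs, f1, f2⟩ := diffeo_iff.1 hσ
  obtain ⟨g0, gs, Φ, Φ0, Φs, g1, g2⟩ := diffeo_iff.1 hΨ
  have hρ : DiffeoGermAt ρ 0 0 := diffeo_iff.2 ⟨ρ0, ρs, σ, f0, fs, f2, f1⟩
  have hΦ := diffeo_iff.2 ⟨Φ0, Φs, Ψ, g0, gs, g2, g1⟩
  obtain ⟨a, ha, hd⟩ := diffeo_deriv hρ
  obtain ⟨K, hK, U, hU, hL⟩ := hΦ.exists_lip
  have hγ : Continuous (fun s : ℝ => (s ^ 3 * C (s ^ 2), s ^ 2)) := by fun_prop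
  have hρc : Tendsto ρ (𝓝 0) (𝓝 0) := by
    have := ρs.at.continuousAt
    unfold ContinuousAt at this
    rwa [ρ0] at this
  have hneg : Tendsto (fun s : ℝ => -s) (𝓝 0) (𝓝 0) := by simpa using continuous_neg.tendsto (0:ℝ)
  have hq : ∀ᶠ r in 𝓝 (0:ℝ), (ρ r ^ 3 * C (ρ r ^ 2), ρ r ^ 2) = Φ (r ^ 2, r ^ 5) := by
    have h1 : ∀ᶠ s in 𝓝 (0:ℝ), Φ (Ψ ((s ^ 3 * C (s ^ 2), s ^ 2))) = (s ^ 3 * C (s ^ 2), s ^ 2) :=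
      hγ.continuousAt.eventually g1
    filter_upwards [hρc.eventually he, f2, hρc.eventually h1] with r a1 a2 a3
    rw [a2] at a1
    rw [← a3, a1]
  have hev : ∀ᶠ r in 𝓝 (0:ℝ), ‖ρ r ^ 3 * C (ρ r ^ 2) - ρ (-r) ^ 3 * C (ρ (-r) ^ 2)‖ ≤ K * ‖2 * r ^ 5‖ := by
    have h1 : ∀ᶠ r in 𝓝 (0:ℝ), ((r ^ 2, r ^ 5) : ℝ × ℝ) ∈ U := by
      have hc : Continuous fun r : ℝ => ((r ^ 2, r ^ 5) : ℝ × ℝ) := by fun_prop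
      exact hc.tendsto' 0 (0, 0) (by simp) |>.eventually hU
    filter_upwards [hq, hneg.eventually hq, h1, hneg.eventually h1] with r a1 a2 a3 a4
    have := hL _ a3 _ a4
    rw [← a1, ← a2] at this
    have h5 : ‖ρ r ^ 3 * C (ρ r ^ 2) - ρ (-r) ^ 3 * C (ρ (-r) ^ 2)‖ ≤ _ :=
      norm_fst_le (((ρ r ^ 3 * C (ρ r ^ 2), ρ r ^ 2) : ℝ × ℝ) - (ρ (-r) ^ 3 * C (ρ (-r) ^ 2), ρ (-r) ^ 2))
    refine h5.trans (this.trans (le_of_eq ?_))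
    have h6 : ((r ^ 2, r ^ 5) : ℝ × ℝ) - ((-r) ^ 2, (-r) ^ 5) = (0, 2 * r ^ 5) := by
      ext <;> simp; ring
    rw [h6]
    simp [Prod.norm_def]
  have hCt : Tendsto (fun r => C (ρ r ^ 2)) (𝓝[≠] 0) (𝓝 (C 0)) := by
    have : Tendsto (fun r => C (ρ r ^ 2)) (𝓝 0) (𝓝 (C (0 ^ 2))) :=
      ((by fun_prop : Continuous fun s => C (s ^ 2)).tendsto 0).comp hρc
    simp only [ne_eq, OfNat.ofNat_ne_zero, not_false_eq_true, zero_pow] at this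
    exact this.mono_left nhdsWithin_le_nhds
  have t1 := ((tendsto_div hd ρ0).pow 3).mul hCt
  have t3 := (t1.add (t1.comp tendsto_neg_ne)).norm
  have t4 : Tendsto (fun r : ℝ => K * ‖2 * r ^ 2‖) (𝓝[≠] 0) (𝓝 0) := by
    have : Continuous fun r : ℝ => K * ‖2 * r ^ 2‖ := by fun_prop
    have := this.tendsto 0
    simp at this
    simp
    exact this.mono_left nhdsWithin_le_nhds
  have := le_of_tendsto_of_tendsto t3 t4 ?_
  · have h7 := norm_le_zero_iff.1 this
    have : a ^ 3 * C 0 = 0 := by linarith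
    exact (mul_eq_zero.1 this).resolve_left (pow_ne_zero 3 ha)
  · filter_upwards [hev.filter_mono nhdsWithin_le_nhds, self_mem_nhdsWithin] with s hs hs0
    have hs0' : s ≠ 0 := hs0
    have hp : 0 < ‖s ^ 3‖ := norm_pos_iff.2 (pow_ne_zero 3 hs0')
    simp only [Function.comp]
    have e1 : (ρ s / s) ^ 3 * C (ρ s ^ 2) + (ρ (-s) / (-s)) ^ 3 * C (ρ (-s) ^ 2) = 
      (ρ s ^ 3 * C (ρ s ^ 2) - ρ (-s) ^ 3 * C (ρ (-s) ^ 2)) / s ^ 3 := by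
      field_simp
      ring
    rw [e1, norm_div, div_le_iff₀ hp]
    refine hs.trans (le_of_eq ?_)
    rw [mul_assoc, ← norm_mul]
    congr 2; ring

lemma model_iff3 {C : ℝ → ℝ} (hC : ContDiff ℝ ∞ C) :
    HasCuspAt (fun s => (s ^ 3 * C (s ^ 2), s ^ 2)) 0 2 3 ↔ C 0 ≠ 0 :=
  ⟨model_nec hC.continuous (by decide), fun h => model_suff hC h (by norm_num)⟩

lemma model_iff5 {C : ℝ → ℝ} (hC : ContDiff ℝ ∞ C) :
    HasCuspAt (fun s => (s ^ 3 * C (s ^ 2), s ^ 2)) 0 2 5 ↔ C 0 = 0 ∧ deriv C 0 ≠ 0 := by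
  have key : C 0 = 0 → (HasCuspAt (fun s => (s ^ 3 * C (s ^ 2), s ^ 2)) 0 2 5 ↔ deriv C 0 ≠ 0) := by
    intro h0
    obtain ⟨D, hD, hCD⟩ := hadamard hC 0 h0
    have e : (fun s : ℝ => (s ^ 3 * C (s ^ 2), s ^ 2)) = fun s => (s ^ 5 * D (s ^ 2), s ^ 2) := by
      ext s <;> simp [hCD]; ring
    have hd : deriv C 0 = D 0 := by
      have h1 : HasDerivAt (fun t => (t - 0) * D t) (1 * D 0 + (0 - 0) * deriv D 0) 0 :=
        ((hasDerivAt_id (0:ℝ)).sub_const 0).mul (hD.differentiable (by simp) 0).hasDerivAt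
      have : C = fun t => (t - 0) * D t := funext hCD
      rw [this, h1.deriv]; ring
    rw [e, hd]
    exact ⟨model_nec hD.continuous (by decide), fun h => model_suff hD h (by norm_num)⟩
  constructor
  · intro h
    have h0 := model_nec5 hC.continuous h
    exact ⟨h0, (key h0).1 h⟩
  · rintro ⟨h0, h1⟩
    exact (key h0).2 h1
lemma smooth_extend {f : ℝ → ℝ} (hf : SmoothNear f 0) : ∃ g : ℝ → ℝ, ContDiff ℝ ∞ g ∧ ∀ᶠ s in 𝓝 0, g s = f s := by
  obtain ⟨r, hr, hb⟩ := Metric.eventually_nhds_iff_ball.1 hf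
  let χ : ContDiffBump (0:ℝ) := ⟨r/3, r/2, by linarith, by linarith⟩
  refine ⟨fun s => χ s * f s, ?_, ?_⟩
  · refine contDiff_iff_contDiffAt.2 fun s => ?_
    by_cases h1 : s ∈ tsupport χ
    · rw [χ.tsupport_eq] at h1
      refine χ.contDiff.contDiffAt.mul (hb s ?_)
      exact Metric.closedBall_subset_ball (by simp only [χ]; linarith) h1
    · have h2 := notMem_tsupport_iff_eventuallyEq.1 h1
      refine (contDiffAt_const (c := (0:ℝ))).congr_of_eventuallyEq ?_
      filter_upwards [h2] with y hy
      simp [hy]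
  · filter_upwards [χ.eventuallyEq_one] with s hs
    simp [hs]

lemma deriv_smooth {f : ℝ → ℝ} (hf : ContDiff ℝ ∞ f) : ContDiff ℝ ∞ (deriv f) := (contDiff_infty_iff_deriv.1 hf).2
lemma hd_smooth {f : ℝ → ℝ} (hf : ContDiff ℝ ∞ f) (t : ℝ) : HasDerivAt f (deriv f t) t :=
  (hf.differentiable (by simp) t).hasDerivAt

lemma hadamard_deriv {f g : ℝ → ℝ} {a : ℝ} (hg : ContDiff ℝ ∞ g) (h : ∀ t, f t = (t - a) * g t) (t : ℝ) :
    HasDerivAt f (g t + (t - a) * deriv g t) t := by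
  have h1 : HasDerivAt (fun t => (t - a) * g t) (1 * g t + (t - a) * deriv g t) t :=
    ((hasDerivAt_id t).sub_const a).mul (hd_smooth hg t)
  rw [show f = fun t => (t - a) * g t from funext h]
  simpa using h1

lemma hadamard2 {f : ℝ → ℝ} (hf : ContDiff ℝ ∞ f) (a : ℝ) (h0 : f a = 0) (h1 : deriv f a = 0) :
    ∃ q : ℝ → ℝ, ContDiff ℝ ∞ q ∧ (∀ t, f t = (t - a) ^ 2 * q t) ∧ deriv (deriv f) a = 2 * q a := by
  obtain ⟨g, hg, e⟩ := hadamard hf a h0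
  have h2 := hadamard_deriv hg e
  have hga : g a = 0 := by have := (h2 a).deriv; simp [h1] at this; exact this.symm
  obtain ⟨q, hq, e2⟩ := hadamard hg a hga
  refine ⟨q, hq, fun t => by rw [e, e2]; ring, ?_⟩
  have h3 : deriv f = fun t => g t + (t - a) * deriv g t := funext fun t => (h2 t).deriv
  have h4 := (hd_smooth hg a).add (hadamard_deriv (f := fun t => (t - a) * deriv g t) (a := a) (deriv_smooth hg) (fun t => rfl) a)
  have h5 := (hadamard_deriv hq e2 a).deriv
  have h6 : deriv (deriv f) a = deriv g a + (deriv g a + (a - a) * deriv (deriv g) a) := by rw [h3]; exact h4.deriv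
  rw [h6, h5]; simp; ring

lemma even_odd {f : ℝ → ℝ} (hf : ContDiff ℝ ∞ f) (h1 : deriv f 0 = 0) :
    ∃ A C : ℝ → ℝ, ContDiff ℝ ∞ A ∧ ContDiff ℝ ∞ C ∧ ∀ s, f s = A (s ^ 2) + s ^ 3 * C (s ^ 2) := by
  have hfn : ContDiff ℝ ∞ fun s => f (-s) := hf.comp contDiff_neg
  obtain ⟨A, hA, eA⟩ := whitney_even (fun s => (f s + f (-s)) / 2) ((hf.add hfn).div_const 2)
    (fun t => by simp [add_comm])
  obtain ⟨k, hk, ek⟩ := hadamard (f := fun s => (f s - f (-s)) / 2) ((hf.sub hfn).div_const 2) 0 (by simp)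
  have hk0 : k 0 = 0 := by
    have h2 := (hadamard_deriv hk ek 0)
    have h3 : HasDerivAt (fun s => f (-s)) (deriv f (-0) * (-1)) 0 := 
      (hd_smooth hf (-0)).comp 0 (hasDerivAt_neg 0)
    have h4 := (((hd_smooth hf 0).sub h3).div_const 2).unique h2
    simp [h1] at h4
    exact h4.symm
  have hke : ∀ t, k (-t) = k t := by
    intro t
    by_cases ht : t = 0
    · simp [ht]
    have a1 := ek t
    have a2 := ek (-t)
    simp only [neg_neg, sub_zero] at a1 a2
    have : t * (k (-t) - k t) = 0 := by linarith
    rcases mul_eq_zero.1 this with h | h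
    · exact absurd h ht
    · linarith
  obtain ⟨B, hB, eB⟩ := whitney_even k hk hke
  obtain ⟨C, hC, eC⟩ := hadamard hB 0 (by have := eB 0; simp [hk0] at this; exact this.symm)
  refine ⟨A, C, hA, hC, fun s => ?_⟩
  have a1 := ek s
  rw [eB, eC] at a1
  rw [← eA]
  linear_combination a1

lemma diffeo_shear {A : ℝ → ℝ} (hA : ContDiff ℝ ∞ A) (h0 : A 0 = 0) :
    DiffeoGermAt (fun p : ℝ × ℝ => (p.1 - A p.2, p.2)) (0, 0) (0, 0) := by
  refine diffeo_iff.2 ⟨by simp [h0], ?_, fun p => (p.1 + A p.2, p.2), by simp [h0], ?_, ?_, ?_⟩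
  · exact ((contDiff_fst.sub (hA.comp contDiff_snd)).prodMk contDiff_snd).smoothNear _
  · exact ((contDiff_fst.add (hA.comp contDiff_snd)).prodMk contDiff_snd).smoothNear _
  · exact Eventually.of_forall fun p => by simp
  · exact Eventually.of_forall fun p => by simp

lemma normal_form (x z : ℝ → ℝ) (t₀ : ℝ) (hx : ContDiff ℝ ∞ x) (hz : ContDiff ℝ ∞ z)
    (x0 : x t₀ = 0) (z0 : z t₀ = 0) (x1 : deriv x t₀ = 0) (z1 : deriv z t₀ = 0) (z2 : 0 < deriv (deriv z) t₀) :
    ∃ (s A C : ℝ → ℝ), ContDiff ℝ ∞ A ∧ ContDiff ℝ ∞ C ∧ DiffeoGermAt s t₀ 0 ∧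
      (∀ᶠ t in 𝓝 t₀, z t = s t ^ 2) ∧ (∀ᶠ t in 𝓝 t₀, x t = A (z t) + s t ^ 3 * C (z t)) ∧
      ∀ i j, HasCuspAt (fun t => (x t, z t)) t₀ i j ↔ HasCuspAt (fun s => (s ^ 3 * C (s ^ 2), s ^ 2)) 0 i j := by
  obtain ⟨q, hq, eq, q0⟩ := hadamard2 hz t₀ z0 z1
  have hqpos : 0 < q t₀ := by linarith
  have hqev : ∀ᶠ t in 𝓝 t₀, 0 < q t := hq.continuous.continuousAt.eventually (lt_mem_nhds hqpos)
  let s : ℝ → ℝ := fun t => (t - t₀) * √(q t)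
  have hs : SmoothNear s t₀ := by
    filter_upwards [hqev] with t ht
    exact (contDiffAt_id.sub contDiffAt_const).mul (hq.contDiffAt.sqrt ht.ne')
  have hs0 : s t₀ = 0 := by simp [s]
  have hsd : HasDerivAt s (√(q t₀)) t₀ := by
    have h1 : DifferentiableAt ℝ (fun t => √(q t)) t₀ := (hq.differentiable (by simp) t₀).sqrt hqpos.ne'
    have := ((hasDerivAt_id t₀).sub_const t₀).mul h1.hasDerivAt
    simpa using! this
  have hsD : DiffeoGermAt s t₀ 0 := by
    have := diffeo_of_deriv hs (Real.sqrt_pos.2 hqpos).ne' hsd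
    rwa [hs0] at this
  have ez : ∀ᶠ t in 𝓝 t₀, z t = s t ^ 2 := by
    filter_upwards [hqev] with t ht
    simp only [s, mul_pow, Real.sq_sqrt ht.le, eq]
  obtain ⟨-, -, τ, τ0, τs, f1, f2⟩ := diffeo_iff.1 hsD
  obtain ⟨f, hf, ef⟩ := smooth_extend ((hx.smoothNear t₀).comp τs τ0)
  have hsc : Tendsto s (𝓝 t₀) (𝓝 0) := by
    have := hs.at.continuousAt
    unfold ContinuousAt at this
    rwa [hs0] at this
  have exf : ∀ᶠ t in 𝓝 t₀, x t = f (s t) := by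
    filter_upwards [hsc.eventually ef, f1] with t h1 h2
    rw [h1]; simp [h2]
  have hf0 : f 0 = 0 := by
    have := exf.self_of_nhds
    rw [x0, hs0] at this; exact this.symm
  have hf1 : deriv f 0 = 0 := by
    have h1 : HasDerivAt (f ∘ s) (deriv f (s t₀) * √(q t₀)) t₀ := (hd_smooth hf _).comp t₀ hsd
    have h2 := h1.congr_of_eventuallyEq (show x =ᶠ[𝓝 t₀] f ∘ s from exf)
    have h3 := h2.unique (hd_smooth hx t₀)
    rw [x1, hs0] at h3
    exact (mul_eq_zero.1 h3).resolve_right (Real.sqrt_pos.2 hqpos).ne'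
  obtain ⟨A, C, hA, hC, e⟩ := even_odd hf hf1
  have hA0 : A 0 = 0 := by have := e 0; simp [hf0] at this; exact this.symm
  have exA : ∀ᶠ t in 𝓝 t₀, x t = A (z t) + s t ^ 3 * C (z t) := by
    filter_upwards [exf, ez] with t h1 h2
    rw [h1, e, h2]
  refine ⟨s, A, C, hA, hC, hsD, ez, exA, fun i j => ?_⟩
  refine cusp_equiv (L := fun p : ℝ × ℝ => (p.1 - A p.2, p.2)) (s := s) ?_ hsD ?_ ?_
  · have := diffeo_shear hA hA0
    simpa [x0, z0] using this
  · exact (hx.continuous.prodMk hz.continuous).continuousAt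
  · filter_upwards [exA, ez] with t h1 h2
    simp [h1, h2]

lemma mul_deriv2 {b M p : ℝ → ℝ} {t₀ : ℝ} (hb : ContDiff ℝ ∞ b) (b0 : b t₀ = 0) (hM : SmoothNear M t₀)
    (h : ∀ᶠ t in 𝓝 t₀, p t = b t * M t) :
    deriv p t₀ = deriv b t₀ * M t₀ ∧
      deriv (deriv p) t₀ = deriv (deriv b) t₀ * M t₀ + 2 * deriv b t₀ * deriv M t₀ := by
  have hd : ∀ᶠ t in 𝓝 t₀, HasDerivAt M (deriv M t) t := by
    filter_upwards [hM] with t ht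
    exact (ht.differentiableAt (by simp)).hasDerivAt
  have h1 : ∀ᶠ t in 𝓝 t₀, deriv p t = deriv b t * M t + b t * deriv M t := by
    filter_upwards [hd, h.eventually_nhds] with t ht h2
    exact (((hd_smooth hb t).mul ht).congr_of_eventuallyEq h2).deriv
  have hdd : DifferentiableAt ℝ (deriv M) t₀ := by
    have h3 : ContDiffAt ℝ 1 (fderiv ℝ M) t₀ := hM.at.fderiv_right (m := 1) (by
      exact WithTop.coe_le_coe.2 (le_top : ((1:ℕ∞) + 1) ≤ ⊤))
    have h4 := (h3.differentiableAt (by simp)).clm_apply (differentiableAt_const (1:ℝ))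
    simpa [fderiv_apply_one_eq_deriv] using! h4
  have h5 := ((hd_smooth (deriv_smooth hb) t₀).mul hd.self_of_nhds).add ((hd_smooth hb t₀).mul hdd.hasDerivAt)
  have h6 := (h5.congr_of_eventuallyEq (f₁ := deriv p) h1).deriv
  refine ⟨?_, ?_⟩
  · rw [h1.self_of_nhds, b0]; ring
  · rw [h6, b0]; ring

lemma slope_eq {x z φ β s A C : ℝ → ℝ} {t₀ : ℝ} (hx : ContDiff ℝ ∞ x) (hz : ContDiff ℝ ∞ z)
    (hφ : ContDiff ℝ ∞ φ) (hβ : ContDiff ℝ ∞ β)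
    (hdx : ∀ t, deriv x t = -(β t) * sin (φ t)) (hdz : ∀ t, deriv z t = β t * cos (φ t))
    (β0 : β t₀ = 0) (β1 : deriv β t₀ ≠ 0)
    (hA : ContDiff ℝ ∞ A) (hC : ContDiff ℝ ∞ C) (hs : SmoothNear s t₀)
    (ez : ∀ᶠ t in 𝓝 t₀, z t = s t ^ 2) (ex : ∀ᶠ t in 𝓝 t₀, x t = A (z t) + s t ^ 3 * C (z t)) :
    (∀ᶠ t in 𝓝 t₀, β t * cos (φ t) = 2 * s t * deriv s t) ∧
    ∀ᶠ t in 𝓝 t₀, deriv φ t = - (cos (φ t)) ^ 2 * deriv s t * (2 * s t * deriv (deriv A) (z t) + 3 / 2 * C (z t)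
      + 6 * s t ^ 2 * deriv C (z t) + 2 * s t ^ 4 * deriv (deriv C) (z t)) := by
  have hsd : ∀ᶠ t in 𝓝 t₀, HasDerivAt s (deriv s t) t := by
    filter_upwards [hs] with t ht
    exact (ht.differentiableAt (by simp)).hasDerivAt
  have h1 : ∀ᶠ t in 𝓝 t₀, β t * cos (φ t) = 2 * s t * deriv s t := by
    filter_upwards [hsd, ez.eventually_nhds] with t ht h2
    rw [← hdz]
    have h3 := ((ht.pow 2).congr_of_eventuallyEq (f₁ := z) h2).deriv
    rw [h3]; simp
  refine ⟨h1, ?_⟩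
  let T : ℝ → ℝ := fun t => deriv A (z t) + 3 / 2 * (s t * C (z t)) + s t ^ 3 * deriv C (z t)
  have h2 : ∀ᶠ t in 𝓝 t₀, β t * (sin (φ t) + cos (φ t) * T t) = 0 := by
    filter_upwards [hsd, ex.eventually_nhds, h1] with t ht h2 h3
    have a1 : HasDerivAt (fun t => A (z t)) _ t := (hd_smooth hA (z t)).comp t (hd_smooth hz t)
    have a2 : HasDerivAt (fun t => C (z t)) _ t := (hd_smooth hC (z t)).comp t (hd_smooth hz t)
    have h4 := ((a1.add ((ht.pow 3).mul a2)).congr_of_eventuallyEq (f₁ := x) h2).deriv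
    rw [hdx, hdz] at h4
    simp only [Pi.pow_apply] at h4
    norm_num at h4
    simp only [T]
    linear_combination -h4 + (3 / 2) * s t * C (z t) * h3
  have Td : ∀ᶠ t in 𝓝 t₀, HasDerivAt T (deriv s t * (2 * s t * deriv (deriv A) (z t) + 3 / 2 * C (z t)
      + 6 * s t ^ 2 * deriv C (z t) + 2 * s t ^ 4 * deriv (deriv C) (z t))) t := by
    filter_upwards [hsd, h1] with t ht h3
    have a1 : HasDerivAt (fun t => deriv A (z t)) _ t := (hd_smooth (deriv_smooth hA) (z t)).comp t (hd_smooth hz t)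
    have a2 : HasDerivAt (fun t => C (z t)) _ t := (hd_smooth hC (z t)).comp t (hd_smooth hz t)
    have a3 : HasDerivAt (fun t => deriv C (z t)) _ t := (hd_smooth (deriv_smooth hC) (z t)).comp t (hd_smooth hz t)
    have h4 := (a1.add ((ht.mul a2).const_mul (3/2))).add ((ht.pow 3).mul a3)
    refine HasDerivAt.congr_deriv (f := T) h4 ?_
    rw [hdz, h3]
    norm_num
    ring
  have hE : ∀ t, HasDerivAt T (deriv T t) t → HasDerivAt (fun t => sin (φ t) + cos (φ t) * T t)
      (cos (φ t) * deriv φ t + (-sin (φ t) * deriv φ t * T t + cos (φ t) * deriv T t)) t := by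
    intro t ht
    exact (hd_smooth hφ t).sin.add ((hd_smooth hφ t).cos.mul ht)
  have hEd : ∀ᶠ t in 𝓝 t₀, HasDerivAt T (deriv T t) t := by
    filter_upwards [Td] with t ht
    exact ht.differentiableAt.hasDerivAt
  have h5 : ∀ᶠ t in 𝓝[≠] t₀, sin (φ t) + cos (φ t) * T t = 0 := by
    have hb : ∀ᶠ t in 𝓝[≠] t₀, β t ≠ 0 := (hd_smooth hβ t₀).eventually_ne β1
    filter_upwards [hb, h2.filter_mono nhdsWithin_le_nhds] with t h3 h4
    exact (mul_eq_zero.1 h4).resolve_left h3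
  have h6 : sin (φ t₀) + cos (φ t₀) * T t₀ = 0 := by
    have c := (hE t₀ hEd.self_of_nhds).continuousAt
    have c1 := c.tendsto.mono_left (nhdsWithin_le_nhds (s := {t₀}ᶜ))
    refine tendsto_nhds_unique c1 ?_
    exact tendsto_const_nhds.congr' (h5.mono fun t ht => ht.symm)
  have h7 : ∀ᶠ t in 𝓝 t₀, sin (φ t) + cos (φ t) * T t = 0 := by
    filter_upwards [eventually_nhdsWithin_iff.1 h5] with t ht
    by_cases h : t = t₀
    · rw [h]; exact h6
    · exact ht h
  filter_upwards [Td, h7.eventually_nhds] with t ht h8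
  have h9 := hE t ht.differentiableAt.hasDerivAt
  have h10 : HasDerivAt (fun t => sin (φ t) + cos (φ t) * T t) 0 t :=
    (hasDerivAt_const t (0:ℝ)).congr_of_eventuallyEq h8
  have h11 := h9.unique h10
  have h12 := h8.self_of_nhds
  rw [ht.deriv] at h11
  linear_combination (cos (φ t)) * h11 - (deriv φ t) * (sin_sq_add_cos_sq (φ t)) + sin (φ t) * deriv φ t * h12

lemma norm_case {x z φ β : ℝ → ℝ} {t₀ : ℝ} (hx : ContDiff ℝ ∞ x) (hz : ContDiff ℝ ∞ z)
    (hφ : ContDiff ℝ ∞ φ) (hβ : ContDiff ℝ ∞ β)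
    (hdx : ∀ t, deriv x t = -(β t) * sin (φ t)) (hdz : ∀ t, deriv z t = β t * cos (φ t))
    (x0 : x t₀ = 0) (z0 : z t₀ = 0) (φ0 : φ t₀ = 0)
    (β0 : β t₀ = 0) (β1 : 0 < deriv β t₀) :
    (HasCuspAt (fun t => (x t, z t)) t₀ 2 3 ↔ deriv φ t₀ ≠ 0) ∧
    (HasCuspAt (fun t => (x t, z t)) t₀ 2 5 ↔ (deriv φ t₀ = 0 ∧
      deriv (deriv β) t₀ * deriv (deriv φ) t₀ - deriv β t₀ * deriv (deriv (deriv φ)) t₀ ≠ 0)) := by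
  have z2 : deriv (deriv z) t₀ = deriv β t₀ := by
    rw [show deriv z = fun t => β t * cos (φ t) from funext hdz]
    have := ((hd_smooth hβ t₀).mul (hd_smooth hφ t₀).cos).deriv
    refine this.trans ?_
    simp [φ0, β0]
  obtain ⟨s, A, C, hA, hC, hs, ez, ex, hcusp⟩ := normal_form x z t₀ hx hz x0 z0 (by simp [hdx, β0]) (by simp [hdz, β0])
    (by rw [z2]; exact β1)
  obtain ⟨a, ha, hsa⟩ := diffeo_deriv hs
  obtain ⟨s0, hs', -⟩ := diffeo_iff.1 hs
  obtain ⟨e1, e2⟩ := slope_eq hx hz hφ hβ hdx hdz β0 β1.ne' hA hC hs' ez ex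
  have p1 : deriv φ t₀ = - (3 / 2) * a * C 0 := by
    rw [e2.self_of_nhds, φ0, s0, z0, hsa.deriv]; simp; ring
  rw [hcusp, hcusp, model_iff3 hC, model_iff5 hC, p1]
  have hC0 : -(3 / 2) * a * C 0 = 0 ↔ C 0 = 0 := by simp [ha]
  refine ⟨(not_congr hC0).symm, ?_⟩
  rw [hC0]
  refine and_congr_right fun c0 => ?_
  obtain ⟨D, hD, eD⟩ := hadamard hC 0 c0
  have D0 : deriv C 0 = D 0 := by simpa using (hadamard_deriv hD eD 0).deriv
  let N : ℝ → ℝ := fun t => 2 * deriv (deriv A) (z t) + s t * (3 / 2 * D (z t) + 6 * deriv C (z t) + 2 * s t ^ 2 * deriv (deriv C) (z t))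
  have hN : SmoothNear N t₀ := by
    filter_upwards [hs'] with t ht
    have b1 : ContDiffAt ℝ ∞ (fun t => deriv (deriv A) (z t)) t := ((deriv_smooth (deriv_smooth hA)).comp hz).contDiffAt
    have b2 : ContDiffAt ℝ ∞ (fun t => D (z t)) t := (hD.comp hz).contDiffAt
    have b3 : ContDiffAt ℝ ∞ (fun t => deriv C (z t)) t := ((deriv_smooth hC).comp hz).contDiffAt
    have b4 : ContDiffAt ℝ ∞ (fun t => deriv (deriv C) (z t)) t := ((deriv_smooth (deriv_smooth hC)).comp hz).contDiffAt
    exact (contDiffAt_const.mul b1).add (ht.mul (((contDiffAt_const.mul b2).add (contDiffAt_const.mul b3)).add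
      ((contDiffAt_const.mul (ht.pow 2)).mul b4)))
  have hNd : HasDerivAt N (15 / 2 * a * deriv C 0) t₀ := by
    have zd : HasDerivAt z 0 t₀ := by
      have := hd_smooth hz t₀
      rwa [hdz, β0, zero_mul] at this
    have b1 : HasDerivAt (fun t => deriv (deriv A) (z t)) _ t₀ :=
      (hd_smooth (deriv_smooth (deriv_smooth hA)) (z t₀)).comp t₀ zd
    have b2 : HasDerivAt (fun t => D (z t)) _ t₀ := (hd_smooth hD (z t₀)).comp t₀ zd
    have b3 : HasDerivAt (fun t => deriv C (z t)) _ t₀ := (hd_smooth (deriv_smooth hC) (z t₀)).comp t₀ zd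
    have b4 : HasDerivAt (fun t => deriv (deriv C) (z t)) _ t₀ :=
      (hd_smooth (deriv_smooth (deriv_smooth hC)) (z t₀)).comp t₀ zd
    have b5 := (b1.const_mul 2).add (hsa.mul (((b2.const_mul (3/2)).add (b3.const_mul 6)).add (((hsa.pow 2).const_mul 2).mul b4)))
    refine HasDerivAt.congr_deriv (f := N) b5 ?_
    simp [s0, z0, D0]
    ring
  let M : ℝ → ℝ := fun t => -(1 / 2) * cos (φ t) ^ 3 * N t
  have hM : SmoothNear M t₀ := by
    filter_upwards [hN] with t ht
    exact (contDiffAt_const.mul ((Real.contDiff_cos.comp hφ).contDiffAt.pow 3)).mul ht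
  have φ1 : deriv φ t₀ = 0 := by rw [p1, c0]; ring
  have hMd : deriv M t₀ = -(15 / 4) * a * deriv C 0 := by
    have b1 := ((((hd_smooth hφ t₀).cos).pow 3).const_mul (-(1/2))).mul hNd
    have : deriv M t₀ = _ := b1.deriv
    rw [this]
    simp [φ0, φ1]
    ring
  have e3 : ∀ᶠ t in 𝓝 t₀, deriv φ t = β t * M t := by
    filter_upwards [e1, e2, ez] with t h1 h2 h3
    rw [h2, eD (z t), sub_zero]
    simp only [M, N]
    rw [← h3, show s t ^ 4 = s t ^ 2 * s t ^ 2 by ring, ← h3]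
    have : z t * D (z t) = s t * (s t * D (z t)) := by rw [h3]; ring
    linear_combination (1/2) * cos (φ t) ^ 2 * (2 * deriv (deriv A) (z t) + s t * (3 / 2 * D (z t) + 6 * deriv C (z t) + 2 * z t * deriv (deriv C) (z t))) * h1 - cos (φ t) ^ 2 * deriv s t * (3 / 2 * D (z t) + 6 * deriv C (z t) + 2 * z t * deriv (deriv C) (z t)) * h3
  obtain ⟨q1, q2⟩ := mul_deriv2 hβ β0 hM e3
  rw [q1, q2, hMd]
  have : deriv (deriv β) t₀ * (deriv β t₀ * M t₀) - deriv β t₀ * (deriv (deriv β) t₀ * M t₀ + 2 * deriv β t₀ * (-(15 / 4) * a * deriv C 0))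
    = (15 / 2 * deriv β t₀ ^ 2 * a) * deriv C 0 := by ring
  rw [this]
  have : (15 / 2 * deriv β t₀ ^ 2 * a) ≠ 0 := by
    have := β1.ne'
    positivity
  simp [this]

lemma degenerate_case {x z : ℝ → ℝ} {t₀ : ℝ} {j : ℕ} (hx : ContDiff ℝ ∞ x) (hz : ContDiff ℝ ∞ z)
    (x1 : deriv x t₀ = 0) (z1 : deriv z t₀ = 0) (x2 : deriv (deriv x) t₀ = 0) (z2 : deriv (deriv z) t₀ = 0)
    : ¬ HasCuspAt (fun t => (x t, z t)) t₀ 2 j := by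
  rintro ⟨σ, Ψ, hσ, hΨ, e⟩
  have key : ∀ f : ℝ → ℝ, ContDiff ℝ ∞ f → deriv f t₀ = 0 → deriv (deriv f) t₀ = 0 →
      ∃ q : ℝ → ℝ, ContDiff ℝ ∞ q ∧ (∀ t, f t - f t₀ = (t - t₀) ^ 2 * q t) ∧ q t₀ = 0 := by
    intro f hf h1 h2
    have e1 : deriv (fun t => f t - f t₀) = deriv f := funext fun t => deriv_sub_const _
    obtain ⟨q, hq, eq, q2⟩ := hadamard2 (f := fun t => f t - f t₀) (hf.sub contDiff_const) t₀ (by simp)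
      (by rw [e1, h1])
    refine ⟨q, hq, eq, ?_⟩
    rw [e1, h2] at q2
    linarith
  obtain ⟨q, hq, eq, q0⟩ := key x hx x1 x2
  obtain ⟨r, hr, er, r0⟩ := key z hz z1 z2
  obtain ⟨K, hK, U, hU, hlip⟩ := hΨ.exists_lip
  obtain ⟨a, ha, hσa⟩ := diffeo_deriv hσ
  have σ0 : σ t₀ = 0 := hσ.1
  have hγ : ContinuousAt (fun t => (x t, z t)) t₀ := (hx.continuous.prodMk hz.continuous).continuousAt
  have h1 : ∀ᶠ t in 𝓝 t₀, σ t ^ 2 ≤ K * ((t - t₀) ^ 2 * (|q t| + |r t|)) := by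
    filter_upwards [e, hγ hU] with t h1 h2
    have h3 := hlip _ h2 _ (mem_of_mem_nhds hU)
    have h4 : Ψ (x t₀, z t₀) = (0, 0) := hΨ.1
    have h1' : Ψ (x t, z t) = (σ t ^ 2, σ t ^ j) := h1
    simp only [h1', h4] at h3
    have h5 : σ t ^ 2 ≤ ‖((σ t ^ 2, σ t ^ j) : ℝ × ℝ) - (0, 0)‖ := by
      refine le_trans ?_ (norm_fst_le _)
      simp
    refine h5.trans (h3.trans ?_)
    refine mul_le_mul_of_nonneg_left ?_ hK.le
    rw [Prod.mk_sub_mk, Prod.norm_mk, eq, er]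
    simp only [norm_mul, Real.norm_eq_abs, abs_pow, sq_abs]
    refine max_le ?_ ?_
    · exact mul_le_mul_of_nonneg_left (by linarith [abs_nonneg (r t)]) (sq_nonneg _)
    · exact mul_le_mul_of_nonneg_left (by linarith [abs_nonneg (q t)]) (sq_nonneg _)
  have h2 : ∀ᶠ t in 𝓝[≠] t₀, (slope σ t₀ t) ^ 2 ≤ K * (|q t| + |r t|) := by
    filter_upwards [h1.filter_mono nhdsWithin_le_nhds, self_mem_nhdsWithin] with t h3 h4
    have h5 : t - t₀ ≠ 0 := sub_ne_zero.2 h4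
    rw [slope_def_field, σ0, sub_zero, div_pow, div_le_iff₀ (by positivity)]
    linarith
  have h3 := (hasDerivAt_iff_tendsto_slope.1 hσa).pow 2
  have h4 : Tendsto (fun t => K * (|q t| + |r t|)) (𝓝[≠] t₀) (𝓝 (K * (|q t₀| + |r t₀|))) := by
    have : Continuous fun t => K * (|q t| + |r t|) := by
      have := hq.continuous
      have := hr.continuous
      fun_prop
    exact (this.tendsto t₀).mono_left nhdsWithin_le_nhds
  have h5 := le_of_tendsto_of_tendsto h3 h4 h2
  rw [q0, r0] at h5
  simp at h5
  exact ha h5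

lemma diffeo_rot (c d u v ε : ℝ) (hcd : c ^ 2 + d ^ 2 = 1) (hε : ε ^ 2 = 1) :
    DiffeoGermAt (fun p : ℝ × ℝ => (ε * (c * (p.1 - u) + d * (p.2 - v)), ε * (-d * (p.1 - u) + c * (p.2 - v))))
      (u, v) (0, 0) := by
  refine diffeo_iff.2 ⟨by simp, ?_, fun p => (u + ε * (c * p.1 - d * p.2), v + ε * (d * p.1 + c * p.2)), by simp, ?_, ?_, ?_⟩
  · exact ContDiff.smoothNear (by fun_prop) _
  · exact ContDiff.smoothNear (by fun_prop) _
  · refine Eventually.of_forall fun p => ?_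
    ext
    · simp only
      linear_combination (c ^ 2 + d ^ 2) * (p.1 - u) * hε + (p.1 - u) * hcd
    · simp only
      linear_combination (c ^ 2 + d ^ 2) * (p.2 - v) * hε + (p.2 - v) * hcd
  · refine Eventually.of_forall fun p => ?_
    ext
    · simp only
      linear_combination (c ^ 2 + d ^ 2) * p.1 * hε + p.1 * hcd
    · simp only
      linear_combination (c ^ 2 + d ^ 2) * p.2 * hε + p.2 * hcd

lemma diffeo_id_at (t₀ : ℝ) : DiffeoGermAt (fun t : ℝ => t) t₀ t₀ :=
  diffeo_iff.2 ⟨rfl, contDiff_id.smoothNear _, fun t => t, rfl, contDiff_id.smoothNear _,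
    Eventually.of_forall fun _ => rfl, Eventually.of_forall fun _ => rfl⟩

lemma reg_case {x z φ β : ℝ → ℝ} {t₀ : ℝ} (hx : ContDiff ℝ ∞ x) (hz : ContDiff ℝ ∞ z)
    (hφ : ContDiff ℝ ∞ φ) (hβ : ContDiff ℝ ∞ β)
    (hdx : ∀ t, deriv x t = -(β t) * sin (φ t)) (hdz : ∀ t, deriv z t = β t * cos (φ t))
    (β0 : β t₀ = 0) (β1 : deriv β t₀ ≠ 0) :
    (HasCuspAt (fun t => (x t, z t)) t₀ 2 3 ↔ deriv φ t₀ ≠ 0) ∧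
    (HasCuspAt (fun t => (x t, z t)) t₀ 2 5 ↔ (deriv φ t₀ = 0 ∧
      deriv (deriv β) t₀ * deriv (deriv φ) t₀ - deriv β t₀ * deriv (deriv (deriv φ)) t₀ ≠ 0)) := by
  obtain ⟨ε, hε, hpos⟩ : ∃ ε : ℝ, ε ^ 2 = 1 ∧ 0 < ε * deriv β t₀ := by
    rcases lt_or_gt_of_ne β1 with h | h
    · exact ⟨-1, by norm_num, by linarith⟩
    · exact ⟨1, by norm_num, by linarith⟩
  have ε0 : ε ≠ 0 := by rintro rfl; norm_num at hε
  set c := cos (φ t₀) with hc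
  set d := sin (φ t₀) with hd
  let X : ℝ → ℝ := fun t => ε * (c * (x t - x t₀) + d * (z t - z t₀))
  let Z : ℝ → ℝ := fun t => ε * (-d * (x t - x t₀) + c * (z t - z t₀))
  have hX : ContDiff ℝ ∞ X := by fun_prop
  have hZ : ContDiff ℝ ∞ Z := by fun_prop
  have eβ : deriv (fun t => ε * β t) = fun t => ε * deriv β t := funext fun t => ((hd_smooth hβ t).const_mul ε).deriv
  have eβ2 : deriv (fun t => ε * deriv β t) = fun t => ε * deriv (deriv β) t :=
    funext fun t => ((hd_smooth (deriv_smooth hβ) t).const_mul ε).deriv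
  have eφ : deriv (fun t => φ t - φ t₀) = deriv φ := funext fun t => deriv_sub_const _
  have key := norm_case (x := X) (z := Z) (φ := fun t => φ t - φ t₀) (β := fun t => ε * β t) (t₀ := t₀) hX hZ
    (by fun_prop) (by fun_prop) (fun t => by
      have := (((((hd_smooth hx t).sub_const (x t₀)).const_mul c).add (((hd_smooth hz t).sub_const (z t₀)).const_mul d)).const_mul ε).deriv
      refine Eq.trans this ?_
      rw [hdx, hdz, sin_sub, ← hc, ← hd]; ring) (fun t => by
      have := (((((hd_smooth hx t).sub_const (x t₀)).const_mul (-d)).add (((hd_smooth hz t).sub_const (z t₀)).const_mul c)).const_mul ε).deriv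
      refine Eq.trans this ?_
      rw [hdx, hdz, cos_sub, ← hc, ← hd]; ring) (by simp [X]) (by simp [Z]) (by simp) (by simp [β0])
      (by rw [eβ]; exact hpos)
  have hcusp : ∀ i j, HasCuspAt (fun t => (x t, z t)) t₀ i j ↔ HasCuspAt (fun t => (X t, Z t)) t₀ i j := by
    intro i j
    refine cusp_equiv (s := fun t => t)
      (L := fun p : ℝ × ℝ => (ε * (c * (p.1 - x t₀) + d * (p.2 - z t₀)), ε * (-d * (p.1 - x t₀) + c * (p.2 - z t₀)))) ?_
      (diffeo_id_at t₀) (hx.continuous.prodMk hz.continuous).continuousAt (Eventually.of_forall fun t => rfl)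
    have := diffeo_rot c d (x t₀) (z t₀) ε (by rw [hc, hd]; exact cos_sq_add_sin_sq _) hε
    simpa [X, Z] using this
  rw [eφ, eβ, eβ2] at key
  rw [hcusp, hcusp, key.1, key.2]
  refine ⟨Iff.rfl, and_congr_right fun _ => not_congr ?_⟩
  rw [show ε * deriv (deriv β) t₀ * deriv (deriv φ) t₀ - ε * deriv β t₀ * deriv (deriv (deriv φ)) t₀
    = ε * (deriv (deriv β) t₀ * deriv (deriv φ) t₀ - deriv β t₀ * deriv (deriv (deriv φ)) t₀) by ring]
  simp [ε0]

/-- Let `(γ, ν)` be a Legendre curve with `γ = (x, z)`,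
`ν = (cos φ, sin φ)`, curvature `(φ̇, β)`, and `β t₀ = 0`.  Then
(1) `γ` has a 3/2-cusp at `t₀` iff `β̇(t₀)φ̇(t₀) ≠ 0`;
(2) `γ` has a 5/2-cusp at `t₀` iff `β̇(t₀) ≠ 0`, `φ̇(t₀) = 0` and
`β̈(t₀)φ̈(t₀) - β̇(t₀)φ⃛(t₀) ≠ 0`. -/
theorem criteria_for_cusps_2_3_and_2_5
    (x z φ β : ℝ → ℝ) (t₀ : ℝ)
    (hx : ContDiff ℝ (⊤ : ℕ∞) x) (hz : ContDiff ℝ (⊤ : ℕ∞) z)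
    (hφ : ContDiff ℝ (⊤ : ℕ∞) φ) (hβ : ContDiff ℝ (⊤ : ℕ∞) β)
    (hdx : ∀ t, deriv x t = -(β t) * sin (φ t))
    (hdz : ∀ t, deriv z t = β t * cos (φ t))
    (hβ0 : β t₀ = 0) :
    (HasCuspAt (fun t => (x t, z t)) t₀ 2 3 ↔
      deriv β t₀ * deriv φ t₀ ≠ 0) ∧
    (HasCuspAt (fun t => (x t, z t)) t₀ 2 5 ↔
      (deriv β t₀ ≠ 0 ∧ deriv φ t₀ = 0 ∧
        iteratedDeriv 2 β t₀ * iteratedDeriv 2 φ t₀ -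
          deriv β t₀ * iteratedDeriv 3 φ t₀ ≠ 0)) := by
  have e2 : ∀ f : ℝ → ℝ, iteratedDeriv 2 f = deriv (deriv f) := fun f => by
    rw [iteratedDeriv_succ, iteratedDeriv_one]
  have e3 : ∀ f : ℝ → ℝ, iteratedDeriv 3 f = deriv (deriv (deriv f)) := fun f => by
    rw [iteratedDeriv_succ, e2]
  rw [e2, e2, e3]
  by_cases h : deriv β t₀ = 0
  · have x2 : deriv (deriv x) t₀ = 0 := by
      rw [show deriv x = fun t => -(β t) * sin (φ t) from funext hdx]
      refine Eq.trans ((hd_smooth hβ t₀).neg.mul (hd_smooth hφ t₀).sin).deriv ?_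
      simp [h, hβ0]
    have z2 : deriv (deriv z) t₀ = 0 := by
      rw [show deriv z = fun t => β t * cos (φ t) from funext hdz]
      refine Eq.trans ((hd_smooth hβ t₀).mul (hd_smooth hφ t₀).cos).deriv ?_
      simp [h, hβ0]
    have n := fun (j : ℕ) => degenerate_case (j := j) hx hz (by simp [hdx, hβ0]) (by simp [hdz, hβ0]) x2 z2
    exact ⟨iff_of_false (n 3) (by simp [h]), iff_of_false (n 5) (by simp [h])⟩
  · obtain ⟨h1, h2⟩ := reg_case hx hz hφ hβ hdx hdz hβ0 h
    rw [h1, h2]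
    refine ⟨by simp [h], by simp [h]⟩
end

section
/- Let (γ,ν): (I,t₀) → ℝ² × S¹ be a Legendre curve with ν(t)=(cos φ(t), sin φ(t)) and curvature (φ̇,β), and assume β(t₀) = 0. Then: (1) γ has a 4/3-cusp at t₀ if and only if β̇(t₀) = 0 and β̈(t₀)φ̇(t₀) ≠ 0; (2) γ has a 5/3-cusp at t₀ if and only if β̇(t₀) = φ̇(t₀) = 0 and β̈(t₀)φ̈(t₀) ≠ 0. -/
open Real

open scoped ContDiff Topology

theorem cont_aux (n : ℕ) (W : ℝ → ℝ) (hW : Continuous W) (t : ℝ) :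
    Continuous (fun σ : ℝ => σ ^ n * W (σ * t)) := by fun_prop

theorem parint_hasDeriv (n : ℕ) (W : ℝ → ℝ) (hW : ContDiff ℝ 1 W) (t : ℝ) :
    HasDerivAt (fun t => ∫ σ in (0:ℝ)..1, σ ^ n * W (σ * t))
      (∫ σ in (0:ℝ)..1, σ ^ (n+1) * deriv W (σ * t)) t := by
  have hW' : Continuous (deriv W) := hW.continuous_deriv le_rfl
  obtain ⟨C, hC⟩ := (isCompact_Icc (a := -(|t|+1)) (b := |t|+1)).exists_bound_of_continuousOn
    hW'.continuousOn
  refine (intervalIntegral.hasDerivAt_integral_of_dominated_loc_of_deriv_le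
    (F := fun t σ => σ ^ n * W (σ * t)) (F' := fun t σ => σ ^ (n+1) * deriv W (σ * t))
    (bound := fun _ => C) (s := Metric.ball t 1) (Metric.ball_mem_nhds t one_pos)
    ?_ ?_ ?_ ?_ ?_ ?_).2
  · exact Filter.Eventually.of_forall fun t => (cont_aux n W hW.continuous t).aestronglyMeasurable
  · exact (cont_aux n W hW.continuous t).intervalIntegrable _ _
  · exact (cont_aux (n+1) _ hW' t).aestronglyMeasurable
  · refine Filter.Eventually.of_forall fun σ hσ y hy => ?_
    rw [Set.uIoc_of_le zero_le_one] at hσ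
    have hy' : |y| ≤ |t| + 1 := by
      rw [Metric.mem_ball, Real.dist_eq] at hy
      have := abs_sub_abs_le_abs_sub y t
      linarith
    have h1 : |σ * y| ≤ |t| + 1 := by
      rw [abs_mul, abs_of_pos hσ.1]
      nlinarith [abs_nonneg y, hσ.2]
    have h2 := hC (σ * y) (abs_le.1 h1)
    rw [norm_mul, norm_pow, Real.norm_eq_abs, abs_of_pos hσ.1]
    have h3 : σ ^ (n+1) ≤ 1 := pow_le_one₀ hσ.1.le hσ.2
    have h4 := norm_nonneg (deriv W (σ * y))
    have h5 : 0 ≤ σ ^ (n+1) := pow_nonneg hσ.1.le _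
    nlinarith
  · exact intervalIntegrable_const
  · refine Filter.Eventually.of_forall fun σ _ y _ => ?_
    have h := (hW.differentiable one_ne_zero (σ * y)).hasDerivAt
    have h2 : HasDerivAt (fun y => σ * y) σ y := by simpa using (hasDerivAt_id y).const_mul σ
    have h3 := (h.comp y h2).const_mul (σ ^ n)
    refine h3.congr_deriv ?_
    ring

theorem parint_contDiff_nat (m : ℕ) : ∀ (n : ℕ) (W : ℝ → ℝ), ContDiff ℝ ∞ W →
    ContDiff ℝ m (fun t => ∫ σ in (0:ℝ)..1, σ ^ n * W (σ * t)) := by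
  induction m with
  | zero =>
    intro n W hW
    exact contDiff_zero.2 (continuous_iff_continuousAt.2 fun t =>
      (parint_hasDeriv n W (hW.of_le (by norm_cast)) t).continuousAt)
  | succ m ih =>
    intro n W hW
    have h := parint_hasDeriv n W (hW.of_le (by norm_cast))
    push_cast
    refine contDiff_succ_iff_deriv.2 ⟨fun t => (h t).differentiableAt, by simp, ?_⟩
    have : deriv (fun t => ∫ σ in (0:ℝ)..1, σ ^ n * W (σ * t)) =
      fun t => ∫ σ in (0:ℝ)..1, σ ^ (n+1) * deriv W (σ * t) := funext fun t => (h t).deriv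
    rw [this]
    exact ih (n+1) _ (contDiff_infty_iff_deriv.1 hW).2

theorem parint_contDiff (n : ℕ) (W : ℝ → ℝ) (hW : ContDiff ℝ ∞ W) :
    ContDiff ℝ ∞ (fun t => ∫ σ in (0:ℝ)..1, σ ^ n * W (σ * t)) :=
  contDiff_infty.2 fun m => parint_contDiff_nat m n W hW

theorem hadamard0 (n : ℕ) (v W : ℝ → ℝ) (hW : ContDiff ℝ ∞ W) (hv0 : v 0 = 0)
    (hd : ∀ t, HasDerivAt v (t ^ n * W t) t) :
    ∃ V : ℝ → ℝ, ContDiff ℝ ∞ V ∧ (∀ t, v t = t ^ (n+1) * V t) ∧ (n+1) * V 0 = W 0 := by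
  refine ⟨_, parint_contDiff n W hW, fun t => ?_, ?_⟩
  · have h : ∀ σ : ℝ, HasDerivAt (fun σ => v (σ * t)) (t ^ (n+1) * (σ ^ n * W (σ * t))) σ := by
      intro σ
      have h2 : HasDerivAt (fun σ => σ * t) t σ := by simpa using (hasDerivAt_id σ).mul_const t
      refine ((hd (σ * t)).comp σ h2).congr_deriv ?_
      ring
    have := intervalIntegral.integral_eq_sub_of_hasDerivAt (a := 0) (b := 1) (fun σ _ => h σ)
      (((cont_aux n W hW.continuous t).const_smul (t^(n+1))).intervalIntegrable _ _)
    rw [intervalIntegral.integral_const_mul] at this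
    rw [this]; simp [hv0]
  · simp
    field_simp

theorem hadamard_s16 (a : ℝ) (n : ℕ) (v W : ℝ → ℝ) (hW : ContDiff ℝ ∞ W) (hv0 : v a = 0)
    (hd : ∀ t, HasDerivAt v ((t - a) ^ n * W t) t) :
    ∃ V : ℝ → ℝ, ContDiff ℝ ∞ V ∧ (∀ t, v t = (t - a) ^ (n+1) * V t) ∧ (n+1) * V a = W a := by
  obtain ⟨V, h1, h2, h3⟩ := hadamard0 n (fun t => v (t + a)) (fun t => W (t + a))
    (hW.comp (by fun_prop)) (by simpa using hv0) (fun t => by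
      have := (hd (t + a)).comp_add_const t a
      simpa using this)
  refine ⟨fun t => V (t - a), h1.comp (by fun_prop), fun t => ?_, by simpa using h3⟩
  have := h2 (t - a)
  simpa using this

theorem hadamard1 (a : ℝ) (v : ℝ → ℝ) (hv : ContDiff ℝ ∞ v) (hv0 : v a = 0) :
    ∃ V : ℝ → ℝ, ContDiff ℝ ∞ V ∧ (∀ t, v t = (t - a) * V t) ∧ V a = deriv v a := by
  obtain ⟨V, h1, h2, h3⟩ := hadamard_s16 a 0 v (deriv v) (contDiff_infty_iff_deriv.1 hv).2 hv0
    (fun t => by simpa using (hv.differentiable (by simp) t).hasDerivAt)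
  exact ⟨V, h1, by simpa using h2, by simpa using h3⟩

/-- Taylor coefficients sequence, in O form. -/
theorem taylorO (R : ℝ → ℝ) (hR : ContDiff ℝ ∞ R) :
    ∃ c : ℕ → ℝ, ∀ N, (fun w => R w - ∑ k ∈ Finset.range N, c k * w ^ k) =O[𝓝 0] (fun w => w ^ N) := by
  have step : ∀ f : {f : ℝ → ℝ // ContDiff ℝ ∞ f}, ∃ g : {f : ℝ → ℝ // ContDiff ℝ ∞ f},
      ∀ t, f.1 t = f.1 0 + t * g.1 t := by
    rintro ⟨f, hf⟩
    obtain ⟨V, h1, h2, -⟩ := hadamard1 0 (fun t => f t - f 0) (hf.sub contDiff_const) (by simp)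
    exact ⟨⟨V, h1⟩, fun t => by have := h2 t; simp at this ⊢; linarith⟩
  choose S hS using step
  let F : ℕ → {f : ℝ → ℝ // ContDiff ℝ ∞ f} := fun n => S^[n] ⟨R, hR⟩
  have hF : ∀ n t, (F n).1 t = (F n).1 0 + t * (F (n+1)).1 t := by
    intro n t
    have : F (n+1) = S (F n) := Function.iterate_succ_apply' _ _ _
    rw [this]; exact hS _ t
  have key : ∀ N w, R w - ∑ k ∈ Finset.range N, (F k).1 0 * w ^ k = w ^ N * (F N).1 w := by
    intro N w
    induction N with
    | zero => simp [F]
    | succ N ih =>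
      rw [Finset.sum_range_succ, ← sub_sub, ih, hF N w]; ring
  refine ⟨fun k => (F k).1 0, fun N => ?_⟩
  simp_rw [key]
  have h1 : (F N).1 =O[𝓝 0] (fun _ => (1:ℝ)) := (F N).2.continuous.continuousAt.isBigO_one ℝ
  simpa using (Asymptotics.isBigO_refl (fun w : ℝ => w ^ N) (𝓝 0)).mul h1

theorem borel_bounds (n k : ℕ) (χ : ContDiffBump (0:ℝ)) :
    ∃ C : ℝ, 0 ≤ C ∧ ∀ x, ‖iteratedDeriv k (fun x : ℝ => x ^ n * χ x) x‖ ≤ C := by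
  have hs : ContDiff ℝ ∞ (fun x : ℝ => x ^ n * χ x) := by
    have := χ.contDiff (n := ⊤)
    fun_prop
  have hc : HasCompactSupport (fun x : ℝ => x ^ n * χ x) := χ.hasCompactSupport.mul_left
  obtain ⟨C, hC⟩ := (hs.continuous_iteratedFDeriv (m := k) (by norm_cast; exact le_top)).bounded_above_of_compact_support
    (hc.iteratedFDeriv k)
  refine ⟨C, (norm_nonneg _).trans (hC 0), fun x => ?_⟩
  rw [← norm_iteratedFDeriv_eq_norm_iteratedDeriv]
  exact hC x

theorem borel_lem (a : ℕ → ℝ) : ∃ f : ℝ → ℝ, ContDiff ℝ ∞ f ∧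
    ∀ N, (fun w => f w - ∑ k ∈ Finset.range N, a k * w ^ k) =O[𝓝 0] (fun w => w ^ N) := by
  let χ : ContDiffBump (0:ℝ) := ⟨1, 2, one_pos, one_lt_two⟩
  have hχs := χ.contDiff (n := ⊤)
  choose C hC0 hC using fun n k => borel_bounds n k χ
  let M : ℕ → ℝ := fun n => 1 + |a n| * 2 ^ n * (1 + ∑ k ∈ Finset.range n, C n k)
  have hsum0 : ∀ n, 0 ≤ ∑ k ∈ Finset.range n, C n k := fun n => Finset.sum_nonneg fun k _ => hC0 n k
  have hP : ∀ n, 0 ≤ |a n| * 2 ^ n := fun n => by positivity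
  have hM1 : ∀ n, 1 ≤ M n := fun n => by
    have := mul_nonneg (hP n) (by linarith [hsum0 n] : 0 ≤ 1 + ∑ k ∈ Finset.range n, C n k)
    simp only [M]; linarith
  have hMa : ∀ n, |a n| * 2 ^ n ≤ M n := fun n => by
    simp only [M]; nlinarith [hP n, mul_nonneg (hP n) (hsum0 n)]
  have hMC : ∀ n k, k < n → |a n| * 2 ^ n * C n k ≤ M n := fun n k hk => by
    have := Finset.single_le_sum (f := fun k => C n k) (fun k _ => hC0 n k) (Finset.mem_range.2 hk)
    have := mul_le_mul_of_nonneg_left this (hP n)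
    simp only [M]; nlinarith [hP n]
  let f : ℕ → ℝ → ℝ := fun n x => a n * x ^ n * χ (M n * x)
  have hfs : ∀ n, ContDiff ℝ ∞ (f n) := fun n => by
    have : ContDiff ℝ ∞ (fun x => χ (M n * x)) := hχs.comp (by fun_prop)
    simp only [f]; fun_prop
  have hfg : ∀ n, f n = fun x => (a n / M n ^ n) * (fun x : ℝ => (fun y : ℝ => y ^ n * χ y) (M n * x)) x := by
    intro n; ext x
    have : M n ≠ 0 := by linarith [hM1 n]
    simp only [f]; rw [mul_pow]; field_simp
  have hb : ∀ n k, k < n → ∀ x, ‖iteratedFDeriv ℝ k (f n) x‖ ≤ (1/2) ^ n := by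
    intro n k hk x
    have hM0 : 0 < M n := by linarith [hM1 n]
    rw [norm_iteratedFDeriv_eq_norm_iteratedDeriv, hfg, iteratedDeriv_const_mul_field,
      iteratedDeriv_comp_const_mul (f := fun y : ℝ => y ^ n * χ y)
        (ContDiff.mul (by fun_prop) (hχs.of_le (by norm_cast; exact le_top)))]
    rw [norm_mul, norm_mul, norm_div, norm_pow, norm_pow, Real.norm_eq_abs, Real.norm_eq_abs, abs_of_pos hM0]
    have h1 : M n ^ k * M n ≤ M n ^ n := by
      rw [← pow_succ]; exact pow_le_pow_right₀ (hM1 n) hk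
    have h2 := hC n k (M n * x)
    have h3 : |a n| * C n k ≤ M n * (1/2)^n := by
      have := hMC n k hk
      rw [one_div, inv_pow, ← div_eq_mul_inv, le_div_iff₀ (by positivity)]; linarith
    calc |a n| / M n ^ n * (M n ^ k * ‖iteratedDeriv k (fun y : ℝ => y ^ n * χ y) (M n * x)‖)
        ≤ |a n| / M n ^ n * (M n ^ k * C n k) := by gcongr
      _ = (|a n| * C n k) * M n ^ k / M n ^ n := by ring
      _ ≤ (M n * (1/2)^n) * M n ^ k / M n ^ n := by gcongr
      _ = (M n ^ k * M n) / M n ^ n * (1/2)^n := by ring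
      _ ≤ 1 * (1/2)^n := by
        gcongr
        rw [div_le_one (by positivity)]; exact h1
      _ = _ := one_mul _
  have hgeo : Summable fun n : ℕ => ((1:ℝ)/2) ^ n := summable_geometric_two
  have hsumm : ∀ x, Summable fun n => f n x := by
    intro x
    refine .of_norm_bounded_eventually (g := fun n => (1/2)^n) hgeo ?_
    rw [Nat.cofinite_eq_atTop]
    filter_upwards [Filter.eventually_gt_atTop 0] with n hn
    simpa using hb n 0 hn x
  refine ⟨fun x => ∑' n, f n x, ?_, fun N => ?_⟩
  · refine contDiff_tsum_of_eventually (N := ⊤) (v := fun _ n => (1/2)^n) hfs (fun _ _ => hgeo) ?_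
    intro k _
    rw [Nat.cofinite_eq_atTop]
    filter_upwards [Filter.eventually_gt_atTop k] with n hn
    exact hb n k hn
  · have hloc : ∀ n, ∀ᶠ x in 𝓝 (0:ℝ), f n x = a n * x ^ n := by
      intro n
      have ht : Filter.Tendsto (fun x : ℝ => M n * x) (𝓝 0) (𝓝 0) := by
        have : Continuous (fun x : ℝ => M n * x) := by fun_prop
        simpa using this.tendsto 0
      filter_upwards [ht.eventually χ.eventuallyEq_one] with x hx
      simp [f, hx]
    have hloc' : ∀ᶠ x in 𝓝 (0:ℝ), ∀ n ∈ Finset.range (N+1), f n x = a n * x ^ n :=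
      (Filter.eventually_all_finset _).2 fun n _ => hloc n
    refine Asymptotics.IsBigO.of_bound (|a N| + 4) ?_
    filter_upwards [hloc', Metric.ball_mem_nhds (0:ℝ) one_pos] with x hx hx1
    rw [Metric.mem_ball, dist_zero_right, Real.norm_eq_abs] at hx1
    have hs := (hsumm x).sum_add_tsum_nat_add (N+1)
    rw [Finset.sum_congr rfl hx, Finset.sum_range_succ] at hs
    rw [← hs]
    have htail : ‖∑' i, f (i + (N+1)) x‖ ≤ |x| ^ N * 4 := by
      have hg : HasSum (fun i : ℕ => |x| ^ N * (2 * ((1:ℝ)/2) ^ i)) (|x| ^ N * (2 * 2)) :=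
        (hasSum_geometric_two.mul_left 2).mul_left _
      have : |x| ^ N * (4:ℝ) = |x| ^ N * (2 * 2) := by norm_num
      rw [this]
      refine tsum_of_norm_bounded hg fun i => ?_
      set n := i + (N+1) with hn
      have hM0 : 0 < M n := by linarith [hM1 n]
      by_cases hbig : 2 ≤ |M n * x|
      · have : χ (M n * x) = 0 := χ.zero_of_le_dist (by simpa [χ, Real.dist_eq] using hbig)
        simp only [f, this]
        simp
      · push Not at hbig
        rw [abs_mul, abs_of_pos hM0] at hbig
        have hχ1 : |χ (M n * x)| ≤ 1 := by
          rw [abs_of_nonneg χ.nonneg]; exact χ.le_one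
        have e1 : |x| ^ n = |x| ^ N * |x| * |x| ^ i := by rw [hn]; ring
        have e2 : |x| ^ i ≤ 1 := pow_le_one₀ (abs_nonneg _) hx1.le
        have e3 : |a n| * |x| ≤ 2 * (1/2) ^ n := by
          have h := hMa n
          have h5 : |a n| * 2 ^ n * |x| ≤ 2 := by nlinarith [abs_nonneg x]
          rw [one_div, inv_pow, ← div_eq_mul_inv, le_div_iff₀ (by positivity)]; linarith
        have e4 : ((1:ℝ)/2) ^ n ≤ (1/2) ^ i := pow_le_pow_of_le_one (by norm_num) (by norm_num) (by omega)
        simp only [f]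
        rw [norm_mul, norm_mul, norm_pow]
        simp only [Real.norm_eq_abs]
        calc |a n| * |x| ^ n * |χ (M n * x)| ≤ |a n| * |x| ^ n * 1 := by gcongr
          _ = |x| ^ N * (|a n| * |x|) * |x| ^ i := by rw [e1]; ring
          _ ≤ |x| ^ N * (2 * (1/2) ^ n) * 1 := by gcongr
          _ ≤ |x| ^ N * (2 * (1/2) ^ i) := by rw [mul_one]; gcongr
    have e : ∑ k ∈ Finset.range N, a k * x ^ k + a N * x ^ N + ∑' i, f (i + (N+1)) x
        - ∑ k ∈ Finset.range N, a k * x ^ k = a N * x ^ N + ∑' i, f (i + (N+1)) x := by ring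
    rw [e]
    refine (norm_add_le _ _).trans ?_
    rw [norm_mul, norm_pow]
    simp only [Real.norm_eq_abs] at htail ⊢
    linarith

def FlatZ (r : ℝ → ℝ) : Prop := ∀ N : ℕ, r =O[𝓝 0] (fun w => w ^ N)

theorem bigO_div (g : ℝ → ℝ) (hg : Continuous g) (N : ℕ)
    (h : (fun w => w * g w) =O[𝓝 0] (fun w => w ^ (N+1))) : g =O[𝓝 0] (fun w => w ^ N) := by
  obtain ⟨C, hC⟩ := h.bound
  have h1 : ∀ᶠ w in 𝓝[≠] (0:ℝ), ‖g w‖ ≤ C * ‖w ^ N‖ := by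
    filter_upwards [hC.filter_mono nhdsWithin_le_nhds, self_mem_nhdsWithin] with w hw hw0
    have hw0 : 0 < |w| := abs_pos.2 hw0
    rw [pow_succ', norm_mul, norm_mul, Real.norm_eq_abs w] at hw
    have : |w| * ‖g w‖ ≤ |w| * (C * ‖w ^ N‖) := by linarith
    exact le_of_mul_le_mul_left this hw0
  have h0 : ‖g 0‖ ≤ C * ‖(0:ℝ) ^ N‖ := by
    have c1 : Continuous fun w => ‖g w‖ := by fun_prop
    have c2 : Continuous fun w : ℝ => C * ‖w ^ N‖ := by fun_prop
    exact le_of_tendsto_of_tendsto ((c1.tendsto 0).mono_left nhdsWithin_le_nhds)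
      ((c2.tendsto 0).mono_left nhdsWithin_le_nhds) h1
  refine Asymptotics.IsBigO.of_bound C ?_
  rw [eventually_nhdsWithin_iff] at h1
  filter_upwards [h1] with w hw
  by_cases hw0 : w = 0
  · rw [hw0]; exact h0
  · exact hw hw0

theorem FlatZ.div {r : ℝ → ℝ} (hr : ContDiff ℝ ∞ r) (hf : FlatZ r) :
    ∃ g : ℝ → ℝ, ContDiff ℝ ∞ g ∧ FlatZ g ∧ ∀ w, r w = w * g w := by
  have h0 : r 0 = 0 := by
    obtain ⟨C, hC⟩ := (hf 1).bound
    have := hC.self_of_nhds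
    simpa using this
  obtain ⟨g, h1, h2, -⟩ := hadamard1 0 r hr h0
  have h2' : r = fun w => w * g w := by ext w; simpa using h2 w
  refine ⟨g, h1, fun N => bigO_div g h1.continuous N ?_, fun w => by simpa using h2 w⟩
  rw [← h2']; exact hf _

theorem FlatZ.deriv {r : ℝ → ℝ} (hr : ContDiff ℝ ∞ r) (hf : FlatZ r) : FlatZ (deriv r) := by
  intro N
  induction N generalizing r with
  | zero =>
    simpa using ((contDiff_infty_iff_deriv.1 hr).2.continuous.continuousAt (x := 0)).isBigO_one ℝ
  | succ N ih =>
    obtain ⟨g, h1, h2, h3⟩ := hf.div hr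
    have : _root_.deriv r = fun w => g w + w * _root_.deriv g w := by
      ext w
      have hrw : r = fun w => w * g w := funext h3
      rw [hrw]
      have := (hasDerivAt_id w).mul (h1.differentiable (by simp) w).hasDerivAt
      refine (this.congr_deriv ?_).deriv
      simp
    rw [this]
    refine (h2 (N+1)).add ?_
    simp_rw [pow_succ']
    exact (Asymptotics.isBigO_refl _ _).mul (ih h1 h2)

theorem exists_cbrt : ∃ cb : ℝ → ℝ, Continuous cb ∧ (∀ x, cb x ^ 3 = x) ∧ ∀ x, cb (x ^ 3) = x := by
  have h3 : Odd 3 := by decide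
  have hm : StrictMono (fun x : ℝ => x ^ 3) := h3.strictMono_pow
  have hs : Function.Surjective (fun x : ℝ => x ^ 3) := by

    have hpos : ∀ y : ℝ, 0 ≤ y → (y ^ ((3:ℕ):ℝ)⁻¹) ^ 3 = y := fun y hy =>
      Real.rpow_inv_natCast_pow hy (by norm_num)
    intro y
    rcases le_total 0 y with hy | hy
    · exact ⟨_, hpos y hy⟩
    · refine ⟨-((-y) ^ ((3:ℕ):ℝ)⁻¹), ?_⟩
      have := hpos (-y) (by linarith)
      simp only [h3.neg_pow, this, neg_neg]
  let e := hm.orderIsoOfSurjective _ hs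
  exact ⟨e.symm, e.symm.continuous, fun x => e.apply_symm_apply x, fun x => e.symm_apply_apply x⟩

theorem flat_cbrt (cb : ℝ → ℝ) (hc : Continuous cb) (h1 : ∀ x, cb x ^ 3 = x)
    (h2 : ∀ x, cb (x ^ 3) = x) (m : ℕ) : ∀ r : ℝ → ℝ, ContDiff ℝ ∞ r → FlatZ r →
    ContDiff ℝ m (fun x => r (cb x)) := by
  have hcb0 : cb 0 = 0 := by simpa using h2 0
  induction m with
  | zero => intro r hr _; exact contDiff_zero.2 (hr.continuous.comp hc)
  | succ m ih =>
    intro r hr hf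
    obtain ⟨g1, s1, f1, e1⟩ := (hf.deriv hr).div (contDiff_infty_iff_deriv.1 hr).2
    obtain ⟨g2, s2, f2, e2⟩ := f1.div s1
    have hd : ∀ x, HasDerivAt (fun x => r (cb x)) (g2 (cb x) / 3) x := by
      intro x
      by_cases hx : x = 0
      · subst hx
        have hg0 : g2 0 = 0 := by
          obtain ⟨C, hC⟩ := (f2 1).bound
          simpa using hC.self_of_nhds
        have hr0 : r 0 = 0 := by
          obtain ⟨C, hC⟩ := (hf 1).bound
          simpa using hC.self_of_nhds
        rw [hcb0, hg0, zero_div, hasDerivAt_iff_isLittleO]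
        have ht : Filter.Tendsto cb (𝓝 0) (𝓝 0) := by simpa [hcb0] using hc.tendsto 0
        have hO : (fun x => r (cb x)) =O[𝓝 0] fun x : ℝ => x ^ 2 := by
          have := (hf 6).comp_tendsto ht
          refine this.congr_right fun x => ?_
          simp only [Function.comp]
          rw [← h1 x, h2]; ring
        have := hO.trans_isLittleO (Asymptotics.isLittleO_pow_id (n := 2) (by norm_num))
        simpa [hcb0, hr0] using this
      · have hcx : cb x ≠ 0 := by
          intro h; apply hx; rw [← h1 x, h]; norm_num
        have hp : HasDerivAt (fun x : ℝ => x ^ 3) (3 * cb x ^ 2) (cb x) := by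
          simpa using hasDerivAt_pow 3 (cb x)
        have hcd := hp.of_local_left_inverse hc.continuousAt (by positivity)
          (Filter.Eventually.of_forall h1)
        have := ((hr.differentiable (by simp) (cb x)).hasDerivAt).comp x hcd
        refine this.congr_deriv ?_
        rw [e1, e2]; field_simp
    push_cast
    refine contDiff_succ_iff_deriv.2 ⟨fun t => (hd t).differentiableAt, by simp, ?_⟩
    rw [show deriv (fun x => r (cb x)) = fun x => g2 (cb x) / 3 from funext fun t => (hd t).deriv]
    exact (ih g2 s2 f2).div_const 3

theorem decomp3 (R : ℝ → ℝ) (hR : ContDiff ℝ ∞ R) : ∃ a b c : ℝ → ℝ, ContDiff ℝ ∞ a ∧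
    ContDiff ℝ ∞ b ∧ ContDiff ℝ ∞ c ∧
    ∀ w, R w = a (w ^ 3) + w * b (w ^ 3) + w ^ 2 * c (w ^ 3) := by
  obtain ⟨r, hr⟩ := taylorO R hR
  obtain ⟨a, sa, ha⟩ := borel_lem fun n => r (3 * n)
  obtain ⟨b, sb, hb⟩ := borel_lem fun n => r (3 * n + 1)
  obtain ⟨c, sc, hc⟩ := borel_lem fun n => r (3 * n + 2)
  obtain ⟨cb, ccb, h1, h2⟩ := exists_cbrt
  let ρ : ℝ → ℝ := fun w => R w - (a (w ^ 3) + w * b (w ^ 3) + w ^ 2 * c (w ^ 3))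
  have hρ : ContDiff ℝ ∞ ρ := by
    have := sa.comp (f := fun w : ℝ => w ^ 3) (by fun_prop)
    have := sb.comp (f := fun w : ℝ => w ^ 3) (by fun_prop)
    have := sc.comp (f := fun w : ℝ => w ^ 3) (by fun_prop)
    simp only [Function.comp_def] at *
    simp only [ρ]; fun_prop
  have ht : Filter.Tendsto (fun w : ℝ => w ^ 3) (𝓝 0) (𝓝 0) := by
    have : Continuous (fun w : ℝ => w ^ 3) := by fun_prop
    simpa using this.tendsto 0
  have hsum : ∀ N (w : ℝ), ∑ k ∈ Finset.range (3 * N), r k * w ^ k =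
      ∑ k ∈ Finset.range N, r (3 * k) * (w ^ 3) ^ k
      + w * ∑ k ∈ Finset.range N, r (3 * k + 1) * (w ^ 3) ^ k
      + w ^ 2 * ∑ k ∈ Finset.range N, r (3 * k + 2) * (w ^ 3) ^ k := by
    intro N w
    induction N with
    | zero => simp
    | succ N ih =>
      rw [show 3 * (N+1) = 3 * N + 1 + 1 + 1 by ring]
      simp only [Finset.sum_range_succ]
      rw [ih]; ring
  have hflat3 : ∀ N : ℕ, ρ =O[𝓝 0] fun w => w ^ (3 * N) := by
    intro N
    have k1 := (ha N).comp_tendsto ht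
    have k2 := (hb N).comp_tendsto ht
    have k3 := (hc N).comp_tendsto ht
    have i1 : (fun w : ℝ => w) =O[𝓝 0] (fun _ => (1:ℝ)) := continuousAt_id.isBigO_one ℝ
    have i2 : (fun w : ℝ => w ^ 2) =O[𝓝 0] (fun _ => (1:ℝ)) :=
      (continuous_pow 2).continuousAt.isBigO_one ℝ
    have k2' := i1.mul k2
    have k3' := i2.mul k3
    simp only [Function.comp_def, one_mul, ← pow_mul] at k1 k2' k3'
    have := (((hr (3 * N)).sub k1).sub k2').sub k3'
    refine this.congr_left fun w => ?_
    rw [hsum N w]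
    simp only [ρ, ← pow_mul]
    ring
  have hflat : FlatZ ρ := fun N => (hflat3 N).trans <| by
    refine Asymptotics.IsBigO.of_bound 1 ?_
    filter_upwards [Metric.ball_mem_nhds (0:ℝ) one_pos] with x hx1
    rw [Metric.mem_ball, dist_zero_right] at hx1
    rw [norm_pow, norm_pow, one_mul]
    exact pow_le_pow_of_le_one (norm_nonneg _) hx1.le (by omega)
  have hs : ContDiff ℝ ∞ (fun x => ρ (cb x)) :=
    contDiff_infty.2 fun m => flat_cbrt cb ccb h1 h2 m ρ hρ hflat
  refine ⟨fun x => a x + ρ (cb x), b, c, sa.add hs, sb, sc, fun w => ?_⟩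
  simp only [h2, ρ]; ring

theorem ift_germ {E : Type*} [NormedAddCommGroup E] [NormedSpace ℝ E] [FiniteDimensional ℝ E]
    (f : E → E) (hf : ContDiff ℝ ∞ f) (L : E →L[ℝ] E) (a : E) (hL : HasFDerivAt f L a)
    (hinj : ∀ w, L w = 0 → w = 0) : DiffeoGermAt f a (f a) := by
  have : CompleteSpace E := FiniteDimensional.complete ℝ E
  let e0 : E ≃L[ℝ] E := (LinearEquiv.ofInjectiveEndo (L : E →ₗ[ℝ] E)
    ((injective_iff_map_eq_zero _).2 hinj)).toContinuousLinearEquiv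
  have he0 : (e0 : E →L[ℝ] E) = L := by ext w; rfl
  have hL' : HasFDerivAt f (e0 : E →L[ℝ] E) a := by rw [he0]; exact hL
  let e := hf.contDiffAt.toOpenPartialHomeomorph f hL' (by simp)
  have hef : (e : E → E) = f := rfl
  let O : Set E := fderiv ℝ f ⁻¹' Set.range ((↑) : (E ≃L[ℝ] E) → E →L[ℝ] E)
  have hO : IsOpen O := ContinuousLinearEquiv.isOpen.preimage (hf.continuous_fderiv (by simp))
  have haO : a ∈ O := ⟨e0, hL'.fderiv.symm⟩
  have has : a ∈ e.source := hf.contDiffAt.mem_toOpenPartialHomeomorph_source hL' (by simp)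
  let e' := e.restrOpen O hO
  have he'f : (e' : E → E) = f := rfl
  have hs' : e'.source = e.source ∩ O := e.restrOpen_source O hO
  refine ⟨rfl, e'.source, e'.target, e'.symm, e'.open_source, ?_, e'.open_target, ?_,
    hf.contDiffOn, ?_, e'.mapsTo, e'.symm_mapsTo, fun p hp => e'.left_inv hp,
    fun q hq => e'.right_inv hq⟩
  · rw [hs']; exact ⟨has, haO⟩
  · exact e'.map_source (by rw [hs']; exact ⟨has, haO⟩)
  · intro y hy
    have h1 := e'.map_target hy
    rw [hs'] at h1
    obtain ⟨e1, he1⟩ := h1.2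
    refine (e'.contDiffAt_symm (f₀' := e1) hy ?_ ?_).contDiffWithinAt
    · rw [he1]
      exact (hf.differentiable (by simp) _).hasFDerivAt
    · exact hf.contDiffAt

theorem globalize (f : ℝ → ℝ) (U : Set ℝ) (hU : IsOpen U) (a : ℝ) (ha : a ∈ U)
    (hf : ContDiffOn ℝ ∞ f U) : ∃ F : ℝ → ℝ, ContDiff ℝ ∞ F ∧ ∀ᶠ t in 𝓝 a, F t = f t := by
  obtain ⟨ε, hε, hb⟩ := Metric.isOpen_iff.1 hU a ha
  let χ : ContDiffBump a := ⟨ε/4, ε/2, by linarith, by linarith⟩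
  refine ⟨fun t => χ t * f t, ?_, ?_⟩
  · refine contDiff_iff_contDiffAt.2 fun t => ?_
    by_cases ht : t ∈ U
    · exact χ.contDiffAt.mul (hf.contDiffAt (hU.mem_nhds ht))
    · have : t ∈ (tsupport χ)ᶜ := by
        rw [χ.tsupport_eq]
        intro h
        apply ht; apply hb
        rw [Metric.mem_closedBall] at h
        rw [Metric.mem_ball]
        have : χ.rOut = ε/2 := rfl
        linarith
      have h0 : (fun t => χ t * f t) =ᶠ[𝓝 t] fun _ => 0 := by
        filter_upwards [(isClosed_tsupport χ).isOpen_compl.mem_nhds this] with y hy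
        rw [image_eq_zero_of_notMem_tsupport hy, zero_mul]
      exact contDiffAt_const.congr_of_eventuallyEq h0
  · filter_upwards [χ.eventuallyEq_one] with t ht
    rw [ht]; simp

theorem germ_inv (a : ℝ) (g : ℝ → ℝ) (hg : ContDiff ℝ ∞ g) (h0 : g a ≠ 0) :
    ∃ h : ℝ → ℝ, ContDiff ℝ ∞ h ∧ ∀ᶠ t in 𝓝 a, g t * h t = 1 := by
  have hU : IsOpen {t | g t ≠ 0} := isOpen_ne_fun hg.continuous continuous_const
  obtain ⟨F, hF, he⟩ := globalize (fun t => (g t)⁻¹) _ hU a h0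
    (hg.contDiffOn.inv fun t ht => ht)
  refine ⟨F, hF, ?_⟩
  filter_upwards [he, hU.mem_nhds h0] with t ht h1
  rw [ht]; exact mul_inv_cancel₀ h1

theorem germ_cbrt (a : ℝ) (U : ℝ → ℝ) (hU : ContDiff ℝ ∞ U) (h0 : U a ≠ 0) :
    ∃ m : ℝ → ℝ, ContDiff ℝ ∞ m ∧ (∀ᶠ t in 𝓝 a, m t ^ 3 = U t) ∧ m a ≠ 0 := by
  obtain ⟨cb, -, hc, -⟩ := exists_cbrt
  have hO : IsOpen {t | 0 < U t / U a} :=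
    isOpen_lt continuous_const (hU.continuous.div_const _)
  have ha : a ∈ {t | 0 < U t / U a} := by simp [h0]
  obtain ⟨F, hF, he⟩ := globalize (fun t => cb (U a) * (U t / U a) ^ ((3:ℕ):ℝ)⁻¹) _ hO a ha
    (contDiffOn_const.mul ((hU.div_const _).contDiffOn.rpow_const_of_ne fun t ht => ht.ne'))
  have h3 : ∀ᶠ t in 𝓝 a, F t ^ 3 = U t := by
    filter_upwards [he, hO.mem_nhds ha] with t ht h1
    rw [ht, mul_pow, hc, Real.rpow_inv_natCast_pow (le_of_lt h1) (by norm_num)]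
    field_simp
  refine ⟨F, hF, h3, fun h => h0 ?_⟩
  rw [← h3.self_of_nhds, h]; norm_num

theorem germ_had (a : ℝ) (s m f : ℝ → ℝ) (hs : ∀ t, s t = (t - a) * m t) (hm : ContDiff ℝ ∞ m)
    (hm0 : m a ≠ 0) (hf : ContDiff ℝ ∞ f) (hf0 : f a = 0) :
    ∃ g : ℝ → ℝ, ContDiff ℝ ∞ g ∧ ∀ᶠ t in 𝓝 a, f t = s t * g t := by
  obtain ⟨V, h1, h2, -⟩ := hadamard1 a f hf hf0
  obtain ⟨i, h3, h4⟩ := germ_inv a m hm hm0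
  refine ⟨fun t => V t * i t, h1.mul h3, ?_⟩
  filter_upwards [h4] with t ht
  rw [h2, hs]
  linear_combination (-(t-a) * V t) * ht

theorem prod_flat (f g : ℝ × ℝ → ℝ) (hf : ContDiff ℝ ∞ f) (hg : ContDiff ℝ ∞ g)
    (hf0 : f (0,0) = 0) (hg0 : g (0,0) = 0) :
    HasFDerivAt (fun q => f q * g q) (0 : ℝ × ℝ →L[ℝ] ℝ) (0,0) := by
  have := (hf.differentiable (by simp) (0,0)).hasFDerivAt.mul
    (hg.differentiable (by simp) (0,0)).hasFDerivAt
  refine this.congr_fderiv ?_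
  rw [hf0, hg0]; simp

theorem cusp_of_param (γ : ℝ → ℝ × ℝ) (a : ℝ) (i j : ℕ) (hi : i ≠ 0) (hj : j ≠ 0) (p : ℝ → ℝ)
    (hp : ContDiff ℝ ∞ p) (hp0 : p a = 0) (hp1 : deriv p a ≠ 0)
    (F : ℝ × ℝ → ℝ × ℝ) (hF : ContDiff ℝ ∞ F) (L : ℝ × ℝ →L[ℝ] ℝ × ℝ)
    (hL : HasFDerivAt F L (0,0)) (hinj : ∀ w, L w = 0 → w = 0)
    (he : ∀ᶠ t in 𝓝 a, γ t = F (p t ^ i, p t ^ j)) : HasCuspAt γ a i j := by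
  have dp : DiffeoGermAt p a (p a) := by
    refine ift_germ p hp _ a (hp.differentiable (by simp) a).hasDerivAt.hasFDerivAt ?_
    intro w hw
    simpa [hp1] using hw
  rw [hp0] at dp
  have dF := ift_germ F hF L (0,0) hL hinj
  have hγ : γ a = F (0,0) := by
    have := he.self_of_nhds
    simpa [hp0, hi, hj] using this
  obtain ⟨-, U, V, g, oU, aU, oV, qV, sF, sg, mF, mg, gl, gr⟩ := dF
  refine ⟨p, g, dp, ?_, ?_⟩
  · rw [hγ]
    exact ⟨gl _ aU, V, U, F, oV, qV, oU, aU, sg, sF, mg, mF, gr, gl⟩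
  · have hc : Continuous fun t => ((p t ^ i, p t ^ j) : ℝ × ℝ) := by
      have := hp.continuous
      fun_prop
    have : ∀ᶠ t in 𝓝 a, ((p t ^ i, p t ^ j) : ℝ × ℝ) ∈ U := by
      apply hc.continuousAt.eventually_mem
      rw [hp0]; simp only [zero_pow hi, zero_pow hj]
      exact oU.mem_nhds aU
    filter_upwards [he, this] with t h1 h2
    rw [h1, gl _ h2]

theorem core_final (x z u v : ℝ → ℝ) (a θ c l : ℝ) (j : ℕ) (hj : j ≠ 0) (hc : c ≠ 0)
    (p A B C : ℝ → ℝ)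
    (hp : ContDiff ℝ ∞ p) (hp0 : p a = 0) (hp1 : deriv p a ≠ 0)
    (hA : ContDiff ℝ ∞ A) (hB : ContDiff ℝ ∞ B) (hC : ContDiff ℝ ∞ C)
    (hx : ∀ t, x t = x a - u t * sin θ + v t * cos θ)
    (hz : ∀ t, z t = z a + u t * cos θ + v t * sin θ)
    (hu : ∀ᶠ t in 𝓝 a, p t ^ 3 = u t + l * v t)
    (hv : ∀ᶠ t in 𝓝 a, v t = c * p t ^ j + (p t ^ 3) ^ 2 * A (p t ^ 3)
      + p t ^ 3 * p t ^ j * B (p t ^ 3) + (p t ^ j) ^ 2 * C (p t ^ 3)) :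
    HasCuspAt (fun t => (x t, z t)) a 3 j := by
  have sA : ContDiff ℝ ∞ (fun q : ℝ × ℝ => A q.1) := hA.comp contDiff_fst
  have sB : ContDiff ℝ ∞ (fun q : ℝ × ℝ => B q.1) := hB.comp contDiff_fst
  have sC : ContDiff ℝ ∞ (fun q : ℝ × ℝ => C q.1) := hC.comp contDiff_fst
  let H : ℝ × ℝ → ℝ := fun q => c * q.2 + q.1 * (q.1 * A q.1 + q.2 * B q.1) + q.2 * (q.2 * C q.1)
  have sH : ContDiff ℝ ∞ H := by simp only [H]; fun_prop
  have dH : HasFDerivAt H (c • ContinuousLinearMap.snd ℝ ℝ ℝ) (0,0) := by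
    have h1 := prod_flat (fun q => q.1) (fun q => q.1 * A q.1 + q.2 * B q.1) (by fun_prop)
      (by fun_prop) (by simp) (by simp)
    have h2 := prod_flat (fun q => q.2) (fun q => q.2 * C q.1) (by fun_prop)
      (by fun_prop) (by simp) (by simp)
    have h3 : HasFDerivAt (fun q : ℝ × ℝ => c * q.2) (c • ContinuousLinearMap.snd ℝ ℝ ℝ) (0,0) :=
      hasFDerivAt_snd.const_mul c
    exact ((h3.add h1).add h2).congr_fderiv (by simp)
  have d1 : HasFDerivAt (fun q : ℝ × ℝ => q.1) (ContinuousLinearMap.fst ℝ ℝ ℝ) (0,0) := hasFDerivAt_fst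
  have e := d1.sub (dH.const_mul l)
  refine cusp_of_param _ a 3 j (by norm_num) hj p hp hp0 hp1
    (fun q => (x a - (q.1 - l * H q) * sin θ + H q * cos θ,
      z a + (q.1 - l * H q) * cos θ + H q * sin θ)) (by fun_prop) _
    (HasFDerivAt.prodMk (((e.mul_const (sin θ)).const_sub (x a)).add (dH.mul_const (cos θ)))
      (((e.mul_const (cos θ)).const_add (z a)).add (dH.mul_const (sin θ)))) ?_ ?_
  · rintro ⟨w1, w2⟩ hw
    have hcs := Real.sin_sq_add_cos_sq θ
    simp at hw
    obtain ⟨k1, k2⟩ := hw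
    have e1 : w1 - l * (c * w2) = 0 := by
      linear_combination (-sin θ) * k1 + cos θ * k2 - (w1 - l * (c * w2)) * hcs
    have e2 : c * w2 = 0 := by
      linear_combination (cos θ) * k1 + sin θ * k2 - (c * w2) * hcs
    have e3 : w2 = 0 := by simpa [hc] using e2
    subst e3
    simpa using e1
  · filter_upwards [hu, hv] with t h1 h2
    have hH : H (p t ^ 3, p t ^ j) = v t := by
      rw [h2]; simp only [H]; ring
    have hX : p t ^ 3 - l * v t = u t := by linarith
    simp only [hH, hX]
    rw [← hx, ← hz]

/-- substituting the inverse of `p` -/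
theorem germ_subst (a : ℝ) (p S : ℝ → ℝ) (hp : ContDiff ℝ ∞ p) (hp0 : p a = 0)
    (hp1 : deriv p a ≠ 0) (hS : ContDiff ℝ ∞ S) :
    ∃ R : ℝ → ℝ, ContDiff ℝ ∞ R ∧ ∀ᶠ t in 𝓝 a, S t = R (p t) := by
  have dp : DiffeoGermAt p a (p a) := by
    refine ift_germ p hp _ a (hp.differentiable (by simp) a).hasDerivAt.hasFDerivAt ?_
    intro w hw
    simpa [hp1] using hw
  rw [hp0] at dp
  obtain ⟨-, U, V, g, oU, aU, oV, qV, sF, sg, mF, mg, gl, gr⟩ := dp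
  obtain ⟨R, hR, he⟩ := globalize (fun w => S (g w)) V oV 0 qV (hS.comp_contDiffOn sg)
  refine ⟨R, hR, ?_⟩
  have ht : Filter.Tendsto p (𝓝 a) (𝓝 0) := by
    have := hp.continuous.tendsto a
    rwa [hp0] at this
  filter_upwards [ht.eventually he, oU.mem_nhds aU] with t h1 h2
  rw [h1, gl t h2]

theorem deriv_lin (a : ℝ) (n : ℝ → ℝ) (hn : ContDiff ℝ ∞ n) :
    deriv (fun t => (t - a) * n t) a = n a := by
  have := ((hasDerivAt_id a).sub_const a).mul (hn.differentiable (by simp) a).hasDerivAt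
  refine (this.congr_deriv ?_).deriv
  simp

theorem cube_one (k : ℝ) (h : k ^ 3 = 1) : k = 1 := by
  have : (k - 1) * ((k + 1/2)^2 + 3/4) = 0 := by linear_combination h
  rcases mul_eq_zero.1 this with h | h
  · linarith
  · nlinarith [sq_nonneg (k + 1/2)]

theorem suff34 (x z u v U V : ℝ → ℝ) (a θ : ℝ) (hU : ContDiff ℝ ∞ U) (hV : ContDiff ℝ ∞ V)
    (hU0 : U a ≠ 0) (hV0 : V a ≠ 0)
    (hu : ∀ t, u t = (t - a) ^ 3 * U t) (hv : ∀ t, v t = (t - a) ^ 4 * V t)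
    (hx : ∀ t, x t = x a - u t * sin θ + v t * cos θ)
    (hz : ∀ t, z t = z a + u t * cos θ + v t * sin θ) :
    HasCuspAt (fun t => (x t, z t)) a 3 4 := by
  obtain ⟨m, sm, hm, hm0⟩ := germ_cbrt a U hU hU0
  obtain ⟨i, si, hi⟩ := germ_inv a m sm hm0
  let s : ℝ → ℝ := fun t => (t - a) * m t
  have ss : ContDiff ℝ ∞ s := by simp only [s]; fun_prop
  have hs0 : s a = 0 := by simp [s]
  let g : ℝ → ℝ := fun t => V t * i t ^ 4
  have sg : ContDiff ℝ ∞ g := by simp only [g]; fun_prop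
  have hi0 := hi.self_of_nhds
  have hg0 : g a ≠ 0 := mul_ne_zero hV0 (pow_ne_zero _ (right_ne_zero_of_mul (by rw [hi0]; exact one_ne_zero)))
  obtain ⟨g1, sg1, hg1⟩ := germ_had a s m (fun t => g t - g a) (fun t => rfl) sm hm0 (by fun_prop)
    (by simp)
  let c := g a
  let l : ℝ := 3 * g1 a / (4 * c ^ 2)
  have hl : c * l * c * 4 = 3 * g1 a := by
    simp only [l, c]; field_simp
  obtain ⟨k, sk, hk, hk0⟩ := germ_cbrt a (fun t => 1 + l * s t * g t) (by fun_prop) (by simp [hs0])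
  have hk1 : k a = 1 := cube_one _ (by have := hk.self_of_nhds; simpa [hs0] using this)
  obtain ⟨j, sj, hj⟩ := germ_inv a (fun t => k t ^ 2 + k t + 1) (by fun_prop) (by rw [hk1]; norm_num)
  have hj0 : 3 * j a = 1 := by
    have := hj.self_of_nhds
    rw [hk1] at this; linarith
  obtain ⟨ik, sik, hik⟩ := germ_inv a k sk hk0
  let Q : ℝ → ℝ := fun t => (k t + 1) * (k t ^ 2 + 1) * j t
  have sQ : ContDiff ℝ ∞ Q := by simp only [Q]; fun_prop
  obtain ⟨K, sK, hK⟩ := germ_had a s m (fun t => g1 t - c * l * g t * Q t) (fun t => rfl) sm hm0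
    (by fun_prop) (by
      simp only [Q]; rw [hk1]
      linear_combination (-(1/3:ℝ)) * hl - (c * l * c * 4 / 3) * hj0)
  let p : ℝ → ℝ := fun t => (t - a) * (m t * k t)
  have sp : ContDiff ℝ ∞ p := by simp only [p]; fun_prop
  have hps : ∀ t, p t = s t * k t := fun t => by simp only [p, s]; ring
  have hp0 : p a = 0 := by simp [p]
  have hp1 : deriv p a ≠ 0 := by
    rw [deriv_lin a _ (by fun_prop)]; exact mul_ne_zero hm0 hk0
  obtain ⟨R, sR, hR⟩ := germ_subst a p (fun t => K t * ik t ^ 6) sp hp0 hp1 (by fun_prop)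
  obtain ⟨A, B, C, hA, hB, hC, hD⟩ := decomp3 R sR
  have eu : ∀ᶠ t in 𝓝 a, u t = s t ^ 3 := by
    filter_upwards [hm] with t ht
    rw [hu, ← ht]; simp only [s]; ring
  have ev : ∀ᶠ t in 𝓝 a, v t = s t ^ 4 * g t := by
    filter_upwards [hi] with t ht
    have : (m t * i t) ^ 4 = 1 := by rw [ht]; norm_num
    rw [hv]; simp only [s, g]
    linear_combination (-(t - a)^4 * V t) * this
  refine core_final x z u v a θ c l 4 (by norm_num) hg0 p A B C sp hp0 hp1 hA hB hC hx hz ?_ ?_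
  · filter_upwards [eu, ev, hk] with t h1 h2 h3
    rw [h1, h2, hps]
    linear_combination s t ^ 3 * h3
  · filter_upwards [ev, hg1, hk, hj, hK, hik, hR] with t h2 h3 h4 h5 h6 h7 h8
    have key : v t = c * p t ^ 4 + s t ^ 6 * K t := by
      have hQ : k t ^ 4 - 1 = l * s t * g t * Q t := by
        simp only [Q]
        linear_combination (k t + 1) * (k t ^ 2 + 1) * j t * h4 - (k t ^ 4 - 1) * h5
      rw [h2, hps]
      linear_combination s t ^ 4 * h3 - c * s t ^ 4 * hQ + s t ^ 5 * h6
    have e6 : s t ^ 6 = p t ^ 6 * ik t ^ 6 := by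
      have : (k t * ik t) ^ 6 = 1 := by rw [h7]; norm_num
      rw [hps]; linear_combination (-s t ^ 6) * this
    have e8 := hD (p t)
    rw [key, e6]
    linear_combination p t ^ 6 * h8 + p t ^ 6 * e8

theorem suff35 (x z u v U V : ℝ → ℝ) (a θ : ℝ) (hU : ContDiff ℝ ∞ U) (hV : ContDiff ℝ ∞ V)
    (hU0 : U a ≠ 0) (hV0 : V a ≠ 0)
    (hu : ∀ t, u t = (t - a) ^ 3 * U t) (hv : ∀ t, v t = (t - a) ^ 5 * V t)
    (hx : ∀ t, x t = x a - u t * sin θ + v t * cos θ)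
    (hz : ∀ t, z t = z a + u t * cos θ + v t * sin θ) :
    HasCuspAt (fun t => (x t, z t)) a 3 5 := by
  obtain ⟨m, sm, hm, hm0⟩ := germ_cbrt a U hU hU0
  obtain ⟨i, si, hi⟩ := germ_inv a m sm hm0
  let s : ℝ → ℝ := fun t => (t - a) * m t
  have ss : ContDiff ℝ ∞ s := by simp only [s]; fun_prop
  have hs0 : s a = 0 := by simp [s]
  let g : ℝ → ℝ := fun t => V t * i t ^ 5
  have sg : ContDiff ℝ ∞ g := by simp only [g]; fun_prop
  have hi0 := hi.self_of_nhds
  have hg0 : g a ≠ 0 := mul_ne_zero hV0 (pow_ne_zero _ (right_ne_zero_of_mul (by rw [hi0]; exact one_ne_zero)))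
  obtain ⟨g1, sg1, hg1⟩ := germ_had a s m (fun t => g t - g a) (fun t => rfl) sm hm0 (by fun_prop)
    (by simp)
  obtain ⟨g2, sg2, hg2⟩ := germ_had a s m (fun t => g1 t - g1 a) (fun t => rfl) sm hm0 (by fun_prop)
    (by simp)
  let c := g a
  let e := g1 a
  let l : ℝ := 3 * g2 a / (5 * c ^ 2)
  have hl : c * l * c * 5 = 3 * g2 a := by
    simp only [l, c]; field_simp
  obtain ⟨k, sk, hk, hk0⟩ := germ_cbrt a (fun t => 1 + l * s t ^ 2 * g t) (by fun_prop) (by simp [hs0])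
  have hk1 : k a = 1 := cube_one _ (by have := hk.self_of_nhds; simpa [hs0] using this)
  obtain ⟨j, sj, hj⟩ := germ_inv a (fun t => k t ^ 2 + k t + 1) (by fun_prop) (by rw [hk1]; norm_num)
  have hj0 : 3 * j a = 1 := by
    have := hj.self_of_nhds
    rw [hk1] at this; linarith
  obtain ⟨ik, sik, hik⟩ := germ_inv a k sk hk0
  let Q : ℝ → ℝ := fun t => (k t ^ 4 + k t ^ 3 + k t ^ 2 + k t + 1) * j t
  have sQ : ContDiff ℝ ∞ Q := by simp only [Q]; fun_prop
  obtain ⟨K, sK, hK⟩ := germ_had a s m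
    (fun t => g2 t - c * l * g t * Q t - e * l * s t * g t * (k t ^ 3 + 1)) (fun t => rfl) sm hm0
    (by fun_prop) (by
      simp only [Q]; rw [hk1, hs0]
      linear_combination (-(1/3:ℝ)) * hl - (c * l * c * 5 / 3) * hj0)
  let p : ℝ → ℝ := fun t => (t - a) * (m t * k t)
  have sp : ContDiff ℝ ∞ p := by simp only [p]; fun_prop
  have hps : ∀ t, p t = s t * k t := fun t => by simp only [p, s]; ring
  have hp0 : p a = 0 := by simp [p]
  have hp1 : deriv p a ≠ 0 := by
    rw [deriv_lin a _ (by fun_prop)]; exact mul_ne_zero hm0 hk0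
  obtain ⟨R, sR, hR⟩ := germ_subst a p (fun t => K t * ik t ^ 8) sp hp0 hp1 (by fun_prop)
  obtain ⟨A, B, C, hA, hB, hC, hD⟩ := decomp3 R sR
  have eu : ∀ᶠ t in 𝓝 a, u t = s t ^ 3 := by
    filter_upwards [hm] with t ht
    rw [hu, ← ht]; simp only [s]; ring
  have ev : ∀ᶠ t in 𝓝 a, v t = s t ^ 5 * g t := by
    filter_upwards [hi] with t ht
    have : (m t * i t) ^ 5 = 1 := by rw [ht]; norm_num
    rw [hv]; simp only [s, g]
    linear_combination (-(t - a)^5 * V t) * this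
  refine core_final x z u v a θ c l 5 (by norm_num) hg0 p (fun X => e + X * B X) A C sp hp0 hp1
    (by fun_prop) hA hC hx hz ?_ ?_
  · filter_upwards [eu, ev, hk] with t h1 h2 h3
    rw [h1, h2, hps]
    linear_combination s t ^ 3 * h3
  · filter_upwards [ev, hg1, hg2, hk, hj, hK, hik, hR] with t h2 h3 h3' h4 h5 h6 h7 h8
    have key : v t = c * p t ^ 5 + e * p t ^ 6 + s t ^ 8 * K t := by
      have hQ : k t ^ 5 - 1 = l * s t ^ 2 * g t * Q t := by
        simp only [Q]
        linear_combination (k t ^ 4 + k t ^ 3 + k t ^ 2 + k t + 1) * j t * h4 - (k t ^ 5 - 1) * h5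
      have hQ6 : k t ^ 6 - 1 = l * s t ^ 2 * g t * (k t ^ 3 + 1) := by
        linear_combination (k t ^ 3 + 1) * h4
      rw [h2, hps]
      linear_combination s t ^ 5 * h3 + s t ^ 6 * h3' - c * s t ^ 5 * hQ - e * s t ^ 6 * hQ6 + s t ^ 7 * h6
    have e6 : s t ^ 8 = p t ^ 8 * ik t ^ 8 := by
      have : (k t * ik t) ^ 8 = 1 := by rw [h7]; norm_num
      rw [hps]; linear_combination (-s t ^ 8) * this
    have e8 := hD (p t)
    rw [key, e6]
    linear_combination p t ^ 8 * h8 + p t ^ 8 * e8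

theorem globalize' {E : Type*} [NormedAddCommGroup E] [NormedSpace ℝ E] [FiniteDimensional ℝ E]
    {F : Type*} [NormedAddCommGroup F] [NormedSpace ℝ F]
    (f : E → F) (U : Set E) (hU : IsOpen U) (a : E) (ha : a ∈ U)
    (hf : ContDiffOn ℝ ∞ f U) : ∃ F : E → F, ContDiff ℝ ∞ F ∧ ∀ᶠ t in 𝓝 a, F t = f t := by
  obtain ⟨ε, hε, hb⟩ := Metric.isOpen_iff.1 hU a ha
  let χ : ContDiffBump a := ⟨ε/4, ε/2, by linarith, by linarith⟩
  refine ⟨fun t => χ t • f t, ?_, ?_⟩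
  · refine contDiff_iff_contDiffAt.2 fun t => ?_
    by_cases ht : t ∈ U
    · exact χ.contDiffAt.smul (hf.contDiffAt (hU.mem_nhds ht))
    · have : t ∈ (tsupport χ)ᶜ := by
        rw [χ.tsupport_eq]
        intro h
        apply ht; apply hb
        rw [Metric.mem_closedBall] at h
        rw [Metric.mem_ball]
        have : χ.rOut = ε/2 := rfl
        linarith
      have h0 : (fun t => χ t • f t) =ᶠ[𝓝 t] fun _ => 0 := by
        filter_upwards [(isClosed_tsupport χ).isOpen_compl.mem_nhds this] with y hy
        rw [image_eq_zero_of_notMem_tsupport hy, zero_smul]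
      exact contDiffAt_const.congr_of_eventuallyEq h0
  · filter_upwards [χ.eventuallyEq_one] with t ht
    rw [ht]; simp

/-- both the germ and its inverse can be taken global, with inverse derivatives -/
theorem germ_data {E F : Type*} [NormedAddCommGroup E] [NormedSpace ℝ E] [FiniteDimensional ℝ E]
    [NormedAddCommGroup F] [NormedSpace ℝ F] [FiniteDimensional ℝ F] (f : E → F) (a : E) (b : F)
    (h : DiffeoGermAt f a b) : ∃ (f' : E → F) (g : F → E), ContDiff ℝ ∞ f' ∧ ContDiff ℝ ∞ g ∧
      f' a = b ∧ g b = a ∧ (∀ᶠ t in 𝓝 a, f' t = f t) ∧ (∀ᶠ t in 𝓝 a, g (f t) = t) ∧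
      (∀ w, fderiv ℝ g b (fderiv ℝ f' a w) = w) ∧ (∀ w, fderiv ℝ f' a (fderiv ℝ g b w) = w) := by
  obtain ⟨hab, U, V, g, oU, aU, oV, qV, sf, sg, mf, mg, gl, gr⟩ := h
  obtain ⟨f', sf', hf'⟩ := globalize' f U oU a aU sf
  obtain ⟨g', sg', hg'⟩ := globalize' g V oV b qV sg
  have hfa : f' a = b := by rw [hf'.self_of_nhds, hab]
  have hgb : g' b = a := by rw [hg'.self_of_nhds, ← hab, gl a aU]
  have tf : Filter.Tendsto f' (𝓝 a) (𝓝 b) := by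
    have := sf'.continuous.tendsto a; rwa [hfa] at this
  have tg : Filter.Tendsto g' (𝓝 b) (𝓝 a) := by
    have := sg'.continuous.tendsto b; rwa [hgb] at this
  have e1 : ∀ᶠ t in 𝓝 a, g' (f' t) = t := by
    filter_upwards [tf.eventually hg', hf', oU.mem_nhds aU] with t h1 h2 h3
    rw [h1, h2, gl t h3]
  have e2 : ∀ᶠ t in 𝓝 b, f' (g' t) = t := by
    filter_upwards [tg.eventually hf', hg', oV.mem_nhds qV] with t h1 h2 h3
    rw [h1, h2, gr t h3]
  have df : HasFDerivAt f' (fderiv ℝ f' a) a := (sf'.differentiable (by simp) a).hasFDerivAt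
  have dg : HasFDerivAt g' (fderiv ℝ g' b) b := (sg'.differentiable (by simp) b).hasFDerivAt
  refine ⟨f', g', sf', sg', hfa, hgb, hf', ?_, ?_, ?_⟩
  · filter_upwards [e1, hf'] with t h1 h2
    rw [← h2, h1]
  · intro w
    have h1 : HasFDerivAt (fun t => g' (f' t)) _ a := HasFDerivAt.comp a (by rw [hfa]; exact dg) df
    have h2 : HasFDerivAt (fun t => g' (f' t)) (ContinuousLinearMap.id ℝ E) a :=
      (hasFDerivAt_id a).congr_of_eventuallyEq e1
    exact congrArg (fun L => L w) (h1.unique h2)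
  · intro w
    have h1 : HasFDerivAt (fun t => f' (g' t)) _ b := HasFDerivAt.comp b (by rw [hgb]; exact df) dg
    have h2 : HasFDerivAt (fun t => f' (g' t)) (ContinuousLinearMap.id ℝ F) b :=
      (hasFDerivAt_id b).congr_of_eventuallyEq e2
    exact congrArg (fun L => L w) (h1.unique h2)

noncomputable def pdX (F : ℝ × ℝ → ℝ) (q : ℝ × ℝ) : ℝ := fderiv ℝ F q (1, 0)
noncomputable def pdY (F : ℝ × ℝ → ℝ) (q : ℝ × ℝ) : ℝ := fderiv ℝ F q (0, 1)

theorem pdX_smooth (F : ℝ × ℝ → ℝ) (hF : ContDiff ℝ ∞ F) : ContDiff ℝ ∞ (pdX F) :=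
  (hF.fderiv_right (m := ∞) (by simp)).clm_apply contDiff_const
theorem pdY_smooth (F : ℝ × ℝ → ℝ) (hF : ContDiff ℝ ∞ F) : ContDiff ℝ ∞ (pdY F) :=
  (hF.fderiv_right (m := ∞) (by simp)).clm_apply contDiff_const

theorem fderiv_pd (F : ℝ × ℝ → ℝ) (q : ℝ × ℝ) (y1 y2 : ℝ) :
    fderiv ℝ F q (y1, y2) = y1 * pdX F q + y2 * pdY F q := by
  have : ((y1, y2) : ℝ × ℝ) = y1 • ((1:ℝ), (0:ℝ)) + y2 • ((0:ℝ), (1:ℝ)) := by simp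
  rw [this, map_add, map_smul, map_smul]; rfl

theorem nec_data (γ : ℝ → ℝ × ℝ) (hγ : Continuous γ) (a : ℝ) (i j : ℕ) 
    (h : HasCuspAt γ a i j) : ∃ (p : ℝ → ℝ) (G1 G2 : ℝ × ℝ → ℝ), ContDiff ℝ ∞ p ∧
      ContDiff ℝ ∞ G1 ∧ ContDiff ℝ ∞ G2 ∧ p a = 0 ∧ deriv p a ≠ 0 ∧
      (∀ w1 w2, w1 * pdX G1 (0,0) + w2 * pdY G1 (0,0) = 0 →
        w1 * pdX G2 (0,0) + w2 * pdY G2 (0,0) = 0 → w1 = 0 ∧ w2 = 0) ∧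
      ∀ᶠ t in 𝓝 a, γ t = (G1 (p t ^ i, p t ^ j), G2 (p t ^ i, p t ^ j)) := by
  obtain ⟨ψ, Ψ, dψ, dΨ, he⟩ := h
  obtain ⟨p, r, sp, sr, hp0, -, hp, -, hpd, -⟩ := germ_data ψ a 0 dψ
  obtain ⟨P, G, sP, sG, -, -, -, hG, -, hGd⟩ := germ_data Ψ (γ a) (0,0) dΨ
  refine ⟨p, fun q => (G q).1, fun q => (G q).2, sp, sG.fst, sG.snd, hp0, ?_, ?_, ?_⟩
  · intro h0
    have := hpd 1
    rw [show fderiv ℝ p a 1 = deriv p a by simp, h0] at this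
    simp at this
  · intro w1 w2 h1 h2
    have dG := (sG.differentiable (by simp) (0,0)).hasFDerivAt
    rw [← fderiv_pd, dG.fst.fderiv] at h1
    rw [← fderiv_pd, dG.snd.fderiv] at h2
    have h3 : fderiv ℝ G (0,0) (w1, w2) = 0 := Prod.ext h1 h2
    have := hGd (w1, w2)
    rw [h3, map_zero] at this
    exact ⟨(congrArg Prod.fst this).symm, (congrArg Prod.snd this).symm⟩
  · filter_upwards [he, hp, hγ.continuousAt.eventually hG] with t h1 h2 h3
    rw [h1, ← h2] at h3
    rw [← h3]

theorem chain_pd (p : ℝ → ℝ) (hp : ContDiff ℝ ∞ p) (F : ℝ × ℝ → ℝ) (hF : ContDiff ℝ ∞ F) (e : ℕ)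
    (t : ℝ) : HasDerivAt (fun t => F (p t ^ 3, p t ^ (e+3))) (p t ^ 2 * (deriv p t *
      (3 * pdX F (p t ^ 3, p t ^ (e+3)) + (e+3) * p t ^ e * pdY F (p t ^ 3, p t ^ (e+3))))) t := by
  have dp := (hp.differentiable (by simp) t).hasDerivAt
  have d2 := (dp.pow 3).prodMk (dp.pow (e+3))
  have d3 := (hF.differentiable (by simp) (p t ^ 3, p t ^ (e+3))).hasFDerivAt
  have := d3.comp_hasDerivAt t d2
  refine this.congr_deriv ?_
  rw [fderiv_pd]
  push_cast
  ring

theorem chain_sm (p : ℝ → ℝ) (hp : ContDiff ℝ ∞ p) (F : ℝ × ℝ → ℝ) (hF : ContDiff ℝ ∞ F) (e : ℕ) :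
    ContDiff ℝ ∞ (fun t => F (p t ^ 3, p t ^ (e+3))) := hF.comp (by fun_prop)

theorem nec_core (φ β p V1 V2 : ℝ → ℝ) (a : ℝ) (hφ : ContDiff ℝ ∞ φ)
    (hp : ContDiff ℝ ∞ p) (hV1 : ContDiff ℝ ∞ V1) (hV2 : ContDiff ℝ ∞ V2) (hp0 : p a = 0)
    (hp1 : deriv p a ≠ 0) (hV : ¬ (V1 a = 0 ∧ V2 a = 0))
    (h1 : ∀ᶠ t in 𝓝 a, -(β t) * sin (φ t) = p t ^ 2 * (deriv p t * V1 t))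
    (h2 : ∀ᶠ t in 𝓝 a, β t * cos (φ t) = p t ^ 2 * (deriv p t * V2 t)) :
    deriv β a = 0 ∧ deriv (deriv β) a ≠ 0 ∧
    (∀ᶠ t in 𝓝 a, V1 t * cos (φ t) + V2 t * sin (φ t) = 0) ∧
    -(V1 a) * sin (φ a) + V2 a * cos (φ a) ≠ 0 := by
  have sp' : ContDiff ℝ ∞ (deriv p) := (contDiff_infty_iff_deriv.1 hp).2
  have ss : ContDiff ℝ ∞ (fun t => sin (φ t)) := hφ.sin
  have sc : ContDiff ℝ ∞ (fun t => cos (φ t)) := hφ.cos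
  have dp := (hp.differentiable (by simp) a).hasDerivAt
  have npunct : ∀ᶠ t in 𝓝[≠] a, p t ≠ 0 := dp.eventually_ne hp1
  have ndp : ∀ᶠ t in 𝓝 a, deriv p t ≠ 0 := sp'.continuous.continuousAt.eventually_ne hp1
  have hWs : Continuous (fun t => V1 t * cos (φ t) + V2 t * sin (φ t)) :=
    ((hV1.mul sc).add (hV2.mul ss)).continuous
  have hWp : ∀ᶠ t in 𝓝[≠] a, V1 t * cos (φ t) + V2 t * sin (φ t) = 0 := by
    filter_upwards [npunct, ndp.filter_mono nhdsWithin_le_nhds, h1.filter_mono nhdsWithin_le_nhds,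
      h2.filter_mono nhdsWithin_le_nhds] with t n1 n2 e1 e2
    have : (p t ^ 2 * deriv p t) * (V1 t * cos (φ t) + V2 t * sin (φ t)) = 0 := by
      linear_combination (-cos (φ t)) * e1 - sin (φ t) * e2
    rcases mul_eq_zero.1 this with h | h
    · exact absurd h (mul_ne_zero (pow_ne_zero _ n1) n2)
    · exact h
  have hWa : V1 a * cos (φ a) + V2 a * sin (φ a) = 0 := by
    have t1 := (hWs.tendsto a).mono_left (nhdsWithin_le_nhds (s := {a}ᶜ))
    have t2 : Filter.Tendsto (fun t => V1 t * cos (φ t) + V2 t * sin (φ t)) (𝓝[≠] a) (𝓝 0) :=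
      tendsto_const_nhds.congr' (hWp.mono fun t ht => ht.symm)
    exact tendsto_nhds_unique t1 t2
  have hW : ∀ᶠ t in 𝓝 a, V1 t * cos (φ t) + V2 t * sin (φ t) = 0 := by
    rw [eventually_nhdsWithin_iff] at hWp
    filter_upwards [hWp] with t ht
    by_cases h : t = a
    · rw [h]; exact hWa
    · exact ht h
  have hκ : -(V1 a) * sin (φ a) + V2 a * cos (φ a) ≠ 0 := by
    intro h
    have sq := sin_sq_add_cos_sq (φ a)
    apply hV
    constructor
    · linear_combination cos (φ a) * hWa - sin (φ a) * h - V1 a * sq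
    · linear_combination sin (φ a) * hWa + cos (φ a) * h - V2 a * sq
  let k : ℝ → ℝ := fun t => deriv p t * (-(V1 t) * sin (φ t) + V2 t * cos (φ t))
  have sk : ContDiff ℝ ∞ k := sp'.mul ((hV1.neg.mul ss).add (hV2.mul sc))
  have sk' : ContDiff ℝ ∞ (deriv k) := (contDiff_infty_iff_deriv.1 sk).2
  have hβ : β =ᶠ[𝓝 a] fun t => p t ^ 2 * k t := by
    filter_upwards [h1, h2] with t e1 e2
    simp only [k]
    linear_combination -sin (φ t) * e1 + cos (φ t) * e2 - β t * sin_sq_add_cos_sq (φ t)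
  have hdβ : deriv β =ᶠ[𝓝 a] fun t => p t * (2 * deriv p t * k t + p t * deriv k t) := by
    have := hβ.deriv
    refine this.trans (Filter.Eventually.of_forall fun t => ?_)
    have d1 := (hp.differentiable (by simp) t).hasDerivAt
    have d2 := (sk.differentiable (by simp) t).hasDerivAt
    have := ((d1.pow 2).mul d2).deriv
    refine Eq.trans this ?_
    simp
    ring
  refine ⟨by rw [hdβ.eq_of_nhds, hp0, zero_mul], ?_, hW, hκ⟩
  have sm : ContDiff ℝ ∞ (fun t => 2 * deriv p t * k t + p t * deriv k t) :=
    ((contDiff_const.mul sp').mul sk).add (hp.mul sk')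
  have := (dp.mul (sm.differentiable (by simp) a).hasDerivAt).deriv
  rw [hdβ.deriv_eq]
  refine fun h => ?_
  have h3 := this.symm.trans h
  simp only [hp0] at h3
  have : deriv p a * (2 * deriv p a * k a) = 0 := by linear_combination h3
  have hk : k a ≠ 0 := mul_ne_zero hp1 hκ
  simp [hp1, hk] at this

theorem nec_common (x z φ β : ℝ → ℝ) (a : ℝ)
    (hx : ContDiff ℝ ∞ x) (hz : ContDiff ℝ ∞ z) (hφ : ContDiff ℝ ∞ φ)
    (hdx : ∀ t, deriv x t = -(β t) * sin (φ t))
    (hdz : ∀ t, deriv z t = β t * cos (φ t)) (e : ℕ) (he : e ≠ 0)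
    (h : HasCuspAt (fun t => (x t, z t)) a 3 (e+3)) :
    deriv β a = 0 ∧ deriv (deriv β) a ≠ 0 ∧ ∃ p A1 A2 B1 B2 S1 S2 T1 T2 : ℝ → ℝ,
      ContDiff ℝ ∞ p ∧ ContDiff ℝ ∞ A1 ∧ ContDiff ℝ ∞ A2 ∧ ContDiff ℝ ∞ B1 ∧ ContDiff ℝ ∞ B2 ∧
      ContDiff ℝ ∞ S1 ∧ ContDiff ℝ ∞ S2 ∧ ContDiff ℝ ∞ T1 ∧ ContDiff ℝ ∞ T2 ∧
      p a = 0 ∧ deriv p a ≠ 0 ∧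
      (∀ t, HasDerivAt A1 (p t ^ 2 * S1 t) t) ∧ (∀ t, HasDerivAt A2 (p t ^ 2 * S2 t) t) ∧
      (∀ t, HasDerivAt B1 (p t ^ 2 * T1 t) t) ∧ (∀ t, HasDerivAt B2 (p t ^ 2 * T2 t) t) ∧
      (∀ᶠ t in 𝓝 a, (3 * A1 t + (e+3) * p t ^ e * B1 t) * cos (φ t) +
        (3 * A2 t + (e+3) * p t ^ e * B2 t) * sin (φ t) = 0) ∧
      -(3 * A1 a) * sin (φ a) + (3 * A2 a) * cos (φ a) ≠ 0 ∧
      B1 a * cos (φ a) + B2 a * sin (φ a) ≠ 0 := by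
  obtain ⟨p, G1, G2, sp, s1, s2, hp0, hp1, hinj, heq⟩ :=
    nec_data _ (hx.continuous.prodMk hz.continuous) a 3 (e+3) h
  have sp' : ContDiff ℝ ∞ (deriv p) := (contDiff_infty_iff_deriv.1 sp).2
  have ss : ContDiff ℝ ∞ (fun t => sin (φ t)) := hφ.sin
  have sc : ContDiff ℝ ∞ (fun t => cos (φ t)) := hφ.cos
  have sV : ∀ F, ContDiff ℝ ∞ F → ContDiff ℝ ∞ (fun t => (3 * pdX F (p t ^ 3, p t ^ (e+3)) +
      (e+3) * p t ^ e * pdY F (p t ^ 3, p t ^ (e+3)))) := by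
    intro F hF
    have a1 := chain_sm p sp _ (pdX_smooth F hF) e
    have a2 := chain_sm p sp _ (pdY_smooth F hF) e
    exact (contDiff_const.mul a1).add ((contDiff_const.mul (sp.pow e)).mul a2)
  have q0 : ((p a ^ 3, p a ^ (e+3)) : ℝ × ℝ) = (0, 0) := by simp [hp0]
  have e1 : ∀ᶠ t in 𝓝 a, -(β t) * sin (φ t) = p t ^ 2 * (deriv p t *
      (3 * pdX G1 (p t ^ 3, p t ^ (e+3)) + (e+3) * p t ^ e * pdY G1 (p t ^ 3, p t ^ (e+3)))) := by
    have : x =ᶠ[𝓝 a] fun t => G1 (p t ^ 3, p t ^ (e+3)) := heq.mono fun t ht => congrArg Prod.fst ht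
    filter_upwards [this.deriv] with t ht
    rw [← hdx, ht, (chain_pd p sp G1 s1 e t).deriv]
  have e2 : ∀ᶠ t in 𝓝 a, β t * cos (φ t) = p t ^ 2 * (deriv p t *
      (3 * pdX G2 (p t ^ 3, p t ^ (e+3)) + (e+3) * p t ^ e * pdY G2 (p t ^ 3, p t ^ (e+3)))) := by
    have : z =ᶠ[𝓝 a] fun t => G2 (p t ^ 3, p t ^ (e+3)) := heq.mono fun t ht => congrArg Prod.snd ht
    filter_upwards [this.deriv] with t ht
    rw [← hdz, ht, (chain_pd p sp G2 s2 e t).deriv]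
  obtain ⟨r1, r2, r3, r4⟩ := nec_core φ β p _ _ a hφ sp (sV G1 s1) (sV G2 s2) hp0 hp1 (by
    rintro ⟨h1, h2⟩
    rw [q0, hp0, zero_pow he] at h1 h2
    have := (hinj 1 0 (by linarith) (by linarith)).1
    norm_num at this) e1 e2
  have hW := r3.self_of_nhds
  rw [q0, hp0, zero_pow he] at r4
  simp only [hp0, zero_pow he] at hW
  rw [zero_pow (by omega), zero_pow (by omega)] at hW
  refine ⟨r1, r2, p, _, _, _, _, _, _, _, _, sp, chain_sm p sp _ (pdX_smooth G1 s1) e,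
    chain_sm p sp _ (pdX_smooth G2 s2) e, chain_sm p sp _ (pdY_smooth G1 s1) e,
    chain_sm p sp _ (pdY_smooth G2 s2) e, sp'.mul (sV _ (pdX_smooth G1 s1)),
    sp'.mul (sV _ (pdX_smooth G2 s2)), sp'.mul (sV _ (pdY_smooth G1 s1)),
    sp'.mul (sV _ (pdY_smooth G2 s2)), hp0, hp1, fun t => chain_pd p sp _ (pdX_smooth G1 s1) e t,
    fun t => chain_pd p sp _ (pdX_smooth G2 s2) e t, fun t => chain_pd p sp _ (pdY_smooth G1 s1) e t,
    fun t => chain_pd p sp _ (pdY_smooth G2 s2) e t, r3, ?_, ?_⟩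
  · rw [q0]
    refine fun h => r4 ?_
    linear_combination h
  · rw [q0]
    intro hB
    set A1 := pdX G1 (0,0)
    set A2 := pdX G2 (0,0)
    set B1 := pdY G1 (0,0)
    set B2 := pdY G2 (0,0)
    have sq := sin_sq_add_cos_sq (φ a)
    have := (hinj (-B1 * sin (φ a) + B2 * cos (φ a)) (A1 * sin (φ a) - A2 * cos (φ a)) (by
      linear_combination B2 / 3 * hW - A2 * hB) (by
      linear_combination A1 * hB - B1 / 3 * hW)).2
    apply r4
    linear_combination (-3) * this

theorem nec34 (x z φ β : ℝ → ℝ) (a : ℝ)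
    (hx : ContDiff ℝ ∞ x) (hz : ContDiff ℝ ∞ z) (hφ : ContDiff ℝ ∞ φ)
    (hdx : ∀ t, deriv x t = -(β t) * sin (φ t))
    (hdz : ∀ t, deriv z t = β t * cos (φ t))
    (h : HasCuspAt (fun t => (x t, z t)) a 3 4) :
    deriv β a = 0 ∧ deriv (deriv β) a ≠ 0 ∧ deriv φ a ≠ 0 := by
  obtain ⟨r1, r2, p, A1, A2, B1, B2, S1, S2, T1, T2, sp, sA1, sA2, sB1, sB2, sS1, sS2, sT1, sT2,
    hp0, hp1, dA1, dA2, dB1, dB2, hW, hκ, hB⟩ := nec_common x z φ β a hx hz hφ hdx hdz 1 (by simp) h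
  refine ⟨r1, r2, fun h0 => ?_⟩
  have dp := (sp.differentiable (by simp) a).hasDerivAt
  have dφ := (hφ.differentiable (by simp) a).hasDerivAt
  have d1 := ((((dA1 a).const_mul 3).add (((dp.pow 1).const_mul ((1:ℕ)+3 : ℝ)).mul (dB1 a))).mul dφ.cos).add
    ((((dA2 a).const_mul 3).add (((dp.pow 1).const_mul ((1:ℕ)+3 : ℝ)).mul (dB2 a))).mul dφ.sin)
  have d2 := d1.unique ((hasDerivAt_const a (0:ℝ)).congr_of_eventuallyEq hW)
  simp [hp0, h0] at d2
  have : (4 * deriv p a) * (B1 a * cos (φ a) + B2 a * sin (φ a)) = 0 := by linear_combination d2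
  simp [hp1, hB] at this

theorem nec35 (x z φ β : ℝ → ℝ) (a : ℝ)
    (hx : ContDiff ℝ ∞ x) (hz : ContDiff ℝ ∞ z) (hφ : ContDiff ℝ ∞ φ)
    (hdx : ∀ t, deriv x t = -(β t) * sin (φ t))
    (hdz : ∀ t, deriv z t = β t * cos (φ t))
    (h : HasCuspAt (fun t => (x t, z t)) a 3 5) :
    deriv β a = 0 ∧ deriv (deriv β) a ≠ 0 ∧ deriv φ a = 0 ∧ deriv (deriv φ) a ≠ 0 := by
  obtain ⟨r1, r2, p, A1, A2, B1, B2, S1, S2, T1, T2, sp, sA1, sA2, sB1, sB2, sS1, sS2, sT1, sT2,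
    hp0, hp1, dA1, dA2, dB1, dB2, hW, hκ, hB⟩ := nec_common x z φ β a hx hz hφ hdx hdz 2 (by simp) h
  have sp' : ContDiff ℝ ∞ (deriv p) := (contDiff_infty_iff_deriv.1 sp).2
  have sφ' : ContDiff ℝ ∞ (deriv φ) := (contDiff_infty_iff_deriv.1 hφ).2
  have ss : ContDiff ℝ ∞ (fun t => sin (φ t)) := hφ.sin
  have sc : ContDiff ℝ ∞ (fun t => cos (φ t)) := hφ.cos
  let Z : ℝ → ℝ := fun t =>
    (10 * deriv p t * B1 t + p t * (3 * S1 t + 5 * p t ^ 2 * T1 t)) * cos (φ t) +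
    (10 * deriv p t * B2 t + p t * (3 * S2 t + 5 * p t ^ 2 * T2 t)) * sin (φ t)
  let K : ℝ → ℝ := fun t =>
    -(3 * A1 t + 5 * p t ^ 2 * B1 t) * sin (φ t) + (3 * A2 t + 5 * p t ^ 2 * B2 t) * cos (φ t)
  have sZ : ContDiff ℝ ∞ Z := by
    refine ContDiff.add (ContDiff.mul ?_ sc) (ContDiff.mul ?_ ss)
    · exact ((contDiff_const.mul sp').mul sB1).add
        (sp.mul ((contDiff_const.mul sS1).add ((contDiff_const.mul (sp.pow 2)).mul sT1)))
    · exact ((contDiff_const.mul sp').mul sB2).add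
        (sp.mul ((contDiff_const.mul sS2).add ((contDiff_const.mul (sp.pow 2)).mul sT2)))
  have sK : ContDiff ℝ ∞ K := by
    refine ContDiff.add (ContDiff.mul (ContDiff.neg ?_) ss) (ContDiff.mul ?_ sc)
    · exact (contDiff_const.mul sA1).add ((contDiff_const.mul (sp.pow 2)).mul sB1)
    · exact (contDiff_const.mul sA2).add ((contDiff_const.mul (sp.pow 2)).mul sB2)
  have key : (fun t => p t * Z t + deriv φ t * K t) =ᶠ[𝓝 a] fun _ => 0 := by
    filter_upwards [hW.eventually_nhds] with t ht
    have dp := (sp.differentiable (by simp) t).hasDerivAt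
    have dφ := (hφ.differentiable (by simp) t).hasDerivAt
    have d1 := ((((dA1 t).const_mul 3).add (((dp.pow 2).const_mul ((2:ℕ)+3 : ℝ)).mul (dB1 t))).mul dφ.cos).add
      ((((dA2 t).const_mul 3).add (((dp.pow 2).const_mul ((2:ℕ)+3 : ℝ)).mul (dB2 t))).mul dφ.sin)
    have d2 := d1.unique ((hasDerivAt_const t (0:ℝ)).congr_of_eventuallyEq ht)
    simp at d2
    simp only [Z, K]
    linear_combination d2
  have hK : K a ≠ 0 := by
    simp only [K, hp0]
    intro h; apply hκ; linear_combination h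
  have hZ : Z a ≠ 0 := by
    simp only [Z, hp0]
    intro h
    have : (10 * deriv p a) * (B1 a * cos (φ a) + B2 a * sin (φ a)) = 0 := by linear_combination h
    simp [hp1, hB] at this
  have hφ0 : deriv φ a = 0 := by
    have := key.eq_of_nhds
    simpa [hp0, hK] using this
  refine ⟨r1, r2, hφ0, fun h0 => ?_⟩
  have d1 := ((sp.differentiable (by simp) a).hasDerivAt.mul
    (sZ.differentiable (by simp) a).hasDerivAt).add
    ((sφ'.differentiable (by simp) a).hasDerivAt.mul (sK.differentiable (by simp) a).hasDerivAt)
  have d2 := d1.unique ((hasDerivAt_const a (0:ℝ)).congr_of_eventuallyEq key)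
  simp [hp0, h0, hφ0, hp1, hZ] at d2

theorem suff_common (x z φ β : ℝ → ℝ) (a : ℝ)
    (hx : ContDiff ℝ ∞ x) (hz : ContDiff ℝ ∞ z) (hφ : ContDiff ℝ ∞ φ) (hβ : ContDiff ℝ ∞ β)
    (hdx : ∀ t, deriv x t = -(β t) * sin (φ t))
    (hdz : ∀ t, deriv z t = β t * cos (φ t)) (hβ0 : β a = 0) (hβ1 : deriv β a = 0)
    (hβ2 : deriv (deriv β) a ≠ 0) (n : ℕ) (S : ℝ → ℝ) (sS : ContDiff ℝ ∞ S) (hS0 : S a ≠ 0)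
    (hS : ∀ t, sin (φ t - φ a) = (t - a)^n * S t) :
    ∃ u v U V : ℝ → ℝ, ContDiff ℝ ∞ U ∧ ContDiff ℝ ∞ V ∧ U a ≠ 0 ∧ V a ≠ 0 ∧
      (∀ t, u t = (t-a)^3 * U t) ∧ (∀ t, v t = (t-a)^(n+3) * V t) ∧
      (∀ t, x t = x a - u t * sin (φ a) + v t * cos (φ a)) ∧
      (∀ t, z t = z a + u t * cos (φ a) + v t * sin (φ a)) := by
  have sβ' : ContDiff ℝ ∞ (deriv β) := (contDiff_infty_iff_deriv.1 hβ).2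
  obtain ⟨W, sW, hW, hWa⟩ := hadamard1 a (deriv β) sβ' hβ1
  obtain ⟨B, sB, hB, hBa⟩ := hadamard_s16 a 1 β W sW hβ0 (fun t => by
    have := (hβ.differentiable (by simp) t).hasDerivAt
    rw [hW] at this; simpa using this)
  have hBa0 : B a ≠ 0 := by
    rintro h; rw [h, hWa] at hBa; apply hβ2; simpa using hBa.symm
  have dx : ∀ t, HasDerivAt x (-(β t) * sin (φ t)) t := fun t => by
    rw [← hdx]; exact (hx.differentiable (by simp) t).hasDerivAt
  have dz : ∀ t, HasDerivAt z (β t * cos (φ t)) t := fun t => by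
    rw [← hdz]; exact (hz.differentiable (by simp) t).hasDerivAt
  obtain ⟨U, sU, hU, hUa⟩ := hadamard_s16 a 2
    (fun t => -(x t - x a) * sin (φ a) + (z t - z a) * cos (φ a))
    (fun t => B t * cos (φ t - φ a)) (sB.mul (hφ.sub contDiff_const).cos) (by simp) (fun t => by
      refine ((((dx t).sub_const (x a)).neg.mul_const _).add
        (((dz t).sub_const (z a)).mul_const _)).congr_deriv ?_
      rw [cos_sub, hB]; ring)
  obtain ⟨V, sV, hV, hVa⟩ := hadamard_s16 a (n+2)
    (fun t => (x t - x a) * cos (φ a) + (z t - z a) * sin (φ a))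
    (fun t => -(B t * S t)) (sB.mul sS).neg (by simp) (fun t => by
      refine ((((dx t).sub_const (x a)).mul_const _).add
        (((dz t).sub_const (z a)).mul_const _)).congr_deriv ?_
      have := hS t
      rw [sin_sub] at this
      rw [hB]
      linear_combination (-(t-a)^2 * B t) * this)
  have sq := sin_sq_add_cos_sq (φ a)
  refine ⟨_, _, U, V, sU, sV, ?_, ?_, hU, hV, ?_, ?_⟩
  · rintro h; rw [h] at hUa; simp [hBa0] at hUa
    exact hBa0 hUa.symm
  · rintro h; rw [h] at hVa; simp [hBa0, hS0] at hVa
  · intro t; linear_combination (-(x t - x a)) * sq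
  · intro t; linear_combination (-(z t - z a)) * sq

theorem suff_main34 (x z φ β : ℝ → ℝ) (a : ℝ)
    (hx : ContDiff ℝ ∞ x) (hz : ContDiff ℝ ∞ z) (hφ : ContDiff ℝ ∞ φ) (hβ : ContDiff ℝ ∞ β)
    (hdx : ∀ t, deriv x t = -(β t) * sin (φ t))
    (hdz : ∀ t, deriv z t = β t * cos (φ t)) (hβ0 : β a = 0) (hβ1 : deriv β a = 0)
    (hβ2 : deriv (deriv β) a ≠ 0) (hφ1 : deriv φ a ≠ 0) :
    HasCuspAt (fun t => (x t, z t)) a 3 4 := by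
  have dφ := (hφ.differentiable (by simp) a).hasDerivAt
  obtain ⟨S, sS, hS, hSa⟩ := hadamard1 a (fun t => sin (φ t - φ a))
    (hφ.sub contDiff_const).sin (by simp)
  rw [(dφ.sub_const (φ a)).sin.deriv] at hSa
  obtain ⟨u, v, U, V, sU, sV, hU0, hV0, hu, hv, h1, h2⟩ := suff_common x z φ β a hx hz hφ hβ hdx hdz
    hβ0 hβ1 hβ2 1 S sS (by rw [hSa]; simpa using hφ1) (fun t => by simpa using hS t)
  exact suff34 x z u v U V a (φ a) sU sV hU0 hV0 hu hv h1 h2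

theorem suff_main35 (x z φ β : ℝ → ℝ) (a : ℝ)
    (hx : ContDiff ℝ ∞ x) (hz : ContDiff ℝ ∞ z) (hφ : ContDiff ℝ ∞ φ) (hβ : ContDiff ℝ ∞ β)
    (hdx : ∀ t, deriv x t = -(β t) * sin (φ t))
    (hdz : ∀ t, deriv z t = β t * cos (φ t)) (hβ0 : β a = 0) (hβ1 : deriv β a = 0)
    (hβ2 : deriv (deriv β) a ≠ 0) (hφ1 : deriv φ a = 0) (hφ2 : deriv (deriv φ) a ≠ 0) :
    HasCuspAt (fun t => (x t, z t)) a 3 5 := by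
  have sφ' : ContDiff ℝ ∞ (deriv φ) := (contDiff_infty_iff_deriv.1 hφ).2
  obtain ⟨W, sW, hW, hWa⟩ := hadamard1 a (deriv φ) sφ' hφ1
  obtain ⟨S, sS, hS, hSa⟩ := hadamard_s16 a 1 (fun t => sin (φ t - φ a))
    (fun t => cos (φ t - φ a) * W t) ((hφ.sub contDiff_const).cos.mul sW) (by simp) (fun t => by
      have dφ := (hφ.differentiable (by simp) t).hasDerivAt
      refine (dφ.sub_const (φ a)).sin.congr_deriv ?_
      rw [hW]; ring)
  obtain ⟨u, v, U, V, sU, sV, hU0, hV0, hu, hv, h1, h2⟩ := suff_common x z φ β a hx hz hφ hβ hdx hdz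
    hβ0 hβ1 hβ2 2 S sS (by
      rintro h; rw [h] at hSa; simp [hWa] at hSa; exact hφ2 hSa.symm) (fun t => by simpa using hS t)
  exact suff35 x z u v U V a (φ a) sU sV hU0 hV0 hu hv h1 h2

/-- Let `(γ, ν)` be a Legendre curve with `γ = (x, z)`,
`ν = (cos φ, sin φ)`, curvature `(φ̇, β)`, and `β t₀ = 0`.  Then
(1) `γ` has a 4/3-cusp at `t₀` iff `β̇(t₀) = 0` and `β̈(t₀)φ̇(t₀) ≠ 0`;
(2) `γ` has a 5/3-cusp at `t₀` iff `β̇(t₀) = φ̇(t₀) = 0` and `β̈(t₀)φ̈(t₀) ≠ 0`. -/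
theorem criteria_for_cusps_3_4_and_3_5
    (x z φ β : ℝ → ℝ) (t₀ : ℝ)
    (hx : ContDiff ℝ (⊤ : ℕ∞) x) (hz : ContDiff ℝ (⊤ : ℕ∞) z)
    (hφ : ContDiff ℝ (⊤ : ℕ∞) φ) (hβ : ContDiff ℝ (⊤ : ℕ∞) β)
    (hdx : ∀ t, deriv x t = -(β t) * sin (φ t))
    (hdz : ∀ t, deriv z t = β t * cos (φ t))
    (hβ0 : β t₀ = 0) :
    (HasCuspAt (fun t => (x t, z t)) t₀ 3 4 ↔
      (deriv β t₀ = 0 ∧ iteratedDeriv 2 β t₀ * deriv φ t₀ ≠ 0)) ∧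
    (HasCuspAt (fun t => (x t, z t)) t₀ 3 5 ↔
      (deriv β t₀ = 0 ∧ deriv φ t₀ = 0 ∧
        iteratedDeriv 2 β t₀ * iteratedDeriv 2 φ t₀ ≠ 0)) := by
  have i2 : ∀ f : ℝ → ℝ, iteratedDeriv 2 f t₀ = deriv (deriv f) t₀ := fun f => by
    rw [iteratedDeriv_succ, iteratedDeriv_one]
  rw [i2, i2]
  refine ⟨⟨fun h => ?_, fun h => ?_⟩, ⟨fun h => ?_, fun h => ?_⟩⟩
  · obtain ⟨h1, h2, h3⟩ := nec34 x z φ β t₀ hx hz hφ hdx hdz h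
    exact ⟨h1, mul_ne_zero h2 h3⟩
  · obtain ⟨h1, h2⟩ := h
    exact suff_main34 x z φ β t₀ hx hz hφ hβ hdx hdz hβ0 h1
      (left_ne_zero_of_mul h2) (right_ne_zero_of_mul h2)
  · obtain ⟨h1, h2, h3, h4⟩ := nec35 x z φ β t₀ hx hz hφ hdx hdz h
    exact ⟨h1, h3, mul_ne_zero h2 h4⟩
  · obtain ⟨h1, h2, h3⟩ := h
    exact suff_main35 x z φ β t₀ hx hz hφ hβ hdx hdz hβ0 h1
      (left_ne_zero_of_mul h3) h2 (right_ne_zero_of_mul h3)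
end

section
/- Let (γ,ν): (I,t₀) → ℝ² × S¹ be a Legendre curve with γ(t)=(x(t),z(t)), ν(t)=(a(t),b(t)) and curvature (ℓ,β), satisfying ℓ(t)a(t) = c·β(t)x(t) for a nonzero constant c ∈ ℝ (i.e., K = cJ for the surface of revolution around the z-axis). Suppose x(t₀) ≠ 0, β(t₀) = 0, ord(a)(t₀) = m+1 and ord(β)(t₀) = n+1 with m ≤ n. Then: (1) γ has a 3/2-cusp at t₀ if and only if m = n = 0; (2) γ has a 4/3-cusp at t₀ if and only if m = n = 1; (3) γ has a 5/3-cusp at t₀ if and only if m = 0 and n = 1. Moreover, γ cannot have a 5/2-cusp at t₀. -/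
/-- `OrdAt f t₀ n` : `f` has a zero of order `n` at `t₀`. -/
def OrdAt (f : ℝ → ℝ) (t₀ : ℝ) (n : ℕ) : Prop :=
  (∀ k < n, iteratedDeriv k f t₀ = 0) ∧ iteratedDeriv n f t₀ ≠ 0

open Filter Topology Asymptotics Set

def HLead (f : ℝ → ℝ) (t₀ : ℝ) (k : ℕ) : Prop :=
  ∃ C : ℝ, C ≠ 0 ∧ Tendsto (fun t => f t / (t - t₀) ^ k) (𝓝[≠] t₀) (𝓝 C)

lemma HLead.integrate {f : ℝ → ℝ} {t₀ : ℝ} {k : ℕ} (hf : Differentiable ℝ f)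
    (h : HLead (deriv f) t₀ k) : HLead (fun t => f t - f t₀) t₀ (k + 1) := by
  obtain ⟨C, hC, h⟩ := h
  have hd : ∀ t, deriv (fun t : ℝ => (t - t₀) ^ (k + 1)) t = (k + 1) * (t - t₀) ^ k := by
    intro t
    have := ((hasDerivAt_id t).sub_const t₀).pow (k + 1)
    simpa using this.deriv
  have hk : (k + 1 : ℝ) ≠ 0 := by positivity
  refine ⟨C / (k + 1), div_ne_zero hC hk, ?_⟩
  apply deriv.lhopital_zero_nhdsNE
  · exact Eventually.of_forall fun t => (hf t).sub_const _
  · filter_upwards [self_mem_nhdsWithin] with t ht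
    rw [hd]
    exact mul_ne_zero hk (pow_ne_zero _ (sub_ne_zero.2 ht))
  · apply tendsto_nhdsWithin_of_tendsto_nhds
    have : Continuous fun t => f t - f t₀ := hf.continuous.sub continuous_const
    simpa using this.tendsto t₀
  · apply tendsto_nhdsWithin_of_tendsto_nhds
    have : Continuous fun t : ℝ => (t - t₀) ^ (k + 1) := by fun_prop
    simpa using this.tendsto t₀
  · refine (h.div_const (k + 1 : ℝ)).congr fun t => ?_
    rw [hd, deriv_sub_const]
    rw [div_div, mul_comm]

lemma OrdAt.hLead {t₀ : ℝ} {k : ℕ} : ∀ {f : ℝ → ℝ}, ContDiff ℝ (⊤ : ℕ∞) f → OrdAt f t₀ k →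
    HLead f t₀ k := by
  induction k with
  | zero =>
    intro f hf h
    refine ⟨f t₀, by simpa using h.2, ?_⟩
    simpa using (hf.continuous.tendsto t₀).mono_left nhdsWithin_le_nhds
  | succ k ih =>
    intro f hf h
    have h1 : ContDiff ℝ (⊤ : ℕ∞) (deriv f) := by
      have := (contDiff_infty_iff_deriv (𝕜 := ℝ) (f := f)).1 hf
      exact this.2
    have h2 : OrdAt (deriv f) t₀ k := by
      refine ⟨fun j hj => ?_, ?_⟩
      · rw [← iteratedDeriv_succ']; exact h.1 _ (by omega)
      · rw [← iteratedDeriv_succ']; exact h.2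
    have h0 : f t₀ = 0 := by simpa using h.1 0 (by omega)
    have := (ih h1 h2).integrate (hf.differentiable (by simp))
    simpa [h0] using this

lemma HLead.mul {f g : ℝ → ℝ} {t₀ : ℝ} {k l : ℕ} (hf : HLead f t₀ k) (hg : HLead g t₀ l) :
    HLead (fun t => f t * g t) t₀ (k + l) := by
  obtain ⟨C, hC, hf⟩ := hf
  obtain ⟨D, hD, hg⟩ := hg
  refine ⟨C * D, mul_ne_zero hC hD, (hf.mul hg).congr fun t => ?_⟩
  rw [pow_add, div_mul_div_comm]

lemma HLead.of_cont {f : ℝ → ℝ} {t₀ : ℝ} (hf : ContinuousAt f t₀) (h : f t₀ ≠ 0) :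
    HLead f t₀ 0 := ⟨f t₀, h, by simpa using hf.tendsto.mono_left nhdsWithin_le_nhds⟩

lemma HLead.isTheta {f : ℝ → ℝ} {t₀ : ℝ} {k : ℕ} (h : HLead f t₀ k) :
    f =Θ[𝓝[≠] t₀] fun t => (t - t₀) ^ k := by
  obtain ⟨C, hC, h⟩ := h
  exact (isTheta_of_div_tendsto_nhds_ne_zero h hC).symm

lemma pow_isBigO {t₀ : ℝ} {k l : ℕ}
    (h : (fun t : ℝ => (t - t₀) ^ k) =O[𝓝[≠] t₀] fun t => (t - t₀) ^ l) : l ≤ k := by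
  by_contra! hlt
  have h1 : (fun t : ℝ => (t - t₀) ^ l) =o[𝓝[≠] t₀] fun t => (t - t₀) ^ k := by
    have h2 : Tendsto (fun t : ℝ => t - t₀) (𝓝[≠] t₀) (𝓝 0) := by
      apply tendsto_nhdsWithin_of_tendsto_nhds
      have : Continuous fun t : ℝ => t - t₀ := by fun_prop
      simpa using this.tendsto t₀
    exact (isLittleO_pow_pow hlt).comp_tendsto h2
  refine h.not_isLittleO ?_ h1
  apply Eventually.frequently
  filter_upwards [self_mem_nhdsWithin] with t ht
  exact pow_ne_zero _ (sub_ne_zero.2 ht)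

lemma HLead.unique {f : ℝ → ℝ} {t₀ : ℝ} {k l : ℕ} (h : HLead f t₀ k) (h' : HLead f t₀ l) :
    k = l :=
  le_antisymm (pow_isBigO (h'.isTheta.symm.trans h.isTheta).1)
    (pow_isBigO (h.isTheta.symm.trans h'.isTheta).1)

lemma HLead.comp_tendsto {f h : ℝ → ℝ} {t₀ e : ℝ} {k : ℕ} (h0 : h 0 = t₀)
    (hd : HasDerivAt h e 0) (he : e ≠ 0) {C : ℝ}
    (hf : Tendsto (fun t => f t / (t - t₀) ^ k) (𝓝[≠] t₀) (𝓝 C)) :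
    Tendsto (fun s => f (h s) / s ^ k) (𝓝[≠] 0) (𝓝 (C * e ^ k)) := by
  have hne : Tendsto h (𝓝[≠] 0) (𝓝[≠] t₀) := by
    have := hd.tendsto_nhdsNE he
    rwa [h0] at this
  have hs : Tendsto (fun s => (h s - t₀) / s) (𝓝[≠] 0) (𝓝 e) := by
    have := hasDerivAt_iff_tendsto_slope.1 hd
    refine this.congr fun s => ?_
    rw [slope_def_field, h0, sub_zero]
  have h2 := (hf.comp hne).mul (hs.pow k)
  refine h2.congr' ?_
  filter_upwards [hne self_mem_nhdsWithin] with s hs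
  have : h s - t₀ ≠ 0 := sub_ne_zero.2 hs
  simp only [Function.comp, div_pow]
  field_simp

lemma HLead.comp {f h : ℝ → ℝ} {t₀ e : ℝ} {k : ℕ} (hf : HLead f t₀ k) (h0 : h 0 = t₀)
    (hd : HasDerivAt h e 0) (he : e ≠ 0) : HLead (fun s => f (h s)) 0 k := by
  obtain ⟨C, hC, hf⟩ := hf
  exact ⟨C * e ^ k, mul_ne_zero hC (pow_ne_zero _ he), by
    simpa using HLead.comp_tendsto h0 hd he hf⟩

lemma cusp_reparam {γ : ℝ → ℝ × ℝ} (hγ : Continuous γ) {t₀ : ℝ} {i j : ℕ}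
    (H : HasCuspAt γ t₀ i j) :
    ∃ (h : ℝ → ℝ) (g Ψ : ℝ × ℝ → ℝ × ℝ) (e : ℝ), h 0 = t₀ ∧ HasDerivAt h e 0 ∧ e ≠ 0 ∧
      DifferentiableAt ℝ Ψ (γ t₀) ∧ Ψ (γ t₀) = (0, 0) ∧ ContDiffAt ℝ 1 g (0, 0) ∧
      g (0, 0) = γ t₀ ∧
      ∀ᶠ s in 𝓝 (0 : ℝ), γ (h s) = g (s ^ i, s ^ j) ∧ Ψ (γ (h s)) = (s ^ i, s ^ j) := by
  obtain ⟨φ, Ψ, ⟨hφ0, U, V, h, hU, htU, hV, h0V, hφc, hhc, -, hm2, hgf, hfg⟩,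
    ⟨hΨ0, U', V', g, hU', htU', hV', h0V', hΨc, hgc, -, -, hgf', hfg'⟩, hev⟩ := H
  have h0 : h 0 = t₀ := by rw [← hφ0]; exact hgf _ htU
  have hdh : DifferentiableAt ℝ h 0 :=
    (hhc.contDiffAt (hV.mem_nhds h0V)).differentiableAt (by simp)
  have hdφ : DifferentiableAt ℝ φ t₀ :=
    (hφc.contDiffAt (hU.mem_nhds htU)).differentiableAt (by simp)
  have he : deriv φ t₀ * deriv h 0 = 1 := by
    have h1 : HasDerivAt (φ ∘ h) (deriv φ t₀ * deriv h 0) 0 := by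
      apply HasDerivAt.comp
      · rw [h0]; exact hdφ.hasDerivAt
      · exact hdh.hasDerivAt
    have h2 : φ ∘ h =ᶠ[𝓝 0] id := by
      filter_upwards [hV.mem_nhds h0V] with s hs using hfg s hs
    exact h1.unique ((hasDerivAt_id (0:ℝ)).congr_of_eventuallyEq h2)
  refine ⟨h, g, Ψ, deriv h 0, h0, hdh.hasDerivAt, right_ne_zero_of_mul_eq_one he,
    (hΨc.contDiffAt (hU'.mem_nhds htU')).differentiableAt (by simp), hΨ0,
    (hgc.contDiffAt (hV'.mem_nhds h0V')).of_le (by simp), ?_, ?_⟩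
  · rw [← hΨ0]; exact hgf' _ htU'
  · have hth : Tendsto h (𝓝 0) (𝓝 t₀) := by
      have := hdh.continuousAt.tendsto; rwa [h0] at this
    have hγU : ∀ᶠ t in 𝓝 t₀, γ t ∈ U' := hγ.continuousAt.eventually (hU'.mem_nhds htU')
    filter_upwards [hV.mem_nhds h0V, hth.eventually hev, hth.eventually hγU] with s h1 h2 h3
    rw [hfg s h1] at h2
    exact ⟨by rw [← h2]; exact (hgf' _ h3).symm, h2⟩

lemma cusp_mult {x z : ℝ → ℝ} (hx : Continuous x) (hz : Continuous z) {t₀ : ℝ} {i j k l : ℕ}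
    (hi : 0 < i) (hij : i ≤ j) (H : HasCuspAt (fun t => (x t, z t)) t₀ i j)
    (hk : HLead (fun t => x t - x t₀) t₀ k) (hl : HLead (fun t => z t - z t₀) t₀ l)
    (hkl : k ≤ l) : i = k := by
  obtain ⟨h, g, Ψ, e, h0, hd, he, hΨ, hΨ0, hg, hg0, hev⟩ :=
    cusp_reparam (hx.prodMk hz) H
  have hX := (hk.comp h0 hd he).isTheta
  have hZ := (hl.comp h0 hd he).isTheta
  have mono : ∀ p q : ℕ, p ≤ q →
      (fun s : ℝ => (s - 0) ^ q) =O[𝓝[≠] 0] fun s : ℝ => (s - 0) ^ p := by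
    intro p q hpq
    rcases hpq.eq_or_lt with rfl | hlt
    · exact isBigO_refl _ _
    · simpa using ((isLittleO_pow_pow (𝕜 := ℝ) hlt).isBigO.mono nhdsWithin_le_nhds)
  have hth : Tendsto h (𝓝[≠] 0) (𝓝 t₀) := by
    have := hd.continuousAt.tendsto; rw [h0] at this
    exact this.mono_left nhdsWithin_le_nhds
  have hev' := hev.filter_mono (nhdsWithin_le_nhds (s := {0}ᶜ))
  apply le_antisymm
  · -- `x - x₀ = O(s^i)`
    have hgd : DifferentiableAt ℝ g (0, 0) := hg.differentiableAt (by simp)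
    have h1 : Tendsto (fun s : ℝ => (s ^ i, s ^ j)) (𝓝[≠] 0) (𝓝 ((0, 0) : ℝ × ℝ)) := by
      apply tendsto_nhdsWithin_of_tendsto_nhds
      have : Continuous fun s : ℝ => (s ^ i, s ^ j) := by fun_prop
      simpa [hi.ne', (hi.trans_le hij).ne'] using this.tendsto 0
    have h2 := hgd.isBigO_sub.comp_tendsto h1
    have h3 : (fun s : ℝ => ((s ^ i, s ^ j) : ℝ × ℝ) - (0, 0)) =O[𝓝[≠] 0]
        fun s : ℝ => (s - 0) ^ i := by
      simp only [Prod.mk_sub_mk, sub_zero]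
      refine IsBigO.prod_left (isBigO_refl _ _) ?_
      simpa using mono i j hij
    have h4 : (fun s => x (h s) - x t₀) =O[𝓝[≠] 0] fun s : ℝ => (s - 0) ^ i := by
      have h5 := h2.trans h3
      have h6 : (fun s : ℝ => ((x (h s) - x t₀, z (h s) - z t₀) : ℝ × ℝ)) =O[𝓝[≠] 0]
          fun s : ℝ => (s - 0) ^ i := by
        refine h5.congr' ?_ EventuallyEq.rfl
        filter_upwards [hev'] with s hs
        simp only [Function.comp]
        rw [← hs.1, hg0]; rfl
      exact isBigO_fst_prod.trans h6
    exact pow_isBigO (hX.symm.1.trans h4)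
  · have h2 : (fun s => Ψ (x (h s), z (h s)) - Ψ (x t₀, z t₀)) =O[𝓝[≠] 0]
        fun s => ((x (h s), z (h s)) : ℝ × ℝ) - (x t₀, z t₀) := by
      refine hΨ.isBigO_sub.comp_tendsto (k := fun s => (x (h s), z (h s))) ?_
      exact ((hx.prodMk hz).tendsto t₀).comp hth
    have h3 : (fun s => ((x (h s), z (h s)) : ℝ × ℝ) - (x t₀, z t₀)) =O[𝓝[≠] 0]
        fun s : ℝ => (s - 0) ^ k := by
      simp only [Prod.mk_sub_mk]
      exact IsBigO.prod_left hX.1 (hZ.1.trans (mono k l hkl))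
    have h4 : (fun s : ℝ => ((s ^ i, s ^ j) : ℝ × ℝ)) =O[𝓝[≠] 0]
        fun s : ℝ => (s - 0) ^ k := by
      refine (h2.trans h3).congr' ?_ EventuallyEq.rfl
      filter_upwards [hev'] with s hs
      rw [hs.2, hΨ0]; simp
    have h5 : (fun s : ℝ => (s - 0) ^ i) =O[𝓝[≠] 0] fun s : ℝ => (s - 0) ^ k := by
      simp only [sub_zero] at h4 ⊢
      exact isBigO_fst_prod.trans h4
    exact pow_isBigO h5

lemma not_cusp_five_two {x z : ℝ → ℝ} (hx : Continuous x) (hz : Continuous z) {t₀ : ℝ}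
    (H : HasCuspAt (fun t => (x t, z t)) t₀ 2 5)
    (hl : HLead (fun t => z t - z t₀) t₀ 3) : False := by
  obtain ⟨h, g, Ψ, e, h0, hd, he, hΨ, hΨ0, hg, hg0, hev⟩ :=
    cusp_reparam (hx.prodMk hz) H
  obtain ⟨C, hC, hl⟩ := hl
  have h1 := HLead.comp_tendsto h0 hd he hl
  have hneg : Tendsto (fun s : ℝ => -s) (𝓝[≠] 0) (𝓝[≠] 0) := by
    have : HasDerivAt (fun s : ℝ => -s) (-1) 0 := (hasDerivAt_id (0:ℝ)).neg
    simpa using this.tendsto_nhdsNE (by norm_num)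
  have h2 := h1.add (h1.comp hneg)
  have hD : C * e ^ 3 + C * e ^ 3 ≠ 0 := by
    rw [← two_mul]; exact mul_ne_zero two_ne_zero (mul_ne_zero hC (pow_ne_zero _ he))
  have h3 : HLead (fun s => z (h s) - z (h (-s))) 0 3 := by
    refine ⟨_, hD, h2.congr fun s => ?_⟩
    simp only [Function.comp, sub_zero]
    rw [Odd.neg_pow (by decide), div_neg, ← sub_eq_add_neg, ← sub_div]
    congr 1; ring
  have hgs := (hg.hasStrictFDerivAt (by simp)).isBigO_sub
  have h4 : Tendsto (fun s : ℝ => (((s ^ 2, s ^ 5), ((-s) ^ 2, (-s) ^ 5)) : (ℝ × ℝ) × (ℝ × ℝ)))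
      (𝓝[≠] 0) (𝓝 ((0, 0), (0, 0))) := by
    apply tendsto_nhdsWithin_of_tendsto_nhds
    have : Continuous fun s : ℝ =>
      (((s ^ 2, s ^ 5), ((-s) ^ 2, (-s) ^ 5)) : (ℝ × ℝ) × (ℝ × ℝ)) := by fun_prop
    simpa using this.tendsto 0
  have h5 := hgs.comp_tendsto h4
  have hev' := hev.filter_mono (nhdsWithin_le_nhds (s := {0}ᶜ))
  have h6 : (fun s => z (h s) - z (h (-s))) =O[𝓝[≠] 0] fun s : ℝ => (s - 0) ^ 5 := by
    have h7 : (fun s : ℝ => ((x (h s) - x (h (-s)), z (h s) - z (h (-s))) : ℝ × ℝ)) =O[𝓝[≠] 0]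
        fun s : ℝ => (((s ^ 2, s ^ 5)) : (ℝ × ℝ)) - ((-s) ^ 2, (-s) ^ 5) := by
      refine h5.congr' ?_ EventuallyEq.rfl
      filter_upwards [hev', hneg.eventually hev'] with s hs hs'
      simp only [Function.comp]
      rw [← hs.1, ← hs'.1]; rfl
    have h8 : (fun s : ℝ => (((s ^ 2, s ^ 5)) : (ℝ × ℝ)) - ((-s) ^ 2, (-s) ^ 5)) =O[𝓝[≠] 0]
        fun s : ℝ => (s - 0) ^ 5 := by
      simp only [Prod.mk_sub_mk]
      refine IsBigO.prod_left ?_ ?_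
      · simp only [even_two.neg_pow, sub_self]; exact isBigO_zero _ _
      · have : (fun s : ℝ => s ^ 5 - (-s) ^ 5) = fun s : ℝ => 2 * (s - 0) ^ 5 := by
          ext s; ring
        rw [this]
        exact isBigO_const_mul_self _ _ _
    exact isBigO_snd_prod.trans (h7.trans h8)
  have := pow_isBigO (h3.isTheta.symm.1.trans h6)
  omega

lemma param_hasDerivAt {K : ℝ → ℝ} (hK : ContDiff ℝ 1 K) (p : ℕ) (w : ℝ) :
    HasDerivAt (fun w => ∫ τ in (0:ℝ)..1, τ ^ p * K (w * τ ^ 2))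
      (∫ τ in (0:ℝ)..1, τ ^ (p + 2) * deriv K (w * τ ^ 2)) w := by
  have hKc := hK.continuous
  have hK'c : Continuous (deriv K) := hK.continuous_deriv (by simp)
  have hcF : ∀ w : ℝ, Continuous fun τ : ℝ => τ ^ p * K (w * τ ^ 2) := by
    intro w; fun_prop
  have hcF' : Continuous fun q : ℝ × ℝ => q.2 ^ (p + 2) * deriv K (q.1 * q.2 ^ 2) := by
    fun_prop
  have hcF'w : ∀ w : ℝ, Continuous fun τ : ℝ => τ ^ (p + 2) * deriv K (w * τ ^ 2) := by
    intro w; fun_prop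
  obtain ⟨M, hM⟩ := ((isCompact_closedBall w (1:ℝ)).prod (isCompact_Icc (a := (0:ℝ)) (b := 1))
    ).exists_bound_of_continuousOn hcF'.continuousOn
  refine (intervalIntegral.hasDerivAt_integral_of_dominated_loc_of_deriv_le
    (F' := fun w τ => τ ^ (p + 2) * deriv K (w * τ ^ 2)) (bound := fun _ => M)
    (Metric.closedBall_mem_nhds w one_pos) ?_ ?_ ?_ ?_ ?_ ?_).2
  · exact Eventually.of_forall fun w => (hcF w).aestronglyMeasurable
  · exact (hcF w).intervalIntegrable _ _
  · exact (hcF'w w).aestronglyMeasurable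
  · refine Eventually.of_forall fun τ hτ v hv => hM (v, τ) ⟨hv, ?_⟩
    rw [uIoc_of_le zero_le_one] at hτ
    exact ⟨hτ.1.le, hτ.2⟩
  · exact intervalIntegrable_const
  · refine Eventually.of_forall fun τ hτ v hv => ?_
    have h1 : HasDerivAt (fun v : ℝ => v * τ ^ 2) (τ ^ 2) v := hasDerivAt_mul_const _
    have h2 : HasDerivAt K (deriv K (v * τ ^ 2)) (v * τ ^ 2) :=
      (hK.differentiable (by simp) _).hasDerivAt
    have h3 := (h2.comp v h1).const_mul (τ ^ p)
    exact h3.congr_deriv (by ring)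

lemma param_contDiff (N : ℕ) : ∀ {K : ℝ → ℝ} (_ : ContDiff ℝ (⊤ : ℕ∞) K) (p : ℕ),
    ContDiff ℝ N (fun w => ∫ τ in (0:ℝ)..1, τ ^ p * K (w * τ ^ 2)) := by
  induction N with
  | zero =>
    intro K hK p
    refine contDiff_zero.2 ?_
    exact continuous_iff_continuousAt.2 fun w =>
      (param_hasDerivAt (hK.of_le (by simp)) p w).continuousAt
  | succ N ih =>
    intro K hK p
    have hd := fun w => param_hasDerivAt (hK.of_le (by simp)) p w
    have : ((N + 1 : ℕ) : WithTop ℕ∞) = (N : WithTop ℕ∞) + 1 := by simp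
    rw [this, contDiff_succ_iff_deriv]
    refine ⟨fun w => (hd w).differentiableAt, by simp, ?_⟩
    have h2 : deriv (fun w => ∫ τ in (0:ℝ)..1, τ ^ p * K (w * τ ^ 2)) =
        fun w => ∫ τ in (0:ℝ)..1, τ ^ (p + 2) * deriv K (w * τ ^ 2) :=
      funext fun w => (hd w).deriv
    rw [h2]
    exact ih (contDiff_infty_iff_deriv.1 hK).2 (p + 2)

lemma exists_global {K : ℝ → ℝ} {r : ℝ} (hr : 0 < r)
    (hK : ContDiffOn ℝ (⊤ : ℕ∞) K (Metric.ball 0 r)) :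
    ∃ K' : ℝ → ℝ, ContDiff ℝ (⊤ : ℕ∞) K' ∧ K' =ᶠ[𝓝 0] K := by
  let f : ContDiffBump (0 : ℝ) := ⟨r / 4, r / 2, by positivity, by linarith⟩
  refine ⟨fun u => f u * K u, ?_, ?_⟩
  · rw [contDiff_iff_contDiffAt]
    intro u
    by_cases hu : u ∈ Metric.ball (0:ℝ) r
    · exact f.contDiff.contDiffAt.mul (hK.contDiffAt (Metric.isOpen_ball.mem_nhds hu))
    · have : (fun u => f u * K u) =ᶠ[𝓝 u] fun _ => 0 := by
        have h1 : (Metric.closedBall (0:ℝ) (r / 2))ᶜ ∈ 𝓝 u := by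
          apply Metric.isClosed_closedBall.isOpen_compl.mem_nhds
          intro h
          apply hu
          exact Metric.closedBall_subset_ball (by linarith) h
        filter_upwards [h1] with v hv
        have : f v = 0 := f.zero_of_le_dist (by
          have : ¬ dist v 0 ≤ r / 2 := hv
          exact (not_le.1 this).le)
        rw [this, zero_mul]
      exact contDiffAt_const.congr_of_eventuallyEq this
  · filter_upwards [f.eventuallyEq_one] with u hu
    rw [hu]; simp

lemma exists_G {K : ℝ → ℝ} {r : ℝ} (hr : 0 < r)
    (hK : ContDiffOn ℝ (⊤ : ℕ∞) K (Metric.ball 0 r)) :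
    ∃ G : ℝ → ℝ, ContDiff ℝ (⊤ : ℕ∞) G ∧ G 0 = K 0 / 3 ∧
      ∀ᶠ s in 𝓝 (0:ℝ), HasDerivAt (fun s => s ^ 3 * G (s ^ 2)) (s ^ 2 * K (s ^ 2)) s := by
  obtain ⟨K', hK', he⟩ := exists_global hr hK
  refine ⟨fun w => ∫ τ in (0:ℝ)..1, τ ^ 2 * K' (w * τ ^ 2), ?_, ?_, ?_⟩
  · exact contDiff_infty.2 fun N => param_contDiff N hK' 2
  · simp only [zero_mul, intervalIntegral.integral_mul_const, integral_pow]
    rw [he.self_of_nhds]; norm_num; ring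
  · have hc : Continuous fun r : ℝ => r ^ 2 * K' (r ^ 2) := by
      have := hK'.continuous; fun_prop
    have heq : (fun s : ℝ => s ^ 3 * ∫ τ in (0:ℝ)..1, τ ^ 2 * K' (s ^ 2 * τ ^ 2)) =
        fun s : ℝ => ∫ r in (0:ℝ)..s, r ^ 2 * K' (r ^ 2) := by
      ext s
      have := intervalIntegral.mul_integral_comp_mul_left (a := 0) (b := 1)
        (f := fun r : ℝ => r ^ 2 * K' (r ^ 2)) s
      simp only [mul_zero, mul_one] at this
      rw [← this, pow_succ' s 2, mul_assoc, ← intervalIntegral.integral_const_mul]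
      congr 1
      apply intervalIntegral.integral_congr
      intro τ _
      simp only [mul_pow]; ring
    have ht : Tendsto (fun s : ℝ => s ^ 2) (𝓝 0) (𝓝 0) := by
      have : Continuous fun s : ℝ => s ^ 2 := by fun_prop
      simpa using this.tendsto 0
    filter_upwards [ht.eventually he] with s hs
    rw [heq, ← hs]
    exact intervalIntegral.integral_hasDerivAt_right (hc.intervalIntegrable _ _)
      (hc.stronglyMeasurableAtFilter _ _) hc.continuousAt

lemma diffeoGerm_of_deriv {a : ℝ → ℝ} {t₀ : ℝ} (ha : ContDiff ℝ (⊤ : ℕ∞) a) (h0 : a t₀ = 0)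
    (hd : deriv a t₀ ≠ 0) : DiffeoGermAt a t₀ 0 := by
  have hda : ∀ t, HasDerivAt a (deriv a t) t := fun t =>
    (ha.differentiable (by simp) t).hasDerivAt
  have hs : HasStrictDerivAt a (deriv a t₀) t₀ :=
    ha.contDiffAt.hasStrictDerivAt' (hda t₀) (by simp)
  let P := (hs.hasStrictFDerivAt_equiv hd).toOpenPartialHomeomorph a
  have hP : ⇑P = a := rfl
  have hmem : t₀ ∈ P.source := (hs.hasStrictFDerivAt_equiv hd).mem_toOpenPartialHomeomorph_source
  have hopen : IsOpen {t | deriv a t ≠ 0} :=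
    isOpen_ne.preimage (ha.continuous_deriv (by simp))
  let Q := P.restrOpen _ hopen
  have hQ : ⇑Q = a := rfl
  have hQs : Q.source = P.source ∩ {t | deriv a t ≠ 0} := rfl
  have hmQ : t₀ ∈ Q.source := ⟨hmem, hd⟩
  refine ⟨h0, Q.source, Q.target, Q.symm, Q.open_source, hmQ, Q.open_target, ?_,
    ha.contDiffOn, ?_, ?_, ?_, ?_, ?_⟩
  · rw [← h0]; exact Q.map_source hmQ
  · intro y hy
    have h1 : Q.symm y ∈ Q.source := Q.map_target hy
    exact (Q.contDiffAt_symm_deriv h1.2 hy (hda _) ha.contDiffAt).contDiffWithinAt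
  · exact fun t ht => Q.map_source ht
  · exact fun t ht => Q.map_target ht
  · exact fun t ht => Q.left_inv ht
  · exact fun t ht => Q.right_inv ht

lemma cusp_normal {x z a b ℓ β : ℝ → ℝ} {c t₀ : ℝ}
    (hx : ContDiff ℝ (⊤ : ℕ∞) x) (hz : ContDiff ℝ (⊤ : ℕ∞) z)
    (ha : ContDiff ℝ (⊤ : ℕ∞) a) (hb : ContDiff ℝ (⊤ : ℕ∞) b)
    (hunit : ∀ t, a t ^ 2 + b t ^ 2 = 1)
    (hdz : ∀ t, deriv z t = β t * a t)
    (hda : ∀ t, deriv a t = -(ℓ t) * b t)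
    (hc : c ≠ 0)
    (hrel : ∀ t, ℓ t * a t = c * β t * x t)
    (hx0 : x t₀ ≠ 0) (ha0 : a t₀ = 0) (ha1 : deriv a t₀ ≠ 0)
    (hax : ∀ t, a t ^ 2 = c * (x t ^ 2 - x t₀ ^ 2)) :
    HasCuspAt (fun t => (x t, z t)) t₀ 2 3 := by
  have hb0 : b t₀ ^ 2 = 1 := by have := hunit t₀; rw [ha0] at this; linarith
  have hb0' : b t₀ ≠ 0 := by intro h; rw [h] at hb0; norm_num at hb0
  set X : ℝ → ℝ := fun u => x t₀ * √(1 + u / (c * x t₀ ^ 2)) with hX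
  set B : ℝ → ℝ := fun u => b t₀ * √(1 - u) with hB
  have hcx : c * x t₀ ^ 2 ≠ 0 := mul_ne_zero hc (pow_ne_zero _ hx0)
  obtain ⟨r, hr, hrU⟩ : ∃ r > 0, ∀ u ∈ Metric.ball (0:ℝ) r,
      0 < 1 + u / (c * x t₀ ^ 2) ∧ 0 < 1 - u := by
    have h1 : ∀ᶠ u in 𝓝 (0:ℝ), 0 < 1 + u / (c * x t₀ ^ 2) := by
      have : Continuous fun u : ℝ => 1 + u / (c * x t₀ ^ 2) := by fun_prop
      exact this.continuousAt.eventually (lt_mem_nhds (by simp))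
    have h2 : ∀ᶠ u in 𝓝 (0:ℝ), 0 < 1 - u := by
      have : Continuous fun u : ℝ => 1 - u := by fun_prop
      exact this.continuousAt.eventually (lt_mem_nhds (by simp))
    exact Metric.eventually_nhds_iff_ball.1 (h1.and h2)
  have hXs : ContDiffOn ℝ (⊤ : ℕ∞) X (Metric.ball 0 r) := by
    apply contDiffOn_const.mul
    apply ContDiffOn.sqrt
    · fun_prop
    · exact fun u hu => (hrU u hu).1.ne'
  have hBs : ContDiffOn ℝ (⊤ : ℕ∞) B (Metric.ball 0 r) := by
    apply contDiffOn_const.mul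
    apply ContDiffOn.sqrt
    · fun_prop
    · exact fun u hu => (hrU u hu).2.ne'
  have hX0 : ∀ u ∈ Metric.ball (0:ℝ) r, X u ≠ 0 := fun u hu =>
    mul_ne_zero hx0 (Real.sqrt_pos.2 (hrU u hu).1).ne'
  have hB0 : ∀ u ∈ Metric.ball (0:ℝ) r, B u ≠ 0 := fun u hu =>
    mul_ne_zero hb0' (Real.sqrt_pos.2 (hrU u hu).2).ne'
  have hKs : ContDiffOn ℝ (⊤ : ℕ∞) (fun u => -1 / (c * (X u * B u))) (Metric.ball 0 r) := by
    apply contDiffOn_const.div (contDiffOn_const.mul (hXs.mul hBs))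
    exact fun u hu => mul_ne_zero hc (mul_ne_zero (hX0 u hu) (hB0 u hu))
  obtain ⟨G, hG, hG0, hGd⟩ := exists_G hr hKs
  have hmem0 : (0:ℝ) ∈ Metric.ball (0:ℝ) r := Metric.mem_ball_self hr
  have hG0' : G 0 ≠ 0 := by
    rw [hG0]
    exact div_ne_zero (div_ne_zero (by norm_num) (mul_ne_zero hc
      (mul_ne_zero (hX0 0 hmem0) (hB0 0 hmem0)))) (by norm_num)
  -- near `t₀`, everything is a function of `a`
  have hta : Tendsto a (𝓝 t₀) (𝓝 0) := by
    have := ha.continuous.tendsto t₀; rwa [ha0] at this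
  have hta2 : Tendsto (fun t => a t ^ 2) (𝓝 t₀) (𝓝 0) := by simpa using hta.pow 2
  have hXx : ∀ y u : ℝ, u ∈ Metric.ball (0:ℝ) r → 0 < y * x t₀ →
      u = c * (y ^ 2 - x t₀ ^ 2) → X u = y := by
    intro y u hu hy huy
    have h1 : X u ^ 2 = y ^ 2 := by
      simp only [hX]
      rw [mul_pow, Real.sq_sqrt (hrU u hu).1.le, huy]
      field_simp
      ring
    rcases sq_eq_sq_iff_eq_or_eq_neg.1 h1 with h | h
    · exact h
    · exfalso
      have h2 : X u * x t₀ = x t₀ ^ 2 * √(1 + u / (c * x t₀ ^ 2)) := by simp only [hX]; ring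
      have h3 : 0 < X u * x t₀ := by
        rw [h2]; exact mul_pos (by positivity) (Real.sqrt_pos.2 (hrU u hu).1)
      rw [h] at h3; linarith
  have hxpos : ∀ᶠ t in 𝓝 t₀, 0 < x t * x t₀ := by
    have : Continuous fun t => x t * x t₀ := hx.continuous.mul continuous_const
    exact this.continuousAt.eventually (lt_mem_nhds (mul_self_pos.2 (by assumption)))
  have hbpos : ∀ᶠ t in 𝓝 t₀, 0 < b t * b t₀ := by
    have : Continuous fun t => b t * b t₀ := hb.continuous.mul continuous_const
    exact this.continuousAt.eventually (lt_mem_nhds (mul_self_pos.2 (by assumption)))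
  have hball : ∀ᶠ t in 𝓝 t₀, a t ^ 2 ∈ Metric.ball (0:ℝ) r :=
    hta2.eventually (Metric.ball_mem_nhds _ hr)
  have hBb : ∀ᶠ t in 𝓝 t₀, B (a t ^ 2) = b t := by
    filter_upwards [hbpos, hball] with t ht hu
    have h1 : B (a t ^ 2) ^ 2 = b t ^ 2 := by
      simp only [hB]
      rw [mul_pow, Real.sq_sqrt (hrU _ hu).2.le, hb0]
      linarith [hunit t]
    rcases sq_eq_sq_iff_eq_or_eq_neg.1 h1 with h | h
    · exact h
    · exfalso
      have h2 : B (a t ^ 2) * b t₀ = b t₀ ^ 2 * √(1 - a t ^ 2) := by simp only [hB]; ring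
      have h3 : 0 < B (a t ^ 2) * b t₀ := by
        rw [h2]; exact mul_pos (by positivity) (Real.sqrt_pos.2 (hrU _ hu).2)
      rw [h] at h3; linarith
  have hzder : ∀ᶠ t in 𝓝 t₀, HasDerivAt (fun t => z t - a t ^ 3 * G (a t ^ 2)) 0 t := by
    filter_upwards [hxpos, hball, hBb, hta.eventually hGd] with t h1 h2 h3 h4
    have h5 : X (a t ^ 2) = x t := hXx _ _ h2 h1 (hax t)
    have hxt : x t ≠ 0 := left_ne_zero_of_mul h1.ne'
    have hbt : b t ≠ 0 := h3 ▸ hB0 _ h2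
    have h6 : HasDerivAt z (β t * a t) t := by
      rw [← hdz]; exact (hz.differentiable (by simp) t).hasDerivAt
    have h7 : HasDerivAt a (-(ℓ t) * b t) t := by
      rw [← hda]; exact (ha.differentiable (by simp) t).hasDerivAt
    have h8 := h6.sub (h4.comp t h7)
    refine h8.congr_deriv ?_
    rw [h5, h3]
    have h9 := hrel t
    field_simp
    linear_combination (-(a t)) * h9
  have hzeq : ∀ᶠ t in 𝓝 t₀, z t = z t₀ + a t ^ 3 * G (a t ^ 2) := by
    obtain ⟨ε, hε, hε'⟩ := Metric.eventually_nhds_iff_ball.1 hzder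
    filter_upwards [Metric.ball_mem_nhds t₀ hε] with t ht
    have hconst := Metric.isOpen_ball.is_const_of_deriv_eq_zero
      (convex_ball t₀ ε).isPreconnected
      (f := fun t => z t - a t ^ 3 * G (a t ^ 2))
      (fun s hs => (hε' s hs).differentiableAt.differentiableWithinAt)
      (fun s hs => (hε' s hs).deriv) ht (Metric.mem_ball_self hε)
    simp only [ha0] at hconst
    linarith
  -- neighbourhood of zero where `G ≠ 0`
  set W : Set ℝ := Metric.ball 0 r ∩ {u | G u ≠ 0} with hW
  have hWo : IsOpen W := Metric.isOpen_ball.inter (isOpen_ne.preimage hG.continuous)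
  have h0W : (0:ℝ) ∈ W := ⟨hmem0, hG0'⟩
  set q : ℝ × ℝ → ℝ := fun p => c * (p.1 ^ 2 - x t₀ ^ 2) with hq
  have hqs : ContDiff ℝ (⊤ : ℕ∞) q := by simp only [hq]; fun_prop
  refine ⟨a, fun p => (q p, (p.2 - z t₀) / G (q p)), diffeoGerm_of_deriv ha ha0 ha1,
    ⟨by simp [hq], {p | q p ∈ W} ∩ {p | 0 < p.1 * x t₀}, {p | p.1 ∈ W},
      fun p => (X p.1, z t₀ + p.2 * G p.1), ?_, ?_, ?_, ?_, ?_, ?_, ?_, ?_, ?_, ?_⟩, ?_⟩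
  · exact (hWo.preimage hqs.continuous).inter
      (isOpen_lt continuous_const (continuous_fst.mul continuous_const))
  · refine ⟨?_, ?_⟩
    · simpa [hq] using h0W
    · show 0 < x t₀ * x t₀
      exact mul_self_pos.2 hx0
  · exact hWo.preimage continuous_fst
  · exact h0W
  · apply hqs.contDiffOn.prodMk
    apply ContDiffOn.div
    · fun_prop
    · exact (hG.comp hqs).contDiffOn
    · exact fun p hp => hp.1.2
  · apply ContDiffOn.prodMk
    · exact hXs.comp contDiff_fst.contDiffOn fun p hp => hp.1
    · exact (contDiff_const.add (contDiff_snd.mul (hG.comp contDiff_fst))).contDiffOn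
  · exact fun p hp => hp.1
  · intro p hp
    have hqX : c * (X p.1 ^ 2 - x t₀ ^ 2) = p.1 := by
      simp only [hX]
      rw [mul_pow, Real.sq_sqrt (hrU _ hp.1).1.le]
      field_simp
      ring
    refine ⟨?_, ?_⟩
    · show c * (X p.1 ^ 2 - x t₀ ^ 2) ∈ W
      rw [hqX]; exact hp
    · show 0 < X p.1 * x t₀
      have h2 : X p.1 * x t₀ = x t₀ ^ 2 * √(1 + p.1 / (c * x t₀ ^ 2)) := by
        simp only [hX]; ring
      rw [h2]; exact mul_pos (by positivity) (Real.sqrt_pos.2 (hrU _ hp.1).1)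
  · rintro ⟨y, w⟩ ⟨h1, h2⟩
    have h3 : X (q (y, w)) = y := hXx y _ h1.1 h2 rfl
    have h4 : G (q (y, w)) ≠ 0 := h1.2
    simp only [h3]
    rw [div_mul_cancel₀ _ h4]
    simp
  · rintro ⟨u, v⟩ hp
    have hqX : ∀ w, q (X u, w) = u := by
      intro w
      simp only [hX, hq]
      rw [mul_pow, Real.sq_sqrt (hrU _ hp.1).1.le]
      field_simp
      ring
    have h4 : G u ≠ 0 := hp.2
    simp only [hqX]
    rw [add_sub_cancel_left, mul_div_cancel_right₀ _ h4]
  · have hGne : ∀ᶠ t in 𝓝 t₀, G (a t ^ 2) ≠ 0 :=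
      hta2.eventually (hG.continuous.continuousAt.eventually_ne hG0')
    filter_upwards [hzeq, hGne] with t h1 h2
    have h3 : q (x t, z t) = a t ^ 2 := (hax t).symm
    simp only [h3]
    rw [h1, add_sub_cancel_left, mul_div_cancel_right₀ _ h2]

/-- Let `(γ, ν)` be a Legendre curve with `γ = (x, z)`, `ν = (a, b)`,
curvature `(ℓ, β)`, satisfying `ℓa = cβx` for a nonzero constant `c` (constant Gauss
curvature ratio `K = cJ`).  Suppose `x t₀ ≠ 0`, `β t₀ = 0`, `ord(a)(t₀) = m + 1`,
`ord(β)(t₀) = n + 1` and `m ≤ n`.  Then `γ` has a 3/2-cusp at `t₀` iff `m = n = 0`; a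
4/3-cusp iff `m = n = 1`; a 5/3-cusp iff `m = 0 ∧ n = 1`; and `γ` cannot have a
5/2-cusp at `t₀`. -/
theorem cusps_of_constant_Gauss_curvature_surfaces_of_revolution
    (x z a b ℓ β : ℝ → ℝ) (c : ℝ) (t₀ : ℝ) (m n : ℕ)
    (hx : ContDiff ℝ (⊤ : ℕ∞) x) (hz : ContDiff ℝ (⊤ : ℕ∞) z)
    (ha : ContDiff ℝ (⊤ : ℕ∞) a) (hb : ContDiff ℝ (⊤ : ℕ∞) b)
    (hl : ContDiff ℝ (⊤ : ℕ∞) ℓ) (hβc : ContDiff ℝ (⊤ : ℕ∞) β)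
    (hunit : ∀ t, a t ^ 2 + b t ^ 2 = 1)
    (hdx : ∀ t, deriv x t = -(β t) * b t)
    (hdz : ∀ t, deriv z t = β t * a t)
    (hda : ∀ t, deriv a t = -(ℓ t) * b t)
    (hdb : ∀ t, deriv b t = ℓ t * a t)
    (hc : c ≠ 0)
    -- K = c J : ℓ a = c β x
    (hrel : ∀ t, ℓ t * a t = c * β t * x t)
    (hx0 : x t₀ ≠ 0) (hsing : β t₀ = 0)
    (horda : OrdAt a t₀ (m + 1)) (hordβ : OrdAt β t₀ (n + 1)) (hmn : m ≤ n) :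
    (HasCuspAt (fun t => (x t, z t)) t₀ 2 3 ↔ (m = 0 ∧ n = 0)) ∧
    (HasCuspAt (fun t => (x t, z t)) t₀ 3 4 ↔ (m = 1 ∧ n = 1)) ∧
    (HasCuspAt (fun t => (x t, z t)) t₀ 3 5 ↔ (m = 0 ∧ n = 1)) ∧
    ¬ HasCuspAt (fun t => (x t, z t)) t₀ 2 5 := by
  have hxd : Differentiable ℝ x := hx.differentiable (by simp)
  have hzd : Differentiable ℝ z := hz.differentiable (by simp)
  have ha0 : a t₀ = 0 := by simpa using horda.1 0 (by omega)
  have hb0 : b t₀ ≠ 0 := by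
    intro h; have := hunit t₀; rw [ha0, h] at this; norm_num at this
  -- first integral
  have hfi : ∀ t, b t ^ 2 + c * x t ^ 2 = b t₀ ^ 2 + c * x t₀ ^ 2 := by
    have hd : ∀ t, HasDerivAt (fun t => b t ^ 2 + c * x t ^ 2) 0 t := by
      intro t
      have h1 : HasDerivAt b (ℓ t * a t) t := by
        rw [← hdb]; exact (hb.differentiable (by simp) t).hasDerivAt
      have h2 : HasDerivAt x (-(β t) * b t) t := by
        rw [← hdx]; exact (hxd t).hasDerivAt
      have h3 := (h1.pow 2).add ((h2.pow 2).const_mul c)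
      refine h3.congr_deriv ?_
      rw [hrel]; simp; ring
    intro t
    exact is_const_of_deriv_eq_zero (fun t => (hd t).differentiableAt) (fun t => (hd t).deriv) t t₀
  have hax : ∀ t, a t ^ 2 = c * (x t ^ 2 - x t₀ ^ 2) := by
    intro t
    have h1 := hfi t
    have h2 := hunit t
    have h3 := hunit t₀
    rw [ha0] at h3
    linarith
  have hLa := horda.hLead ha
  have hLβ := hordβ.hLead hβc
  have hLx : HLead (fun t => x t - x t₀) t₀ (n + 2) := by
    refine HLead.integrate (k := n + 1) hxd ?_
    have h1 : deriv x = fun t => β t * (-b t) := by ext t; rw [hdx]; ring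
    rw [h1]
    exact hLβ.mul (HLead.of_cont (f := fun t => -b t) hb.continuous.neg.continuousAt
      (neg_ne_zero.2 hb0))
  have hLz : HLead (fun t => z t - z t₀) t₀ (n + m + 3) := by
    have h2 : n + m + 3 = (n + 1 + (m + 1)) + 1 := by ring
    rw [h2]
    refine HLead.integrate hzd ?_
    have h1 : deriv z = fun t => β t * a t := by ext t; rw [hdz]
    rw [h1]
    exact hLβ.mul hLa
  have hnm : n = 2 * m := by
    have h1 := hLa.mul hLa
    have h2 : HLead (fun t => (x t - x t₀) * (c * (x t + x t₀))) t₀ (n + 2) := by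
      refine hLx.mul (l := 0) (HLead.of_cont ?_ ?_)
      · exact (continuous_const.mul (hx.continuous.add continuous_const)).continuousAt
      · exact mul_ne_zero hc (by rw [← two_mul]; exact mul_ne_zero two_ne_zero hx0)
    have h3 : (fun t => (x t - x t₀) * (c * (x t + x t₀))) = fun t => a t * a t := by
      ext t; have := hax t; linear_combination -this
    rw [h3] at h2
    have := h1.unique h2
    omega
  have key : ∀ i j : ℕ, 0 < i → i ≤ j → HasCuspAt (fun t => (x t, z t)) t₀ i j → i = n + 2 :=
    fun i j hi hij H => cusp_mult hx.continuous hz.continuous hi hij H hLx hLz (by omega)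
  refine ⟨⟨fun H => ?_, fun h => ?_⟩, ⟨fun H => ?_, fun h => ?_⟩, ⟨fun H => ?_, fun h => ?_⟩,
    fun H => ?_⟩
  · have := key 2 3 (by omega) (by omega) H
    omega
  · obtain ⟨rfl, -⟩ := h
    exact cusp_normal hx hz ha hb hunit hdz hda hc hrel hx0 ha0
      (by simpa using horda.2) hax
  · have := key 3 4 (by omega) (by omega) H
    omega
  · omega
  · have := key 3 5 (by omega) (by omega) H
    omega
  · omega
  · have := key 2 5 (by omega) (by omega) H
    have h3 : n + m + 3 = 3 := by omega
    rw [h3] at hLz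
    exact not_cusp_five_two hx.continuous hz.continuous H hLz
end
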